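/- arXiv:1807.05772 — 7 statements merged into one kernel-verified Lean document; each statement's English description precedes it below -/
import Mathlib

section
/- Let F be a connected simple graph that is strictly balanced. Let G be a simple graph and let F1 and F2 be two distinct subgraphs of G, each isomorphic to F, whose vertex sets intersect. Then the subgraph H of G with vertex set V(F1) ∪ V(F2) and edge set E(F1) ∪ E(F2) has density strictly greater than the density of F. -/
open scoped Classical
open Filter Asymptotics

/-- `p = (V, E)` is a subgraph of the simple graph `G`: every edge of `p` is an
edge of `G` and both endpoints of every edge of `p` lie in `V`. -/
def IsSubgraphPair {n : ℕ} (G : SimpleGraph (Fin n))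
    (p : Finset (Fin n) × Finset (Sym2 (Fin n))) : Prop :=
  (∀ e ∈ p.2, e ∈ G.edgeSet) ∧ ∀ e ∈ p.2, ∀ v ∈ e, v ∈ p.1

/-- The subgraph pair `p` is isomorphic to the simple graph `F`. -/
def SubgraphIso {k n : ℕ} (F : SimpleGraph (Fin k))
    (p : Finset (Fin n) × Finset (Sym2 (Fin n))) : Prop :=
  ∃ σ : Fin k ↪ Fin n, (p.1 : Set (Fin n)) = Set.range σ ∧
    (p.2 : Set (Sym2 (Fin n))) = Sym2.map σ '' F.edgeSet

/-- The number `G[F]` of subgraphs of `G` isomorphic to `F`. -/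
noncomputable def countSubSG {k n : ℕ} (F : SimpleGraph (Fin k))
    (G : SimpleGraph (Fin n)) : ℕ :=
  Set.ncard {p : Finset (Fin n) × Finset (Sym2 (Fin n)) |
    IsSubgraphPair G p ∧ SubgraphIso F p}

/-- `F` is strictly balanced: its density exceeds that of every nonempty proper
subgraph. -/
def StrictlyBalancedSG {k : ℕ} (F : SimpleGraph (Fin k)) : Prop :=
  ∀ p : Finset (Fin k) × Finset (Sym2 (Fin k)), IsSubgraphPair F p → p.1.Nonempty →
    ¬((p.1 : Set (Fin k)) = Set.univ ∧ (p.2 : Set (Sym2 (Fin k))) = F.edgeSet) →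
    (p.2.card : ℝ) / p.1.card < (F.edgeSet.ncard : ℝ) / k

theorem SubgraphIso.card_vertices {k n : ℕ} {F : SimpleGraph (Fin k)}
    {p : Finset (Fin n) × Finset (Sym2 (Fin n))} (h : SubgraphIso F p) : p.1.card = k := by
  obtain ⟨σ, hV, -⟩ := h
  rw [← Set.ncard_coe_finset, hV, ← Set.image_univ, Set.ncard_image_of_injective _ σ.injective,
    Set.ncard_univ, Nat.card_fin]

theorem SubgraphIso.card_edges {k n : ℕ} {F : SimpleGraph (Fin k)}
    {p : Finset (Fin n) × Finset (Sym2 (Fin n))} (h : SubgraphIso F p) :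
    p.2.card = F.edgeSet.ncard := by
  obtain ⟨σ, -, hE⟩ := h
  rw [← Set.ncard_coe_finset, hE, Set.ncard_image_of_injective _ (Sym2.map.injective σ.injective)]

/-- A nonempty proper subgraph of a copy of a strictly balanced graph `F` is less dense
than `F`. -/
theorem StrictlyBalancedSG.density_lt {k n : ℕ} {F : SimpleGraph (Fin k)}
    (hbal : StrictlyBalancedSG F) {p q : Finset (Fin n) × Finset (Sym2 (Fin n))}
    (hp : SubgraphIso F p) (hqp : q ≤ p) (hq : ∀ e ∈ q.2, ∀ v ∈ e, v ∈ q.1)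
    (hne : q.1.Nonempty) (hproper : q ≠ p) :
    (q.2.card : ℝ) / q.1.card < (F.edgeSet.ncard : ℝ) / k := by
  obtain ⟨σ, hV, hE⟩ := hp
  have hσ := Sym2.map.injective σ.injective
  have hqV : (q.1 : Set (Fin n)) ⊆ Set.range σ := hV ▸ Finset.coe_subset.2 hqp.1
  have hqE : (q.2 : Set (Sym2 (Fin n))) ⊆ Sym2.map σ '' F.edgeSet :=
    hE ▸ Finset.coe_subset.2 hqp.2
  have hcV : (q.1.preimage σ σ.injective.injOn).card = q.1.card := by
    rw [Finset.card_preimage, Finset.filter_true_of_mem fun v hv => hqV hv]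
  have hcE : (q.2.preimage (Sym2.map σ) hσ.injOn).card = q.2.card := by
    rw [Finset.card_preimage, Finset.filter_true_of_mem fun e he =>
      Set.image_subset_range _ _ (hqE he)]
  have key := hbal (q.1.preimage σ σ.injective.injOn, q.2.preimage (Sym2.map σ) hσ.injOn)
    ⟨fun e he => ?_, fun e he v hv => ?_⟩ ?_ ?_
  · rwa [hcV, hcE] at key
  · simp only [Finset.mem_preimage] at he
    obtain ⟨d, hd, heq⟩ := hqE he
    exact hσ heq ▸ hd
  · simp only [Finset.mem_preimage] at he ⊢
    exact hq _ he _ (Sym2.mem_map.2 ⟨v, hv, rfl⟩)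
  · exact Finset.card_pos.1 (hcV ▸ Finset.card_pos.2 hne)
  · rintro ⟨hU, hF⟩
    rw [Finset.coe_preimage] at hU hF
    refine hproper (le_antisymm hqp ⟨fun v hv => ?_, fun e he => ?_⟩)
    · obtain ⟨w, rfl⟩ := hV.subset hv
      exact hU.superset (Set.mem_univ w)
    · obtain ⟨d, hd, rfl⟩ := hE.subset he
      exact hF.superset hd

/-- If F is a connected strictly balanced simple graph and F1 ≠ F2
are two subgraphs of a simple graph G, each isomorphic to F, whose vertex sets
intersect, then the subgraph (V(F1) ∪ V(F2), E(F1) ∪ E(F2)) has density strictly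
greater than the density of F. -/
theorem stmt0 {k : ℕ} (F : SimpleGraph (Fin k)) (hconn : F.Connected)
    (hbal : StrictlyBalancedSG F)
    {n : ℕ} (G : SimpleGraph (Fin n))
    (F1 F2 : Finset (Fin n) × Finset (Sym2 (Fin n)))
    (h1 : IsSubgraphPair G F1) (h2 : IsSubgraphPair G F2)
    (hi1 : SubgraphIso F F1) (hi2 : SubgraphIso F F2)
    (hne : F1 ≠ F2) (hmeet : (F1.1 ∩ F2.1).Nonempty) :
    (F.edgeSet.ncard : ℝ) / k < ((F1.2 ∪ F2.2).card : ℝ) / (F1.1 ∪ F2.1).card := by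
  have hV1 := hi1.card_vertices
  have hV2 := hi2.card_vertices
  have hE1 := hi1.card_edges
  have hE2 := hi2.card_edges
  have key := hbal.density_lt (q := (F1.1 ∩ F2.1, F1.2 ∩ F2.2)) hi1
    ⟨Finset.inter_subset_left, Finset.inter_subset_left⟩
    (fun e he v hv => Finset.mem_inter.2
      ⟨h1.2 e (Finset.mem_inter.1 he).1 v hv, h2.2 e (Finset.mem_inter.1 he).2 v hv⟩)
    hmeet
    (fun h => hne (Prod.ext
      (Finset.eq_of_subset_of_card_le (Finset.inter_eq_left.1 (congrArg Prod.fst h))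
        (hV2.trans hV1.symm).le)
      (Finset.eq_of_subset_of_card_le (Finset.inter_eq_left.1 (congrArg Prod.snd h))
        (hE2.trans hE1.symm).le)))
  have hcV : ((F1.1 ∪ F2.1).card : ℝ) + (F1.1 ∩ F2.1).card = k + k := by
    exact_mod_cast (Finset.card_union_add_card_inter F1.1 F2.1).trans (by rw [hV1, hV2])
  have hcE : ((F1.2 ∪ F2.2).card : ℝ) + (F1.2 ∩ F2.2).card
      = F.edgeSet.ncard + F.edgeSet.ncard := by
    exact_mod_cast (Finset.card_union_add_card_inter F1.2 F2.2).trans (by rw [hE1, hE2])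
  have hI : (0 : ℝ) < (F1.1 ∩ F2.1).card := by exact_mod_cast Finset.card_pos.2 hmeet
  have hU : (0 : ℝ) < (F1.1 ∪ F2.1).card := by
    exact_mod_cast Finset.card_pos.2 (hmeet.mono Finset.inter_subset_union)
  have hk : (0 : ℝ) < k := by linarith
  rw [div_lt_div_iff₀ hI hk] at key
  rw [div_lt_div_iff₀ hk hU, eq_sub_of_add_eq hcV, eq_sub_of_add_eq hcE]
  linarith
end

section
/- Let F be a multigraph with n(F) ≥ 1 vertices, m(F) ≥ 1 edges and density d = m(F)/n(F). For all n ≥ 1 and m ≥ 0, a uniformly random (n,m)-multigraph G satisfies P(G[F] > 0) ≤ (a_F / (n(F)! · m(F)!)) · (m · n^{1/d − 2})^{m(F)}. Consequently, if m = m(n) satisfies m(n) · n^{1/d − 2} → 0 as n → ∞ (i.e. m = o(n^{2 − 1/d})), then the probability that a uniformly random (n, m(n))-multigraph contains at least one sub-multigraph isomorphic to F tends to 0, at rate O((m n^{1/d − 2})^{m(F)}). -/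
open scoped Classical
open Filter Asymptotics

/-- `(S, L)` is a sub-multigraph of the multigraph `E : Fin m → Fin n × Fin n`:
both endpoints of every edge labeled in `L` lie in `S`. -/
def IsSubMG {n m : ℕ} (E : Fin m → Fin n × Fin n)
    (p : Finset (Fin n) × Finset (Fin m)) : Prop :=
  ∀ j ∈ p.2, (E j).1 ∈ p.1 ∧ (E j).2 ∈ p.1

/-- Isomorphism of multigraphs, disregarding edge labels and orientations. -/
def MGIso {k l k' l' : ℕ} (F : Fin l → Fin k × Fin k) (F' : Fin l' → Fin k' × Fin k') : Prop :=
  ∃ (σ : Fin k ≃ Fin k') (τ : Fin l ≃ Fin l'),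
    ∀ j, s((F' (τ j)).1, (F' (τ j)).2) = s(σ (F j).1, σ (F j).2)

/-- The sub-multigraph `p` of `E` is isomorphic to the multigraph `F`. -/
def SubMGIso {k l n m : ℕ} (F : Fin l → Fin k × Fin k)
    (E : Fin m → Fin n × Fin n) (p : Finset (Fin n) × Finset (Fin m)) : Prop :=
  ∃ (σ : Fin k ↪ Fin n) (τ : Fin l ↪ Fin m),
    (p.1 : Set (Fin n)) = Set.range σ ∧ (p.2 : Set (Fin m)) = Set.range τ ∧
    ∀ j, s((E (τ j)).1, (E (τ j)).2) = s(σ (F j).1, σ (F j).2)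

/-- The number `G[F]` of sub-multigraphs of `E` isomorphic to `F`. -/
noncomputable def countSubMG {k l n m : ℕ} (F : Fin l → Fin k × Fin k)
    (E : Fin m → Fin n × Fin n) : ℕ :=
  Set.ncard {p : Finset (Fin n) × Finset (Fin m) | IsSubMG E p ∧ SubMGIso F E p}

/-- `F` is strictly balanced: its density exceeds that of every nonempty proper
sub-multigraph. -/
def StrictlyBalancedMG {k l : ℕ} (F : Fin l → Fin k × Fin k) : Prop :=
  ∀ p : Finset (Fin k) × Finset (Fin l), IsSubMG F p → p.1.Nonempty →
    ¬(p.1 = Finset.univ ∧ p.2 = Finset.univ) →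
    (p.2.card : ℝ) / p.1.card < (l : ℝ) / k

/-- degree of a vertex in a multigraph (a loop counts twice) -/
def degMG {k l : ℕ} (E : Fin l → Fin k × Fin k) (v : Fin k) : ℕ :=
  (Finset.univ.filter fun ji : Fin l × Fin 2 =>
    (if ji.2 = 0 then (E ji.1).1 else (E ji.1).2) = v).card

/-- connectedness of a multigraph -/
def MGConnected {k l : ℕ} (E : Fin l → Fin k × Fin k) : Prop :=
  (SimpleGraph.fromRel fun v w => ∃ j, E j = (v, w)).Connected

/-- weight of a multigraph coming from vertex-degree weights `δ` -/
noncomputable def wMG {n m : ℕ} (δ : ℕ → ℝ) (E : Fin m → Fin n × Fin n) : ℝ :=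
  ∏ v : Fin n, δ (degMG E v)

/-- total weight of all `(n,m)`-multigraphs -/
noncomputable def MGw (n m : ℕ) (δ : ℕ → ℝ) : ℝ :=
  ∑ E : Fin m → Fin n × Fin n, wMG δ E

/-- the entire function `Δ(x) = Σ_d δ(d) x^d / d!` (finite support) -/
noncomputable def DeltaFun (δ : ℕ → ℝ) : ℝ → ℝ :=
  fun x => ∑ᶠ d : ℕ, δ d * x ^ d / d.factorial

/-- A multigraph having a sub-multigraph isomorphic to `F` has one on some `k`-set of vertices and
some `l`-set of edges. -/
lemma exists_subMGIso_of_countSubMG_pos {k l n m : ℕ} {F : Fin l → Fin k × Fin k}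
    {E : Fin m → Fin n × Fin n} (h : 0 < countSubMG F E) :
    ∃ S ∈ Finset.powersetCard k (Finset.univ : Finset (Fin n)),
      ∃ L ∈ Finset.powersetCard l (Finset.univ : Finset (Fin m)), SubMGIso F E (S, L) := by
  obtain ⟨⟨S, L⟩, -, hSL⟩ := Set.nonempty_of_ncard_ne_zero (Nat.pos_iff_ne_zero.mp h)
  obtain ⟨σ, τ, hS, hL, -⟩ := id hSL
  refine ⟨S, ?_, L, ?_, hSL⟩
  · rw [Finset.mem_powersetCard_univ, ← Set.ncard_coe_finset, hS,
      Set.ncard_range_of_injective σ.injective, Nat.card_eq_fintype_card, Fintype.card_fin]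
  · rw [Finset.mem_powersetCard_univ, ← Set.ncard_coe_finset, hL,
      Set.ncard_range_of_injective τ.injective, Nat.card_eq_fintype_card, Fintype.card_fin]

/-- Transporting a copy of `F` on `(S, L)` along enumerations of `S` and `L` gives a multigraph
isomorphic to `F`. -/
lemma exists_mgIso_of_subMGIso {k l n m : ℕ} {F : Fin l → Fin k × Fin k}
    {E : Fin m → Fin n × Fin n} {S : Finset (Fin n)} {L : Finset (Fin m)}
    (eS : S ≃ Fin k) (eL : L ≃ Fin l) (h : SubMGIso F E (S, L)) :
    ∃ E' : Fin l → Fin k × Fin k, MGIso F E' ∧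
      ∀ j : L, E j = ((eS.symm (E' (eL j)).1 : Fin n), (eS.symm (E' (eL j)).2 : Fin n)) := by
  obtain ⟨σ, τ, hS, hL, hE⟩ := h
  dsimp only at hS hL
  have hσ : ∀ v, σ v ∈ S := fun v => by
    rw [← Finset.mem_coe, hS]; exact Set.mem_range_self v
  have hτ : ∀ j, τ j ∈ L := fun j => by
    rw [← Finset.mem_coe, hL]; exact Set.mem_range_self j
  have hmem : ∀ j : L, (E j).1 ∈ S ∧ (E j).2 ∈ S := by
    rintro ⟨j, hj⟩
    rw [← Finset.mem_coe, hL] at hj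
    obtain ⟨i, rfl⟩ := hj
    rcases Sym2.eq_iff.mp (hE i) with ⟨h₁, h₂⟩ | ⟨h₁, h₂⟩ <;>
      exact ⟨h₁ ▸ hσ _, h₂ ▸ hσ _⟩
  have hinjσ : Function.Injective fun v => eS ⟨σ v, hσ v⟩ := fun v w h => by simpa using h
  have hinjτ : Function.Injective fun j => eL ⟨τ j, hτ j⟩ := fun v w h => by simpa using h
  refine ⟨fun i => (eS ⟨_, (hmem (eL.symm i)).1⟩, eS ⟨_, (hmem (eL.symm i)).2⟩),
    ⟨Equiv.ofBijective _ (Finite.injective_iff_bijective.mp hinjσ),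
      Equiv.ofBijective _ (Finite.injective_iff_bijective.mp hinjτ), fun j => ?_⟩, fun j => ?_⟩
  · have := hE j
    simp only [Sym2.eq_iff] at this
    simpa [Sym2.eq_iff] using this
  · simp

/-- The number of multigraphs whose restriction to `(S, L)` is isomorphic to `F`. -/
lemma card_filter_subMGIso_le {k l n m : ℕ} (F : Fin l → Fin k × Fin k)
    {S : Finset (Fin n)} {L : Finset (Fin m)} (hS : S.card = k) (hL : L.card = l) :
    (Finset.univ.filter fun E : Fin m → Fin n × Fin n => SubMGIso F E (S, L)).card ≤
      (Finset.univ.filter fun E' : Fin l → Fin k × Fin k => MGIso F E').card *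
        (n * n) ^ (m - l) := by
  let eS := S.equivFinOfCardEq hS
  let eL := L.equivFinOfCardEq hL
  let extend : (Fin l → Fin k × Fin k) × ({j // j ∉ L} → Fin n × Fin n) →
      Fin m → Fin n × Fin n := fun p j =>
    if hj : j ∈ L then
      ((eS.symm (p.1 (eL ⟨j, hj⟩)).1 : Fin n), (eS.symm (p.1 (eL ⟨j, hj⟩)).2 : Fin n))
    else p.2 ⟨j, hj⟩
  have hcard : Fintype.card ({j // j ∉ L} → Fin n × Fin n) = (n * n) ^ (m - l) := by
    simp [Fintype.card_subtype_compl, hL]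
  rw [← hcard, ← Finset.card_univ, ← Finset.card_product]
  refine (Finset.card_le_card fun E hE => ?_).trans (Finset.card_image_le (f := extend))
  obtain ⟨E', hE', hEE'⟩ := exists_mgIso_of_subMGIso eS eL (Finset.mem_filter.mp hE).2
  refine Finset.mem_image.mpr ⟨(E', fun j => E j), by simpa using hE', ?_⟩
  funext j
  by_cases hj : j ∈ L
  · simpa [extend, hj] using (hEE' ⟨j, hj⟩).symm
  · simp [extend, hj]

/-- Union bound for the number of multigraphs containing a copy of `F`. -/
lemma ncard_countSubMG_pos_le {k l : ℕ} (F : Fin l → Fin k × Fin k) (n m : ℕ) :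
    Set.ncard {E : Fin m → Fin n × Fin n | 0 < countSubMG F E} ≤
      n.choose k * m.choose l *
        (Set.ncard {E' : Fin l → Fin k × Fin k | MGIso F E'} * (n * n) ^ (m - l)) := by
  have hset : {E' : Fin l → Fin k × Fin k | MGIso F E'} =
      ↑(Finset.univ.filter fun E' : Fin l → Fin k × Fin k => MGIso F E') := by simp
  have hsub : {E : Fin m → Fin n × Fin n | 0 < countSubMG F E} ⊆
      ↑((Finset.powersetCard k (Finset.univ : Finset (Fin n)) ×ˢ
        Finset.powersetCard l (Finset.univ : Finset (Fin m))).biUnion fun p =>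
          Finset.univ.filter fun E : Fin m → Fin n × Fin n => SubMGIso F E p) := by
    intro E hE
    obtain ⟨S, hS, L, hL, h⟩ := exists_subMGIso_of_countSubMG_pos hE
    exact Finset.mem_biUnion.mpr ⟨(S, L), Finset.mk_mem_product hS hL, by simpa using h⟩
  refine (Set.ncard_le_ncard hsub (Finset.finite_toSet _)).trans ?_
  rw [Set.ncard_coe_finset, hset, Set.ncard_coe_finset]
  refine (Finset.card_biUnion_le_card_mul _ _ ((Finset.univ.filter fun E' :
    Fin l → Fin k × Fin k => MGIso F E').card * (n * n) ^ (m - l)) ?_).trans_eq ?_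
  · rintro ⟨S, L⟩ hp
    simp only [Finset.mem_product, Finset.mem_powersetCard_univ] at hp
    exact card_filter_subMGIso_le F hp.1 hp.2
  · simp

/-- First-moment bound for the probability of containing a copy of `F`. -/
lemma prob_countSubMG_pos_le {k l : ℕ} (F : Fin l → Fin k × Fin k) (hl : 1 ≤ l)
    {n : ℕ} (m : ℕ) (hn : 1 ≤ n) :
    (Set.ncard {E : Fin m → Fin n × Fin n | 0 < countSubMG F E} : ℝ) / (n : ℝ) ^ (2 * m) ≤
      (Set.ncard {E' : Fin l → Fin k × Fin k | MGIso F E'} : ℝ) / (k.factorial * l.factorial) *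
        ((m : ℝ) * (n : ℝ) ^ ((1 : ℝ) / ((l : ℝ) / k) - 2)) ^ l := by
  have hn₀ : (0 : ℝ) < n := by exact_mod_cast hn
  have hl₀ : (l : ℝ) ≠ 0 := by positivity
  have hbound := ncard_countSubMG_pos_le F n m
  set a := Set.ncard {E' : Fin l → Fin k × Fin k | MGIso F E'}
  rcases lt_or_ge m l with hml | hml
  · rw [Nat.choose_eq_zero_of_lt hml, mul_zero, zero_mul, Nat.le_zero] at hbound
    rw [hbound, Nat.cast_zero, zero_div]
    positivity
  have hpow : ((n : ℝ) ^ ((1 : ℝ) / ((l : ℝ) / k) - 2)) ^ l = (n : ℝ) ^ k / (n : ℝ) ^ (2 * l) := by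
    rw [← Real.rpow_natCast, ← Real.rpow_mul hn₀.le, ← Real.rpow_natCast, ← Real.rpow_natCast,
      ← Real.rpow_sub hn₀]
    congr 1
    push_cast
    field_simp
  have hsplit : (n : ℝ) ^ (2 * m) = (n : ℝ) ^ (2 * l) * ((n : ℝ) * n) ^ (m - l) := by
    rw [← sq, ← pow_mul, ← pow_add]
    congr 1
    omega
  have hbound' : (Set.ncard {E : Fin m → Fin n × Fin n | 0 < countSubMG F E} : ℝ) ≤
      (n.choose k : ℝ) * m.choose l * (a * ((n : ℝ) * n) ^ (m - l)) := by exact_mod_cast hbound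
  rw [mul_pow, hpow, div_le_iff₀ (by positivity), hsplit]
  calc _ ≤ _ := hbound'
    _ ≤ ((n : ℝ) ^ k / k.factorial) * ((m : ℝ) ^ l / l.factorial) *
        (a * ((n : ℝ) * n) ^ (m - l)) := by
      gcongr <;> exact Nat.choose_le_pow_div _ _
    _ = _ := by field_simp

/-- for a fixed multigraph F of density d, the probability that a
uniform random (n,m)-multigraph contains a copy of F is at most
(a_F / (n(F)!·m(F)!)) · (m·n^(1/d−2))^(m(F)); consequently if m(n)·n^(1/d−2) → 0
the probability tends to 0 at rate O((m n^(1/d−2))^(m(F))). -/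
theorem stmt5 {kF lF : ℕ} (F : Fin lF → Fin kF × Fin kF) (hkF : 1 ≤ kF) (hlF : 1 ≤ lF)
    (aF : ℕ) (haF : aF = Set.ncard {E' : Fin lF → Fin kF × Fin kF | MGIso F E'})
    (d : ℝ) (hd : d = (lF : ℝ) / kF) :
    (∀ n m : ℕ, 1 ≤ n →
        (Set.ncard {E : Fin m → Fin n × Fin n | 0 < countSubMG F E} : ℝ) /
            (n : ℝ) ^ (2 * m) ≤
          (aF : ℝ) / (kF.factorial * lF.factorial) *
            ((m : ℝ) * (n : ℝ) ^ ((1 : ℝ) / d - 2)) ^ lF) ∧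
      ∀ m : ℕ → ℕ,
        Tendsto (fun n : ℕ => (m n : ℝ) * (n : ℝ) ^ ((1 : ℝ) / d - 2)) atTop (nhds 0) →
          Tendsto (fun n : ℕ =>
              (Set.ncard {E : Fin (m n) → Fin n × Fin n | 0 < countSubMG F E} : ℝ) /
                (n : ℝ) ^ (2 * m n)) atTop (nhds 0) ∧
            (fun n : ℕ =>
                (Set.ncard {E : Fin (m n) → Fin n × Fin n | 0 < countSubMG F E} : ℝ) /
                  (n : ℝ) ^ (2 * m n)) =O[atTop]
              fun n : ℕ => ((m n : ℝ) * (n : ℝ) ^ ((1 : ℝ) / d - 2)) ^ lF := by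
  subst haF hd
  have hbound := fun n m (hn : 1 ≤ n) => prob_countSubMG_pos_le F hlF m hn
  refine ⟨hbound, fun m hm => ?_⟩
  have hO : (fun n : ℕ =>
      (Set.ncard {E : Fin (m n) → Fin n × Fin n | 0 < countSubMG F E} : ℝ) /
        (n : ℝ) ^ (2 * m n)) =O[atTop]
      fun n : ℕ => ((m n : ℝ) * (n : ℝ) ^ ((1 : ℝ) / ((lF : ℝ) / kF) - 2)) ^ lF := by
    refine IsBigO.of_bound ((Set.ncard {E' : Fin lF → Fin kF × Fin kF | MGIso F E'} : ℝ) /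
      (kF.factorial * lF.factorial)) ?_
    filter_upwards [eventually_ge_atTop 1] with n hn
    rw [Real.norm_of_nonneg (by positivity), Real.norm_of_nonneg (by positivity)]
    exact hbound n (m n) hn
  refine ⟨hO.trans_tendsto ?_, hO⟩
  simpa [zero_pow (Nat.one_le_iff_ne_zero.mp hlF)] using hm.pow lF
end

section
/- Let F be a multigraph with at least one edge, let d = m(F)/n(F) be its density, and let d* = max over nonempty sub-multigraphs H of F of the density of H (the essential density of F). Fix 0 < α < 2 and let m = m(n) satisfy m(n) = O(n^α). Let G be a uniformly random (n, m(n))-multigraph. If α < 2 − 1/d*, then P(G[F] > 0) → 0 as n → ∞ (so asymptotically almost surely G[F] = 0). If α ≥ 2 − 1/d*, then the expected value of G[F] is O(n^{m(F) · (α − 2 + 1/d)}). -/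
open scoped Classical
open Filter Asymptotics

/-- Copies of the multigraph `H : I → V × V` in `E`, given by a vertex map and an injective edge
map that preserves unordered endpoints. -/
noncomputable def mgCopies {V I : Type*} [Fintype V] [Fintype I] {n m : ℕ} (H : I → V × V)
    (E : Fin m → Fin n × Fin n) : Finset ((V → Fin n) × (I ↪ Fin m)) :=
  Finset.univ.filter fun q =>
    ∀ j, s((E (q.2 j)).1, (E (q.2 j)).2) = s(q.1 (H j).1, q.1 (H j).2)

/-- The edges in the range of `τ` have at most two admissible values each; all other edges are
free. -/
theorem card_filter_prescribed_edges_mul_le {V I : Type*} [Fintype I] {n m : ℕ}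
    (H : I → V × V) (σ : V → Fin n) (τ : I ↪ Fin m) :
    (Finset.univ.filter fun E : Fin m → Fin n × Fin n =>
        ∀ j, s((E (τ j)).1, (E (τ j)).2) = s(σ (H j).1, σ (H j).2)).card *
      n ^ (2 * Fintype.card I) ≤ 2 ^ Fintype.card I * n ^ (2 * m) := by
  set A := Finset.univ.filter fun E : Fin m → Fin n × Fin n =>
    ∀ j, s((E (τ j)).1, (E (τ j)).2) = s(σ (H j).1, σ (H j).2) with hA
  let f : (Fin m → Fin n × Fin n) × (I → Fin n × Fin n) →
      (I → Bool) × (Fin m → Fin n × Fin n) := fun x =>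
    (fun j => decide (x.1 (τ j) = (σ (H j).1, σ (H j).2)), Function.extend τ x.2 x.1)
  have hf : Set.InjOn f (A ×ˢ (Finset.univ : Finset (I → Fin n × Fin n)) : Finset _) := by
    rintro ⟨E, g⟩ hE ⟨E', g'⟩ hE' h
    simp only [hA, Finset.coe_product, Set.mem_prod, Finset.mem_coe, Finset.mem_filter,
      Finset.mem_univ, true_and, and_true] at hE hE'
    simp only [f, Prod.mk.injEq] at h
    obtain ⟨hb, hx⟩ := h
    have hg : g = g' := by
      funext j
      have := congrFun hx (τ j)
      rwa [τ.injective.extend_apply, τ.injective.extend_apply] at this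
    have hEE : E = E' := by
      funext e
      by_cases he : ∃ j, τ j = e
      · obtain ⟨j, rfl⟩ := he
        have hb' := congrFun hb j
        have h1 := hE j
        have h2 := hE' j
        rw [Sym2.eq_iff] at h1 h2
        simp only [decide_eq_decide, Prod.ext_iff] at hb'
        apply Prod.ext <;> grind
      · have := congrFun hx e
        rwa [Function.extend_apply' _ _ _ he, Function.extend_apply' _ _ _ he] at this
    rw [hg, hEE]
  have := Finset.card_le_card_of_injOn f (fun _ _ => Finset.mem_coe.2 (Finset.mem_univ _)) hf
  simpa [Finset.card_product, pow_mul, sq] using this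

theorem sum_card_mgCopies_mul_le {V I : Type*} [Fintype V] [Fintype I] (n m : ℕ)
    (H : I → V × V) :
    (∑ E : Fin m → Fin n × Fin n, (mgCopies H E).card) * n ^ (2 * Fintype.card I) ≤
      n ^ Fintype.card V * m ^ Fintype.card I * (2 ^ Fintype.card I * n ^ (2 * m)) := by
  have hswap : ∑ E : Fin m → Fin n × Fin n, (mgCopies H E).card =
      ∑ q : (V → Fin n) × (I ↪ Fin m), (Finset.univ.filter fun E : Fin m → Fin n × Fin n =>
        ∀ j, s((E (q.2 j)).1, (E (q.2 j)).2) = s(q.1 (H j).1, q.1 (H j).2)).card := by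
    simp only [mgCopies, Finset.card_filter]
    exact Finset.sum_comm
  have hcard : Fintype.card ((V → Fin n) × (I ↪ Fin m)) ≤
      n ^ Fintype.card V * m ^ Fintype.card I := by
    have := Nat.descFactorial_le_pow m (Fintype.card I)
    simp only [Fintype.card_prod, Fintype.card_fun, Fintype.card_embedding_eq, Fintype.card_fin]
    gcongr
  rw [hswap, Finset.sum_mul]
  refine (Finset.sum_le_card_nsmul _ _ _ fun q _ =>
    card_filter_prescribed_edges_mul_le H q.1 q.2).trans ?_
  rw [smul_eq_mul, Finset.card_univ]
  gcongr

/-- The expected number of copies of a multigraph with `v` vertices and `e` edges is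
`O(n ^ (v + e (α - 2)))`. -/
theorem expected_mgCopies_isBigO {V I : Type*} [Fintype V] [Fintype I] (H : I → V × V)
    {α : ℝ} {m : ℕ → ℕ}
    (hm : (fun n : ℕ => (m n : ℝ)) =O[atTop] fun n : ℕ => (n : ℝ) ^ α) :
    (fun n : ℕ => (∑ E : Fin (m n) → Fin n × Fin n, ((mgCopies H E).card : ℝ)) /
        (n : ℝ) ^ (2 * m n)) =O[atTop]
      fun n : ℕ => (n : ℝ) ^ ((Fintype.card V : ℝ) + Fintype.card I * (α - 2)) := by
  obtain ⟨C, hC⟩ := hm.bound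
  refine IsBigO.of_bound (C ^ Fintype.card I * 2 ^ Fintype.card I) ?_
  filter_upwards [hC, eventually_gt_atTop 0] with n hn hn0
  have hnR : (0 : ℝ) < n := by exact_mod_cast hn0
  rw [Real.norm_of_nonneg (by positivity), Real.norm_of_nonneg (by positivity)] at *
  have key : (∑ E : Fin (m n) → Fin n × Fin n, ((mgCopies H E).card : ℝ)) *
      (n : ℝ) ^ (2 * Fintype.card I) ≤ (n : ℝ) ^ Fintype.card V * (m n : ℝ) ^ Fintype.card I *
        (2 ^ Fintype.card I * (n : ℝ) ^ (2 * m n)) := by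
    exact_mod_cast sum_card_mgCopies_mul_le n (m n) H
  have hexp : (n : ℝ) ^ ((Fintype.card V : ℝ) + Fintype.card I * (α - 2)) *
      (n : ℝ) ^ (2 * Fintype.card I) =
      (n : ℝ) ^ Fintype.card V * ((n : ℝ) ^ α) ^ Fintype.card I := by
    rw [← Real.rpow_mul_natCast hnR.le, ← Real.rpow_natCast, ← Real.rpow_natCast,
      ← Real.rpow_add hnR, ← Real.rpow_add hnR]
    congr 1
    push_cast
    ring
  rw [div_le_iff₀ (by positivity)]
  refine le_of_mul_le_mul_right (key.trans ?_)
    (show (0 : ℝ) < (n : ℝ) ^ (2 * Fintype.card I) by positivity)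
  calc (n : ℝ) ^ Fintype.card V * (m n : ℝ) ^ Fintype.card I *
        (2 ^ Fintype.card I * (n : ℝ) ^ (2 * m n))
      ≤ (n : ℝ) ^ Fintype.card V * (C * (n : ℝ) ^ α) ^ Fintype.card I *
        (2 ^ Fintype.card I * (n : ℝ) ^ (2 * m n)) := by gcongr
    _ = C ^ Fintype.card I * 2 ^ Fintype.card I * (n : ℝ) ^ (2 * m n) *
        ((n : ℝ) ^ Fintype.card V * ((n : ℝ) ^ α) ^ Fintype.card I) := by rw [mul_pow]; ring
    _ = _ := by rw [← hexp]; ring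

theorem countSubMG_le_card_mgCopies {k l n m : ℕ} (F : Fin l → Fin k × Fin k)
    (E : Fin m → Fin n × Fin n) : countSubMG F E ≤ (mgCopies F E).card := by
  let f : (Fin k → Fin n) × (Fin l ↪ Fin m) → Finset (Fin n) × Finset (Fin m) := fun q =>
    (Finset.univ.image q.1, Finset.univ.image q.2)
  have hsub : {p : Finset (Fin n) × Finset (Fin m) | IsSubMG E p ∧ SubMGIso F E p} ⊆
      ((mgCopies F E).image f : Finset _) := by
    rintro ⟨S, L⟩ ⟨-, σ, τ, hS, hL, h⟩
    refine Finset.mem_coe.2 (Finset.mem_image.2 ⟨(σ, τ), by simpa [mgCopies] using h, ?_⟩)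
    apply Prod.ext <;> apply Finset.coe_injective
    · simpa [f] using hS.symm
    · simpa [f] using hL.symm
  refine (Set.ncard_le_ncard hsub (Finset.finite_toSet _)).trans ?_
  rw [Set.ncard_coe_finset]
  exact Finset.card_image_le

/-- The sub-multigraph `p` of `F` as a multigraph on the subtypes of its vertices and edges. -/
def IsSubMG.restrict {k l : ℕ} {F : Fin l → Fin k × Fin k}
    {p : Finset (Fin k) × Finset (Fin l)} (hp : IsSubMG F p) : p.2 → p.1 × p.1 :=
  fun j => (⟨(F j).1, (hp j j.2).1⟩, ⟨(F j).2, (hp j j.2).2⟩)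

theorem IsSubMG.mgCopies_restrict_nonempty {k l n m : ℕ} {F : Fin l → Fin k × Fin k}
    {p : Finset (Fin k) × Finset (Fin l)} (hp : IsSubMG F p) {E : Fin m → Fin n × Fin n}
    (hE : 0 < countSubMG F E) : (mgCopies hp.restrict E).Nonempty := by
  obtain ⟨q, hq⟩ := Finset.card_pos.1 (hE.trans_le (countSubMG_le_card_mgCopies F E))
  refine ⟨(fun v => q.1 v, (Function.Embedding.subtype _).trans q.2), ?_⟩
  simp only [mgCopies, Finset.mem_filter, Finset.mem_univ, true_and] at hq ⊢
  exact fun j => hq j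

theorem IsSubMG.ncard_countSubMG_pos_le {k l n m : ℕ} {F : Fin l → Fin k × Fin k}
    {p : Finset (Fin k) × Finset (Fin l)} (hp : IsSubMG F p) :
    Set.ncard {E : Fin m → Fin n × Fin n | 0 < countSubMG F E} ≤
      ∑ E : Fin m → Fin n × Fin n, (mgCopies hp.restrict E).card := by
  rw [Set.ncard_eq_toFinset_card', Finset.card_eq_sum_ones]
  refine (Finset.sum_le_sum fun E hE => ?_).trans
    (Finset.sum_le_sum_of_subset (Finset.subset_univ _))
  exact Finset.card_pos.2 (hp.mgCopies_restrict_nonempty (by simpa using hE))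

/-- The essential density of a multigraph with at least one edge is positive and is attained. -/
theorem exists_isSubMG_eq_sSup_density {k l : ℕ} (F : Fin l → Fin k × Fin k) (hl : 1 ≤ l) :
    ∃ p : Finset (Fin k) × Finset (Fin l), IsSubMG F p ∧ 0 < p.1.card ∧ 0 < p.2.card ∧
      sSup {r : ℝ | ∃ p : Finset (Fin k) × Finset (Fin l),
        IsSubMG F p ∧ p.1.Nonempty ∧ r = (p.2.card : ℝ) / p.1.card} =
        (p.2.card : ℝ) / p.1.card := by
  set D := {r : ℝ | ∃ p : Finset (Fin k) × Finset (Fin l),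
    IsSubMG F p ∧ p.1.Nonempty ∧ r = (p.2.card : ℝ) / p.1.card} with hD
  have hk : 0 < k := Fin.pos (F ⟨0, hl⟩).1
  have hfin : D.Finite := by
    refine (Set.finite_range fun p : Finset (Fin k) × Finset (Fin l) =>
      (p.2.card : ℝ) / p.1.card).subset ?_
    rintro r ⟨p, -, -, rfl⟩
    exact ⟨p, rfl⟩
  have hmem : (l : ℝ) / k ∈ D :=
    ⟨(Finset.univ, Finset.univ), fun j _ => by simp, ⟨⟨0, hk⟩, Finset.mem_univ _⟩, by simp⟩
  obtain ⟨p, hp, hne, hpD⟩ := Set.Nonempty.csSup_mem ⟨_, hmem⟩ hfin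
  refine ⟨p, hp, hne.card_pos, ?_, hpD⟩
  have hle := le_csSup hfin.bddAbove hmem
  have hpos : (0 : ℝ) < (l : ℝ) / k := by positivity
  rw [hpD] at hle
  by_contra h0
  simp only [not_lt, nonpos_iff_eq_zero] at h0
  rw [h0] at hle
  simp only [Nat.cast_zero, zero_div] at hle
  linarith

/-- essential-density threshold for a sub-multigraph F in a uniform
random (n, m(n))-multigraph with m(n) = O(n^α): below 2 − 1/d* the probability of
containing a copy of F tends to 0; above it the expected number of copies is
O(n^(m(F)(α − 2 + 1/d))). -/
theorem stmt6 {kF lF : ℕ} (F : Fin lF → Fin kF × Fin kF) (hlF : 1 ≤ lF)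
    (d : ℝ) (hd : d = (lF : ℝ) / kF)
    (dstar : ℝ)
    (hdstar : dstar = sSup {r : ℝ | ∃ p : Finset (Fin kF) × Finset (Fin lF),
        IsSubMG F p ∧ p.1.Nonempty ∧ r = (p.2.card : ℝ) / p.1.card})
    (α : ℝ) (hα0 : 0 < α) (hα2 : α < 2)
    (m : ℕ → ℕ)
    (hm : (fun n : ℕ => (m n : ℝ)) =O[atTop] fun n : ℕ => (n : ℝ) ^ α) :
    (α < 2 - 1 / dstar →
      Tendsto (fun n : ℕ =>
          (Set.ncard {E : Fin (m n) → Fin n × Fin n | 0 < countSubMG F E} : ℝ) /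
            (n : ℝ) ^ (2 * m n)) atTop (nhds 0)) ∧
    (2 - 1 / dstar ≤ α →
      (fun n : ℕ =>
          (∑ E : Fin (m n) → Fin n × Fin n, (countSubMG F E : ℝ)) /
            (n : ℝ) ^ (2 * m n))
        =O[atTop] fun n : ℕ => (n : ℝ) ^ ((lF : ℝ) * (α - 2 + 1 / d))) := by
  refine ⟨fun hα => ?_, fun _ => ?_⟩
  · obtain ⟨p, hp, hS, hL, hpD⟩ := exists_isSubMG_eq_sSup_density F hlF
    rw [hdstar, hpD, one_div_div] at hα
    have hSR : (0 : ℝ) < p.1.card := by exact_mod_cast hS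
    have hLR : (0 : ℝ) < p.2.card := by exact_mod_cast hL
    have hexp : (p.1.card : ℝ) + p.2.card * (α - 2) < 0 := by
      have : (p.1.card : ℝ) / p.2.card < 2 - α := by linarith
      rw [div_lt_iff₀ hLR] at this
      linarith
    have hO := expected_mgCopies_isBigO hp.restrict hm
    simp only [Fintype.card_coe] at hO
    have hlim := (tendsto_rpow_neg_atTop (neg_pos.2 hexp)).comp
      (tendsto_natCast_atTop_atTop (R := ℝ))
    simp only [neg_neg, Function.comp_def] at hlim
    refine squeeze_zero (fun n => by positivity) (fun n => ?_) (hO.trans_tendsto hlim)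
    gcongr
    exact_mod_cast hp.ncard_countSubMG_pos_le (n := n) (m := m n)
  · have hk : 0 < kF := Fin.pos (F ⟨0, hlF⟩).1
    have hO := expected_mgCopies_isBigO F hm
    have hexp : (lF : ℝ) * (α - 2 + 1 / d) = (kF : ℝ) + lF * (α - 2) := by
      have hl0 : (lF : ℝ) ≠ 0 := by positivity
      rw [hd, one_div_div]
      field_simp
      ring
    simp only [Fintype.card_fin] at hO
    rw [hexp]
    refine IsBigO.trans (IsBigO.of_norm_le fun n => ?_) hO
    rw [Real.norm_of_nonneg (by positivity)]
    gcongr with E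
    exact countSubMG_le_card_mgCopies F E
end

section
/- Let F be a simple graph with at least one edge, let d = m(F)/n(F) be its density, and let d* = max over nonempty subgraphs H of F of the density of H (the essential density of F). Fix 0 < α < 2 and let m = m(n) satisfy m(n) = O(n^α) and m(n) ≤ choose(n,2) for all n. Let G be a uniformly random (n, m(n))-graph. If α < 2 − 1/d*, then P(G[F] > 0) → 0 as n → ∞ (so asymptotically almost surely G[F] = 0). If α ≥ 2 − 1/d*, then the expected value of G[F] is O(n^{m(F) · (α − 2 + 1/d)}). -/
open scoped Classical
open Filter Asymptotics

/-- Each further prescribed element costs a factor `M / N` in the number of `M`-subsets of an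
`N`-set containing the prescribed elements. -/
theorem choose_sub_mul_pow_le {N M : ℕ} (h : M ≤ N) (l : ℕ) (hl : l ≤ M) :
    (N - l).choose (M - l) * N ^ l ≤ M ^ l * N.choose M := by
  induction l with
  | zero => simp
  | succ l ih =>
    obtain ⟨a, rfl⟩ : ∃ a, M = a + (l + 1) := ⟨M - (l + 1), by omega⟩
    obtain ⟨b, rfl⟩ : ∃ b, N = b + a + (l + 1) := ⟨N - (a + (l + 1)), by omega⟩
    have ih := ih (by omega)
    rw [show b + a + (l + 1) - l = b + a + 1 by omega, show a + (l + 1) - l = a + 1 by omega] at ih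
    rw [show b + a + (l + 1) - (l + 1) = b + a by omega, show a + (l + 1) - (l + 1) = a by omega]
    have hc := Nat.add_one_mul_choose_eq (b + a) a
    refine Nat.le_of_mul_le_mul_left ?_ (by omega : 0 < b + a + 1)
    calc (b + a + 1) * ((b + a).choose a * (b + a + (l + 1)) ^ (l + 1))
        = ((b + a + 1) * (b + a).choose a) * (b + a + (l + 1)) ^ (l + 1) := by ring
      _ = ((b + a + (l + 1)) * (a + 1)) *
            ((b + a + 1).choose (a + 1) * (b + a + (l + 1)) ^ l) := by rw [hc]; ring
      _ ≤ ((b + a + 1) * (a + (l + 1))) *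
            ((a + (l + 1)) ^ l * (b + a + (l + 1)).choose (a + (l + 1))) := by
          refine Nat.mul_le_mul ?_ ih
          nlinarith [Nat.zero_le (b * l)]
      _ = _ := by ring

/-- The number of graphs with `M` edges on `Fin n` that contain a given graph `K`. -/
theorem card_graphs_containing_mul_pow_le {n M : ℕ} (K : SimpleGraph (Fin n))
    (hM : M ≤ n.choose 2) :
    (Finset.univ.filter fun G : SimpleGraph (Fin n) => G.edgeSet.ncard = M ∧ K ≤ G).card *
        (n.choose 2) ^ K.edgeSet.ncard ≤
      M ^ K.edgeSet.ncard * (n.choose 2).choose M := by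
  have hcard : ∀ G : SimpleGraph (Fin n), G.edgeSet.ncard = G.edgeFinset.card := fun G => by
    rw [← SimpleGraph.coe_edgeFinset, Set.ncard_coe_finset]
  by_cases hl : K.edgeSet.ncard ≤ M
  · refine le_trans (Nat.mul_le_mul_right _ ?_) (choose_sub_mul_pow_le hM _ hl)
    have htop : ((⊤ : SimpleGraph (Fin n)).edgeFinset \ K.edgeFinset).card =
        n.choose 2 - K.edgeSet.ncard := by
      rw [Finset.card_sdiff_of_subset (SimpleGraph.edgeFinset_mono le_top), hcard,
        SimpleGraph.card_edgeFinset_top_eq_card_choose_two, Fintype.card_fin]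
    rw [← htop, ← Finset.card_powersetCard]
    refine Finset.card_le_card_of_injOn (fun G => G.edgeFinset \ K.edgeFinset) ?_ ?_
    · intro G hG
      simp only [Finset.coe_filter, Finset.mem_univ, true_and, Set.mem_ofPred_eq] at hG
      simp only [Finset.mem_coe, Finset.mem_powersetCard]
      refine ⟨Finset.sdiff_subset_sdiff (SimpleGraph.edgeFinset_mono le_top) le_rfl, ?_⟩
      rw [Finset.card_sdiff_of_subset (SimpleGraph.edgeFinset_mono hG.2), ← hcard, ← hcard, hG.1]
    · intro G hG G' hG' h
      simp only [Finset.coe_filter, Finset.mem_univ, true_and, Set.mem_ofPred_eq] at hG hG'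
      have h1 := Finset.sdiff_union_of_subset (SimpleGraph.edgeFinset_mono hG.2)
      have h2 := Finset.sdiff_union_of_subset (SimpleGraph.edgeFinset_mono hG'.2)
      simp only at h
      rw [h, h2] at h1
      exact (SimpleGraph.edgeFinset_inj.1 h1).symm
  · rw [Finset.filter_eq_empty_iff.2]
    · simp
    · rintro G - ⟨h, hK⟩
      apply hl
      rw [← h]
      exact Set.ncard_le_ncard (SimpleGraph.edgeSet_mono hK) (Set.toFinite _)

/-- The number of embeddings of the vertices of `H` into `Fin n` that carry `H` into `G`. -/
noncomputable def embCount {β : Type*} [Fintype β] {n : ℕ} (H : SimpleGraph β)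
    (G : SimpleGraph (Fin n)) : ℕ :=
  (Finset.univ.filter fun f : β ↪ Fin n => H.map f ≤ G).card

theorem ncard_edgeSet_map {β γ : Type*} (H : SimpleGraph β) (f : β ↪ γ) :
    (H.map f).edgeSet.ncard = H.edgeSet.ncard := by
  rw [SimpleGraph.edgeSet_map]
  exact Set.ncard_image_of_injective _ f.sym2Map.injective

/-- First moment bound for the number of embeddings of `H` in a random graph. -/
theorem sum_embCount_div_le {β : Type*} [Fintype β] {n M : ℕ} (H : SimpleGraph β) (hn : 2 ≤ n)
    (hM : M ≤ n.choose 2) :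
    (∑ G : SimpleGraph (Fin n), if G.edgeSet.ncard = M then (embCount H G : ℝ) else 0) /
        ((n.choose 2).choose M : ℝ) ≤
      (n : ℝ) ^ Fintype.card β * ((M : ℝ) / (n.choose 2 : ℝ)) ^ H.edgeSet.ncard := by
  have hN : (0 : ℝ) < (n.choose 2 : ℝ) := by exact_mod_cast Nat.choose_pos hn
  have hC : (0 : ℝ) < ((n.choose 2).choose M : ℝ) := by exact_mod_cast Nat.choose_pos hM
  rw [div_le_iff₀ hC]
  have hswap : (∑ G : SimpleGraph (Fin n),
      if G.edgeSet.ncard = M then (embCount H G : ℝ) else 0) =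
      ∑ f : β ↪ Fin n, ((Finset.univ.filter fun G : SimpleGraph (Fin n) =>
        G.edgeSet.ncard = M ∧ H.map f ≤ G).card : ℝ) := by
    simp only [embCount, Finset.card_filter, Nat.cast_sum, Nat.cast_ite, Nat.cast_one,
      Nat.cast_zero]
    rw [Finset.sum_comm]
    refine Finset.sum_congr rfl fun G _ => ?_
    split_ifs with h <;> simp [h]
  have hterm : ∀ f : β ↪ Fin n, ((Finset.univ.filter fun G : SimpleGraph (Fin n) =>
        G.edgeSet.ncard = M ∧ H.map f ≤ G).card : ℝ) ≤
      ((M : ℝ) / (n.choose 2 : ℝ)) ^ H.edgeSet.ncard * ((n.choose 2).choose M : ℝ) := by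
    intro f
    have h := card_graphs_containing_mul_pow_le (H.map f) hM
    rw [ncard_edgeSet_map] at h
    rw [div_pow, div_mul_eq_mul_div, le_div_iff₀ (by positivity)]
    exact_mod_cast h
  rw [hswap]
  refine (Finset.sum_le_sum fun f _ => hterm f).trans ?_
  rw [Finset.sum_const, nsmul_eq_mul, mul_assoc]
  refine mul_le_mul_of_nonneg_right ?_ (by positivity)
  have h : Fintype.card (β ↪ Fin n) ≤ n ^ Fintype.card β := by
    rw [Fintype.card_embedding_eq, Fintype.card_fin]
    exact Nat.descFactorial_le_pow _ _
  rw [Finset.card_univ]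
  exact_mod_cast h

theorem pow_mul_edge_density_pow_isBigO {α : ℝ} {m : ℕ → ℕ}
    (hm : (fun n : ℕ => (m n : ℝ)) =O[atTop] fun n : ℕ => (n : ℝ) ^ α) (v e : ℕ) :
    (fun n : ℕ => (n : ℝ) ^ v * ((m n : ℝ) / (n.choose 2 : ℝ)) ^ e) =O[atTop]
      fun n : ℕ => (n : ℝ) ^ ((v : ℝ) + e * (α - 2)) := by
  have hinv : (fun n : ℕ => ((n.choose 2 : ℝ))⁻¹) =O[atTop] fun n : ℕ => (n : ℝ) ^ (-2 : ℝ) := by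
    refine IsBigO.of_bound 4 ?_
    filter_upwards [eventually_ge_atTop 2] with n hn
    have hn' : (2 : ℝ) ≤ n := by exact_mod_cast hn
    rw [Real.rpow_neg (by positivity), Real.rpow_two, norm_inv, norm_inv, Nat.cast_choose_two,
      Real.norm_of_nonneg (by nlinarith), Real.norm_of_nonneg (by positivity),
      ← div_eq_mul_inv, inv_le_comm₀ (by nlinarith) (by positivity), inv_div]
    nlinarith
  have h := (isBigO_refl (fun n : ℕ => (n : ℝ) ^ v) atTop).mul ((hm.mul hinv).pow e)
  refine h.congr' (Eventually.of_forall fun n => by simp [div_eq_mul_inv]) ?_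
  filter_upwards [eventually_gt_atTop 0] with n hn
  have hn' : (0 : ℝ) < n := by exact_mod_cast hn
  rw [← Real.rpow_add hn', ← Real.rpow_natCast, ← Real.rpow_natCast, ← Real.rpow_mul hn'.le,
    ← Real.rpow_add hn']
  congr 1
  ring

/-- The expected number of embeddings of `H` in a random graph with `O(n ^ α)` edges. -/
theorem expected_embCount_isBigO {β : Type*} [Fintype β] (H : SimpleGraph β) {α : ℝ} {m : ℕ → ℕ}
    (hmle : ∀ n, m n ≤ n.choose 2)
    (hm : (fun n : ℕ => (m n : ℝ)) =O[atTop] fun n : ℕ => (n : ℝ) ^ α) :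
    (fun n : ℕ => (∑ G : SimpleGraph (Fin n),
        if G.edgeSet.ncard = m n then (embCount H G : ℝ) else 0) /
          ((n.choose 2).choose (m n) : ℝ)) =O[atTop]
      fun n : ℕ => (n : ℝ) ^ ((Fintype.card β : ℝ) + H.edgeSet.ncard * (α - 2)) := by
  refine IsBigO.trans (IsBigO.of_bound' ?_)
    (pow_mul_edge_density_pow_isBigO hm (Fintype.card β) H.edgeSet.ncard)
  filter_upwards [eventually_ge_atTop 2] with n hn
  rw [Real.norm_of_nonneg (by positivity), Real.norm_of_nonneg (by positivity)]
  exact sum_embCount_div_le H hn (hmle n)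

theorem map_le_of_isSubgraphPair {k n : ℕ} {F : SimpleGraph (Fin k)} {G : SimpleGraph (Fin n)}
    {p : Finset (Fin n) × Finset (Sym2 (Fin n))} (hp : IsSubgraphPair G p) {σ : Fin k ↪ Fin n}
    (hσ : (p.2 : Set (Sym2 (Fin n))) = Sym2.map σ '' F.edgeSet) : F.map σ ≤ G := by
  rw [← SimpleGraph.edgeSet_subset_edgeSet, SimpleGraph.edgeSet_map]
  intro e he
  apply hp.1
  rw [← Finset.mem_coe, hσ]
  exact he

theorem countSubSG_le_embCount {k n : ℕ} (F : SimpleGraph (Fin k)) (G : SimpleGraph (Fin n)) :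
    countSubSG F G ≤ embCount F G := by
  rw [countSubSG, embCount]
  have hsub : {p : Finset (Fin n) × Finset (Sym2 (Fin n)) |
      IsSubgraphPair G p ∧ SubgraphIso F p} ⊆
      ((Finset.univ.filter fun f : Fin k ↪ Fin n => F.map f ≤ G).image fun f : Fin k ↪ Fin n =>
        ((Set.range f).toFinset, (Sym2.map f '' F.edgeSet).toFinset) :
          Finset (Finset (Fin n) × Finset (Sym2 (Fin n)))) := by
    rintro ⟨V, E⟩ ⟨hp, σ, hV, hE⟩
    simp only [Finset.coe_image, Finset.coe_filter, Finset.mem_univ, true_and, Set.mem_image,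
      Set.mem_ofPred_eq]
    refine ⟨σ, map_le_of_isSubgraphPair hp hE, ?_⟩
    simp only [Prod.mk.injEq]
    exact ⟨by rw [← Finset.coe_inj, hV, Set.coe_toFinset],
      by rw [← Finset.coe_inj, hE, Set.coe_toFinset]⟩
  refine (Set.ncard_le_ncard hsub (Finset.finite_toSet _)).trans ?_
  rw [Set.ncard_coe_finset]
  exact Finset.card_image_le

/-- The subgraph pair `p` as a simple graph on its own vertices. -/
def pairGraph {k : ℕ} (p : Finset (Fin k) × Finset (Sym2 (Fin k))) : SimpleGraph p.1 :=
  SimpleGraph.fromEdgeSet {e | Sym2.map Subtype.val e ∈ p.2}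

theorem ncard_edgeSet_pairGraph {k : ℕ} {F : SimpleGraph (Fin k)}
    {p : Finset (Fin k) × Finset (Sym2 (Fin k))} (hp : IsSubgraphPair F p) :
    (pairGraph p).edgeSet.ncard = p.2.card := by
  rw [← Set.ncard_coe_finset,
    ← Set.ncard_image_of_injective _ (Sym2.map.injective Subtype.val_injective)]
  congr 1
  ext e
  induction e with | _ a b =>
  constructor
  · rintro ⟨e', he', h⟩
    rw [← h]
    rw [pairGraph, SimpleGraph.edgeSet_fromEdgeSet] at he'
    exact he'.1
  · intro he
    have ha := hp.2 _ he a (Sym2.mem_mk_left a b)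
    have hb := hp.2 _ he b (Sym2.mem_mk_right a b)
    refine ⟨s(⟨a, ha⟩, ⟨b, hb⟩), ?_, rfl⟩
    rw [pairGraph, SimpleGraph.mem_edgeSet, SimpleGraph.fromEdgeSet_adj]
    refine ⟨he, fun h => ?_⟩
    have hadj : F.Adj a b := hp.1 _ he
    exact hadj.ne (congrArg Subtype.val h)

theorem embCount_pairGraph_pos {k n : ℕ} {F : SimpleGraph (Fin k)}
    {p : Finset (Fin k) × Finset (Sym2 (Fin k))} (hp : IsSubgraphPair F p)
    {G : SimpleGraph (Fin n)} (h : 0 < countSubSG F G) : 0 < embCount (pairGraph p) G := by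
  obtain ⟨q, hq, σ, -, hE⟩ := (Set.ncard_pos (Set.toFinite _)).1 h
  have hle := map_le_of_isSubgraphPair hq hE
  refine Finset.card_pos.2 ⟨(Function.Embedding.subtype _).trans σ, ?_⟩
  simp only [Finset.mem_filter, Finset.mem_univ, true_and]
  refine le_trans ?_ hle
  rw [SimpleGraph.map_le_iff_le_comap]
  intro a b hab
  have hF : F.Adj a b := hp.1 _ ((SimpleGraph.fromEdgeSet_adj _).1 hab).1
  simpa using hF

/-- Some subgraph attains the essential density, which is positive. -/
theorem exists_subgraph_density_eq_sSup {k : ℕ} (F : SimpleGraph (Fin k))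
    (hedge : 0 < F.edgeSet.ncard) :
    ∃ p : Finset (Fin k) × Finset (Sym2 (Fin k)), IsSubgraphPair F p ∧ 0 < p.1.card ∧
      0 < p.2.card ∧
      sSup {r : ℝ | ∃ p : Finset (Fin k) × Finset (Sym2 (Fin k)),
        IsSubgraphPair F p ∧ p.1.Nonempty ∧ r = (p.2.card : ℝ) / p.1.card} =
          (p.2.card : ℝ) / p.1.card := by
  set S := {r : ℝ | ∃ p : Finset (Fin k) × Finset (Sym2 (Fin k)),
        IsSubgraphPair F p ∧ p.1.Nonempty ∧ r = (p.2.card : ℝ) / p.1.card} with hS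
  have hfin : S.Finite := by
    refine (Set.finite_range fun p : Finset (Fin k) × Finset (Sym2 (Fin k)) =>
      (p.2.card : ℝ) / p.1.card).subset ?_
    rintro r ⟨p, -, -, rfl⟩
    exact ⟨p, rfl⟩
  obtain ⟨e, he⟩ := (Set.ncard_pos (Set.toFinite _)).1 hedge
  have hne : (Finset.univ : Finset (Fin k)).Nonempty := by
    induction e with | _ a b => exact ⟨a, Finset.mem_univ _⟩
  have hmem : (F.edgeFinset.card : ℝ) / (Finset.univ : Finset (Fin k)).card ∈ S :=
    ⟨(Finset.univ, F.edgeFinset), ⟨fun e he => SimpleGraph.mem_edgeFinset.1 he,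
      fun _ _ _ _ => Finset.mem_univ _⟩, hne, rfl⟩
  have hpos : (0 : ℝ) < (F.edgeFinset.card : ℝ) / (Finset.univ : Finset (Fin k)).card := by
    have h1 : 0 < F.edgeFinset.card := Finset.card_pos.2 ⟨e, SimpleGraph.mem_edgeFinset.2 he⟩
    have h2 := hne.card_pos
    positivity
  have hle := hpos.trans_le (le_csSup hfin.bddAbove hmem)
  obtain ⟨p, hp, hp1, hr⟩ : sSup S ∈ S := Set.Nonempty.csSup_mem ⟨_, hmem⟩ hfin
  refine ⟨p, hp, hp1.card_pos, ?_, hr⟩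
  rw [hr] at hle
  by_contra h0
  simp [Nat.eq_zero_of_not_pos h0] at hle

theorem ncard_le_sum_of_pos {n M : ℕ} {P : SimpleGraph (Fin n) → Prop}
    {X : SimpleGraph (Fin n) → ℕ} (h : ∀ G, P G → 0 < X G) :
    ((Set.ncard {G : SimpleGraph (Fin n) | G.edgeSet.ncard = M ∧ P G} : ℕ) : ℝ) ≤
      ∑ G : SimpleGraph (Fin n), if G.edgeSet.ncard = M then (X G : ℝ) else 0 := by
  rw [Set.ncard_eq_toFinset_card', Set.toFinset_ofPred, Finset.card_filter, Nat.cast_sum]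
  refine Finset.sum_le_sum fun G _ => ?_
  by_cases h1 : G.edgeSet.ncard = M
  · by_cases h2 : P G
    · have : (1 : ℝ) ≤ X G := by exact_mod_cast h G h2
      simpa [h1, h2] using this
    · simp [h1, h2]
  · simp [h1]

/-- essential-density threshold for a subgraph F in a uniform random
(n, m(n))-graph with m(n) = O(n^α): below 2 − 1/d* the probability of containing a
copy of F tends to 0, and in general the expected number of copies is
O(n^(m(F)(α − 2 + 1/d))). -/
theorem stmt7 {k : ℕ} (F : SimpleGraph (Fin k)) (hedge : 0 < F.edgeSet.ncard)
    (d : ℝ) (hd : d = (F.edgeSet.ncard : ℝ) / k)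
    (dstar : ℝ)
    (hdstar : dstar = sSup {r : ℝ | ∃ p : Finset (Fin k) × Finset (Sym2 (Fin k)),
        IsSubgraphPair F p ∧ p.1.Nonempty ∧ r = (p.2.card : ℝ) / p.1.card})
    (α : ℝ) (hα0 : 0 < α) (hα2 : α < 2)
    (m : ℕ → ℕ) (hmle : ∀ n, m n ≤ n.choose 2)
    (hm : (fun n : ℕ => (m n : ℝ)) =O[atTop] fun n : ℕ => (n : ℝ) ^ α) :
    (α < 2 - 1 / dstar →
      Tendsto (fun n : ℕ =>
          (Set.ncard {G : SimpleGraph (Fin n) |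
              G.edgeSet.ncard = m n ∧ 0 < countSubSG F G} : ℝ) /
            ((n.choose 2).choose (m n) : ℝ)) atTop (nhds 0)) ∧
    (2 - 1 / dstar ≤ α →
      (fun n : ℕ =>
          (∑ G : SimpleGraph (Fin n),
            if G.edgeSet.ncard = m n then (countSubSG F G : ℝ) else 0) /
            ((n.choose 2).choose (m n) : ℝ))
        =O[atTop] fun n : ℕ => (n : ℝ) ^ ((F.edgeSet.ncard : ℝ) * (α - 2 + 1 / d))) := by
  refine ⟨fun hα => ?_, fun _ => ?_⟩
  · obtain ⟨p, hp, hv, he, hr⟩ := exists_subgraph_density_eq_sSup F hedge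
    rw [← hdstar] at hr
    have hO := expected_embCount_isBigO (pairGraph p) hmle hm
    rw [ncard_edgeSet_pairGraph hp, Fintype.card_coe] at hO
    have hv' : (0 : ℝ) < p.1.card := by exact_mod_cast hv
    have he' : (0 : ℝ) < p.2.card := by exact_mod_cast he
    have hexp : (p.1.card : ℝ) + p.2.card * (α - 2) < 0 := by
      rw [hr, one_div_div] at hα
      have h := mul_lt_mul_of_pos_left hα he'
      have h' : (p.2.card : ℝ) * (p.1.card / p.2.card) = p.1.card := by field_simp
      rw [mul_sub, h'] at h
      linarith
    have hzero : Tendsto (fun n : ℕ => (n : ℝ) ^ ((p.1.card : ℝ) + p.2.card * (α - 2))) atTop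
        (nhds 0) := by
      have h := (tendsto_rpow_neg_atTop (neg_pos.2 hexp)).comp
        (tendsto_natCast_atTop_atTop (R := ℝ))
      simpa only [neg_neg, Function.comp_def] using h
    refine squeeze_zero (fun n => by positivity) (fun n => ?_) (hO.trans_tendsto hzero)
    gcongr
    exact ncard_le_sum_of_pos fun G => embCount_pairGraph_pos hp
  · have hO := expected_embCount_isBigO F hmle hm
    have hm' : (0 : ℝ) < F.edgeSet.ncard := by exact_mod_cast hedge
    have hexp : (Fintype.card (Fin k) : ℝ) + F.edgeSet.ncard * (α - 2) =
        (F.edgeSet.ncard : ℝ) * (α - 2 + 1 / d) := by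
      rw [hd, one_div_div, Fintype.card_fin]
      field_simp
      ring
    rw [hexp] at hO
    refine IsBigO.trans (IsBigO.of_bound' (Eventually.of_forall fun n => ?_)) hO
    rw [Real.norm_of_nonneg (by positivity), Real.norm_of_nonneg (by positivity)]
    gcongr with G
    split_ifs
    · exact_mod_cast countSubSG_le_embCount F G
    · exact le_rfl
end

section
/- Let F be a simple graph with at least one edge. Then F is strictly balanced if and only if the following holds: for every simple graph G and every pair of distinct subgraphs F1 ≠ F2 of G, each isomorphic to F, whose vertex sets intersect, the subgraph with vertex set V(F1) ∪ V(F2) and edge set E(F1) ∪ E(F2) has density strictly greater than the density of F. -/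
open scoped Classical
open Filter Asymptotics

/-- The copy of `F` in `Fin n` traced out by the embedding `σ`. -/
noncomputable def copyPair {k n : ℕ} (F : SimpleGraph (Fin k)) (σ : Fin k ↪ Fin n) :
    Finset (Fin n) × Finset (Sym2 (Fin n)) :=
  (Finset.univ.image σ, F.edgeFinset.image (Sym2.map σ))

theorem subgraphIso_iff_exists_copyPair {k n : ℕ} {F : SimpleGraph (Fin k)}
    {p : Finset (Fin n) × Finset (Sym2 (Fin n))} :
    SubgraphIso F p ↔ ∃ σ : Fin k ↪ Fin n, p = copyPair F σ := by
  refine exists_congr fun σ => ?_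
  rw [Prod.ext_iff, copyPair, ← Finset.coe_inj, ← Finset.coe_inj]
  simp

theorem card_copyPair_fst {k n : ℕ} (F : SimpleGraph (Fin k)) (σ : Fin k ↪ Fin n) :
    (copyPair F σ).1.card = k := by
  rw [copyPair, Finset.card_image_of_injective _ σ.injective, Finset.card_fin]

theorem card_copyPair_snd {k n : ℕ} (F : SimpleGraph (Fin k)) (σ : Fin k ↪ Fin n) :
    (copyPair F σ).2.card = F.edgeSet.ncard := by
  rw [copyPair, Finset.card_image_of_injective _ (Sym2.map.injective σ.injective),
    ← SimpleGraph.coe_edgeFinset, Set.ncard_coe_finset]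

theorem isSubgraphPair_top_copyPair {k n : ℕ} (F : SimpleGraph (Fin k)) (σ : Fin k ↪ Fin n) :
    IsSubgraphPair ⊤ (copyPair F σ) := by
  constructor <;> intro e he <;> simp only [copyPair, Finset.mem_image] at he <;>
    obtain ⟨f, hf, rfl⟩ := he
  · induction f with
    | _ a b =>
      have hab : a ≠ b := (show F.Adj a b by simpa using hf).ne
      simpa using hab
  · intro v hv
    obtain ⟨a, -, rfl⟩ := Sym2.mem_map.1 hv
    simp [copyPair]

/-- For two graphs with `k` vertices and `l` edges whose intersection has `v` vertices and `e`
edges, the union is denser than each of them iff the intersection is sparser. -/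
theorem density_lt_union_iff {α β : Type*} [DecidableEq α] [DecidableEq β] {A B : Finset α}
    {C D : Finset β} {k l : ℕ} (hk : 0 < k) (hA : A.card = k) (hB : B.card = k)
    (hC : C.card = l) (hD : D.card = l) :
    (l : ℝ) / k < ((C ∪ D).card : ℝ) / (A ∪ B).card ↔
      (k : ℝ) * (C ∩ D).card < l * (A ∩ B).card := by
  have hV : ((A ∪ B).card : ℝ) + (A ∩ B).card = k + k := by
    exact_mod_cast (by rw [Finset.card_union_add_card_inter, hA, hB] :
      (A ∪ B).card + (A ∩ B).card = k + k)
  have hE : ((C ∪ D).card : ℝ) + (C ∩ D).card = l + l := by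
    exact_mod_cast (by rw [Finset.card_union_add_card_inter, hC, hD] :
      (C ∪ D).card + (C ∩ D).card = l + l)
  have hpos : (0 : ℝ) < (A ∪ B).card := by
    have := Finset.card_le_card (Finset.subset_union_left (s₁ := A) (s₂ := B))
    exact_mod_cast (by omega : 0 < (A ∪ B).card)
  rw [div_lt_div_iff₀ (by exact_mod_cast hk) hpos, eq_sub_of_add_eq hV, eq_sub_of_add_eq hE]
  constructor <;> intro h <;> linarith

theorem StrictlyBalancedSG.inter_sparser {k n : ℕ} {F : SimpleGraph (Fin k)}
    (hF : StrictlyBalancedSG F) (hk : 0 < k) {σ τ : Fin k ↪ Fin n}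
    (hne : copyPair F σ ≠ copyPair F τ)
    (hint : ((copyPair F σ).1 ∩ (copyPair F τ).1).Nonempty) :
    (k : ℝ) * ((copyPair F σ).2 ∩ (copyPair F τ).2).card <
      F.edgeSet.ncard * ((copyPair F σ).1 ∩ (copyPair F τ).1).card := by
  set W := Finset.univ.filter fun v => σ v ∈ (copyPair F τ).1 with hW
  set D := F.edgeFinset.filter fun e => Sym2.map σ e ∈ (copyPair F τ).2 with hD
  have hWi : (copyPair F σ).1 ∩ (copyPair F τ).1 = W.image σ := by
    ext x
    simp only [copyPair, Finset.mem_inter, Finset.mem_image, hW, Finset.mem_filter]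
    grind
  have hDi : (copyPair F σ).2 ∩ (copyPair F τ).2 = D.image (Sym2.map σ) := by
    ext x
    simp only [copyPair, Finset.mem_inter, Finset.mem_image, hD, Finset.mem_filter]
    grind
  have hsub : IsSubgraphPair F (W, D) := by
    refine ⟨fun e he => by simpa using (Finset.mem_filter.1 he).1, fun e he v hv => ?_⟩
    exact Finset.mem_filter.2 ⟨Finset.mem_univ v, (isSubgraphPair_top_copyPair F τ).2 _
      (Finset.mem_filter.1 he).2 _ (Sym2.mem_map.2 ⟨v, hv, rfl⟩)⟩
  have hWne : W.Nonempty := by rwa [hWi, Finset.image_nonempty] at hint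
  have hlt := hF (W, D) hsub hWne <| by
    rintro ⟨h₁, h₂⟩
    refine hne (Prod.ext ?_ ?_)
    · refine Finset.eq_of_subset_of_card_le ?_
        (by rw [card_copyPair_fst, card_copyPair_fst])
      have hWu : W = Finset.univ := Finset.coe_eq_univ.1 h₁
      rw [← Finset.inter_eq_left, hWi, hWu, copyPair]
    · refine Finset.eq_of_subset_of_card_le ?_
        (by rw [card_copyPair_snd, card_copyPair_snd])
      have hDu : D = F.edgeFinset := by rw [← Finset.coe_inj, SimpleGraph.coe_edgeFinset]; exact h₂
      rw [← Finset.inter_eq_left, hDi, hDu, copyPair]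
  rw [hWi, hDi, Finset.card_image_of_injective _ σ.injective,
    Finset.card_image_of_injective _ (Sym2.map.injective σ.injective)]
  rw [div_lt_div_iff₀ (by exact_mod_cast hWne.card_pos) (by exact_mod_cast hk)] at hlt
  linarith

/-- Two copies of `Fin k` can be glued along any set `W` of vertices. -/
theorem exists_embeddings_glued_along {k : ℕ} (W : Finset (Fin k)) :
    ∃ σ τ : Fin k ↪ Fin (k + k), (∀ v ∈ W, σ v = τ v) ∧ ∀ v w, σ v = τ w → v ∈ W := by
  refine ⟨Fin.castAddEmb k,
    ⟨fun v => if v ∈ W then Fin.castAdd k v else Fin.natAdd k v, ?_⟩, ?_, ?_⟩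
  · intro v w h
    grind [Fin.ext_iff, Fin.val_castAdd, Fin.val_natAdd]
  · intro v hv
    simp [hv]
  · intro v w h
    by_cases hw : w ∈ W
    · obtain rfl : v = w := by simpa [hw, Fin.ext_iff] using h
      exact hw
    · have := congrArg Fin.val h
      simp [hw] at this
      omega

theorem card_lt_of_density_le {k : ℕ} {F : SimpleGraph (Fin k)} (hk : 0 < k)
    {p : Finset (Fin k) × Finset (Sym2 (Fin k))} (hp : IsSubgraphPair F p)
    (hproper : ¬((p.1 : Set (Fin k)) = Set.univ ∧ (p.2 : Set (Sym2 (Fin k))) = F.edgeSet))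
    (hd : (F.edgeSet.ncard : ℝ) / k ≤ (p.2.card : ℝ) / p.1.card) : p.1.card < k := by
  by_contra! hle
  have huniv : p.1 = Finset.univ := Finset.eq_univ_of_card _
    (le_antisymm (Finset.card_le_univ _) (by simpa using hle))
  refine hproper ⟨by simp [huniv], Set.eq_of_subset_of_ncard_le (fun e he => hp.1 e he) ?_
    (Set.toFinite _)⟩
  rw [huniv, Finset.card_fin, div_le_div_iff_of_pos_right (by exact_mod_cast hk)] at hd
  rw [Set.ncard_coe_finset]
  exact_mod_cast hd

/-- a simple graph F with at least one edge is strictly balanced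
iff every union of two distinct intersecting copies of F (inside any simple
graph G) is strictly denser than F. -/
theorem stmt8 {k : ℕ} (F : SimpleGraph (Fin k)) (hedge : 0 < F.edgeSet.ncard) :
    StrictlyBalancedSG F ↔
      ∀ (n : ℕ) (G : SimpleGraph (Fin n))
        (F1 F2 : Finset (Fin n) × Finset (Sym2 (Fin n))),
        IsSubgraphPair G F1 → IsSubgraphPair G F2 →
        SubgraphIso F F1 → SubgraphIso F F2 → F1 ≠ F2 → (F1.1 ∩ F2.1).Nonempty →
        (F.edgeSet.ncard : ℝ) / k < ((F1.2 ∪ F2.2).card : ℝ) / (F1.1 ∪ F2.1).card := by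
  have hk : 0 < k := by
    obtain ⟨e, -⟩ := Set.nonempty_of_ncard_ne_zero hedge.ne'
    induction e with
    | _ a b => exact a.pos
  constructor
  · intro hF n G F1 F2 _ _ hF1 hF2 hne hint
    obtain ⟨σ, rfl⟩ := subgraphIso_iff_exists_copyPair.1 hF1
    obtain ⟨τ, rfl⟩ := subgraphIso_iff_exists_copyPair.1 hF2
    exact (density_lt_union_iff hk (card_copyPair_fst F σ) (card_copyPair_fst F τ)
      (card_copyPair_snd F σ) (card_copyPair_snd F τ)).2 (hF.inter_sparser hk hne hint)
  · intro h p hp hpne hproper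
    by_contra! hd
    have hcard := card_lt_of_density_le hk hp hproper hd
    obtain ⟨σ, τ, hagree, hmeet⟩ := exists_embeddings_glued_along p.1
    have hV : (copyPair F σ).1 ∩ (copyPair F τ).1 ⊆ p.1.image σ := by
      intro x hx
      simp only [copyPair, Finset.mem_inter, Finset.mem_image] at hx
      obtain ⟨⟨v, -, rfl⟩, w, -, hw⟩ := hx
      exact Finset.mem_image_of_mem _ (hmeet v w hw.symm)
    have hE : p.2.image (Sym2.map σ) ⊆ (copyPair F σ).2 ∩ (copyPair F τ).2 := by
      intro x hx
      obtain ⟨e, he, rfl⟩ := Finset.mem_image.1 hx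
      have heF : e ∈ F.edgeFinset := by simpa using hp.1 e he
      refine Finset.mem_inter.2 ⟨Finset.mem_image_of_mem _ heF, ?_⟩
      rw [Sym2.map_congr fun v hv => hagree v (hp.2 e he v hv)]
      exact Finset.mem_image_of_mem _ heF
    have hVcard := Finset.card_le_card hV
    have hEcard := Finset.card_le_card hE
    rw [Finset.card_image_of_injective _ σ.injective] at hVcard
    rw [Finset.card_image_of_injective _ (Sym2.map.injective σ.injective)] at hEcard
    have hne : copyPair F σ ≠ copyPair F τ := by
      intro heq
      rw [← heq, Finset.inter_self, card_copyPair_fst] at hVcard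
      omega
    have hint : ((copyPair F σ).1 ∩ (copyPair F τ).1).Nonempty := by
      obtain ⟨v, hv⟩ := hpne
      refine ⟨σ v, Finset.mem_inter.2 ⟨by simp [copyPair], ?_⟩⟩
      rw [hagree v hv]
      simp [copyPair]
    have hlt := (density_lt_union_iff hk (card_copyPair_fst F σ) (card_copyPair_fst F τ)
      (card_copyPair_snd F σ) (card_copyPair_snd F τ)).1
      (h _ ⊤ _ _ (isSubgraphPair_top_copyPair F σ) (isSubgraphPair_top_copyPair F τ)
        (subgraphIso_iff_exists_copyPair.2 ⟨σ, rfl⟩)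
        (subgraphIso_iff_exists_copyPair.2 ⟨τ, rfl⟩) hne hint)
    rw [div_le_div_iff₀ (by exact_mod_cast hk) (by exact_mod_cast hpne.card_pos)] at hd
    have hVmul : (F.edgeSet.ncard : ℝ) * ((copyPair F σ).1 ∩ (copyPair F τ).1).card ≤
        F.edgeSet.ncard * p.1.card := by gcongr
    have hEmul : (k : ℝ) * p.2.card ≤
        k * ((copyPair F σ).2 ∩ (copyPair F τ).2).card := by gcongr
    linarith
end

section
/- Let F be a strictly balanced multigraph with n(F) vertices, m(F) ≥ 1 edges and density d = m(F)/n(F), and set α = 2 − 1/d. Let c > 0 and let m = m(n) be a sequence of integers with m(n) → ∞ and m(n)/n^α → c. Let G be a uniformly random (n, m(n))-multigraph. Then G[F] converges in distribution to a Poisson law of parameter λ = a_F · c^{m(F)} / (n(F)! · m(F)!); that is, for every t ∈ ℕ, P(G[F] = t) → λ^t e^{−λ} / t! as n → ∞. -/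
open scoped Classical
open Filter Asymptotics

/-! ### Poisson convergence from factorial moments -/

lemma abs_indicator_sub_alternating_sum_choose_le (s J : ℕ) :
    |(if s = 0 then (1 : ℝ) else 0) - ∑ j ∈ Finset.range J, (-1) ^ j * (s.choose j : ℝ)|
      ≤ s.choose J := by
  cases s with
  | zero =>
    cases J with
    | zero => simp
    | succ J => simp [Finset.sum_range_succ']
  | succ s =>
    cases J with
    | zero => simp
    | succ J =>
      have h := congrArg (Int.cast : ℤ → ℝ)
        (Int.alternating_sum_range_choose_eq_choose (n := s) (m := J))
      push_cast at h
      rw [h]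
      have h2 : s.choose J ≤ (s + 1).choose (J + 1) := by
        rw [Nat.choose_succ_succ]; omega
      simpa [abs_mul] using (by exact_mod_cast h2 : (s.choose J : ℝ) ≤ (s + 1).choose (J + 1))

/-- Bonferroni inequalities for the indicator of `X = t` in terms of factorial powers of `X`. -/
lemma abs_indicator_sub_sum_descFactorial_le (X t J : ℕ) :
    |(if X = t then (1 : ℝ) else 0) - ∑ j ∈ Finset.range J,
        (-1) ^ j * (X.descFactorial (t + j) : ℝ) / (t.factorial * j.factorial)|
      ≤ X.descFactorial (t + J) / (t.factorial * J.factorial) := by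
  rcases lt_or_ge X t with h | h
  · have h0 : ∀ j, X.descFactorial (t + j) = 0 := fun j =>
      Nat.descFactorial_eq_zero_iff_lt.2 (by omega)
    simp [h0, h.ne]
  · obtain ⟨s, rfl⟩ := Nat.exists_eq_add_of_le h
    have key : ∀ j, ((t + s).descFactorial (t + j) : ℝ) / (t.factorial * j.factorial)
        = (t + s).choose t * s.choose j := by
      intro j
      have h1 : (t + s).descFactorial (t + j)
          = (t.factorial * (t + s).choose t) * (j.factorial * s.choose j) := by
        rw [← Nat.descFactorial_eq_factorial_mul_choose,
          ← Nat.descFactorial_eq_factorial_mul_choose, mul_comm]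
        have := Nat.descFactorial_mul_descFactorial (n := t + s) (k := t) (m := t + j) (by omega)
        simpa using this.symm
      rw [h1]
      have := t.factorial_ne_zero
      have := j.factorial_ne_zero
      push_cast
      field_simp
    have h2 : (if t + s = t then (1 : ℝ) else 0)
        = (t + s).choose t * (if s = 0 then (1 : ℝ) else 0) := by
      by_cases hs : s = 0 <;> simp [hs]
    simp_rw [mul_div_assoc, key, h2, mul_left_comm _ ((t + s).choose t : ℝ)]
    rw [← Finset.mul_sum, ← mul_sub, abs_mul, Nat.abs_cast]
    exact mul_le_mul_of_nonneg_left (abs_indicator_sub_alternating_sum_choose_le s J)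
      (Nat.cast_nonneg _)

lemma tendsto_poisson_of_bonferroni {a : ℕ → ℝ} {M : ℕ → ℕ → ℝ} {lam : ℝ} {t : ℕ}
    (hM : ∀ r, Tendsto (M r) atTop (nhds (lam ^ r)))
    (hb : ∀ J, ∀ᶠ n in atTop,
      |a n - ∑ j ∈ Finset.range J, (-1) ^ j * M (t + j) n / (t.factorial * j.factorial)|
        ≤ M (t + J) n / (t.factorial * J.factorial)) :
    Tendsto a atTop (nhds (lam ^ t * Real.exp (-lam) / t.factorial)) := by
  set P : ℕ → ℝ := fun J =>
    ∑ j ∈ Finset.range J, (-1) ^ j * lam ^ (t + j) / (t.factorial * j.factorial) with hP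
  have hPlim : Tendsto P atTop (nhds (lam ^ t * Real.exp (-lam) / t.factorial)) := by
    have h := (NormedSpace.expSeries_div_hasSum_exp (-lam)).tendsto_sum_nat
    rw [← Real.exp_eq_exp_ℝ] at h
    have h2 := h.const_mul (lam ^ t / t.factorial)
    convert h2 using 2
    · rw [hP]
      simp only [Finset.mul_sum]
      refine Finset.sum_congr rfl fun j _ => ?_
      rw [neg_pow lam, pow_add]
      field_simp
    · ring
  have hRlim : Tendsto (fun J : ℕ => lam ^ (t + J) / (t.factorial * J.factorial)) atTop
      (nhds 0) := by
    have h := (FloorSemiring.tendsto_pow_div_factorial_atTop lam).const_mul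
      (lam ^ t / t.factorial)
    rw [mul_zero] at h
    refine h.congr fun J => ?_
    rw [pow_add]
    field_simp
  rw [Metric.tendsto_atTop]
  intro ε hε
  have h3 : (0 : ℝ) < ε / 4 := by positivity
  obtain ⟨J, hJ1, hJ2⟩ := ((Metric.tendsto_nhds.1 hPlim _ h3).and
    (hRlim.eventually (gt_mem_nhds h3))).exists
  have hS : Tendsto (fun n => ∑ j ∈ Finset.range J,
      (-1) ^ j * M (t + j) n / (t.factorial * j.factorial)) atTop (nhds (P J)) :=
    tendsto_finsetSum _ fun j _ => ((hM (t + j)).const_mul _).div_const _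
  have hR : Tendsto (fun n => M (t + J) n / (t.factorial * J.factorial)) atTop
      (nhds (lam ^ (t + J) / (t.factorial * J.factorial))) := (hM (t + J)).div_const _
  obtain ⟨N, hN⟩ := eventually_atTop.1 (((hb J).and (Metric.tendsto_nhds.1 hS _ h3)).and
    (hR.eventually (gt_mem_nhds hJ2)))
  refine ⟨N, fun n hn => ?_⟩
  obtain ⟨⟨h4, h5⟩, h6⟩ := hN n hn
  rw [Real.dist_eq] at *
  rw [abs_lt] at *
  rw [abs_le] at h4
  constructor <;> linarith [h4.1, h4.2, h5.1, h5.2, hJ1.1, hJ1.2]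

/-! ### Excess of unions of copies of a strictly balanced multigraph -/

lemma SubMGIso.isSubMG {k l n m : ℕ} {F : Fin l → Fin k × Fin k} {E : Fin m → Fin n × Fin n}
    {p : Finset (Fin n) × Finset (Fin m)} (h : SubMGIso F E p) : IsSubMG E p := by
  obtain ⟨σ, τ, h1, h2, h3⟩ := h
  intro j hj
  have hj' : j ∈ Set.range τ := by rw [← h2]; exact hj
  obtain ⟨i, rfl⟩ := hj'
  have hmem : ∀ x, σ x ∈ p.1 := fun x => by
    have : σ x ∈ (p.1 : Set (Fin n)) := by rw [h1]; exact ⟨x, rfl⟩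
    exact this
  rcases Sym2.eq_iff.1 (h3 i) with ⟨ha, hb⟩ | ⟨ha, hb⟩ <;> rw [ha, hb] <;>
    exact ⟨hmem _, hmem _⟩

lemma SubMGIso.card_eq {k l n m : ℕ} {F : Fin l → Fin k × Fin k} {E : Fin m → Fin n × Fin n}
    {p : Finset (Fin n) × Finset (Fin m)} (h : SubMGIso F E p) :
    p.1.card = k ∧ p.2.card = l := by
  obtain ⟨σ, τ, h1, h2, -⟩ := h
  have e1 : p.1 = Finset.univ.map σ := by
    rw [← Finset.coe_inj, h1]; simp
  have e2 : p.2 = Finset.univ.map τ := by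
    rw [← Finset.coe_inj, h2]; simp
  rw [e1, e2]; simp

lemma StrictlyBalancedMG.mul_card_le {k l : ℕ} {F : Fin l → Fin k × Fin k}
    (hF : StrictlyBalancedMG F) {p : Finset (Fin k) × Finset (Fin l)} (hp : IsSubMG F p) :
    k * p.2.card ≤ l * p.1.card ∧
      (p.1.Nonempty → ¬(p.1 = Finset.univ ∧ p.2 = Finset.univ) →
        k * p.2.card < l * p.1.card) := by
  have hlt : p.1.Nonempty → ¬(p.1 = Finset.univ ∧ p.2 = Finset.univ) →
      k * p.2.card < l * p.1.card := by
    intro hne hpr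
    have h := hF p hp hne hpr
    have hk : 0 < k := Fin.pos_iff_nonempty.2 ⟨hne.choose⟩
    rw [div_lt_div_iff₀ (by exact_mod_cast hne.card_pos) (by exact_mod_cast hk)] at h
    have h' : p.2.card * k < l * p.1.card := by exact_mod_cast h
    rwa [mul_comm] at h'
  refine ⟨?_, hlt⟩
  rcases p.1.eq_empty_or_nonempty with h0 | hne
  · have : p.2 = ∅ := by
      rw [Finset.eq_empty_iff_forall_notMem]
      intro j hj
      simpa [h0] using (hp j hj).1
    simp [this]
  · by_cases hpr : p.1 = Finset.univ ∧ p.2 = Finset.univ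
    · rw [hpr.1, hpr.2]; simp [mul_comm]
    · exact (hlt hne hpr).le

/-- A sub-multigraph of a copy of a strictly balanced multigraph is at most as dense as the copy,
strictly less dense if it is nonempty and proper. -/
lemma SubMGIso.mul_card_le {k l n m : ℕ} {F : Fin l → Fin k × Fin k}
    {E : Fin m → Fin n × Fin n} {p q : Finset (Fin n) × Finset (Fin m)}
    (h : SubMGIso F E p) (hF : StrictlyBalancedMG F) (hq : IsSubMG E q)
    (hqp1 : q.1 ⊆ p.1) (hqp2 : q.2 ⊆ p.2) :
    k * q.2.card ≤ l * q.1.card ∧ (q.1.Nonempty → q ≠ p → k * q.2.card < l * q.1.card) := by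
  obtain ⟨σ, τ, h1, h2, h3⟩ := h
  set H : Finset (Fin k) × Finset (Fin l) :=
    (Finset.univ.filter fun i => σ i ∈ q.1, Finset.univ.filter fun j => τ j ∈ q.2) with hH
  have e1 : q.1 = H.1.map σ := by
    ext x
    simp only [hH, Finset.mem_map, Finset.mem_filter, Finset.mem_univ, true_and]
    constructor
    · intro hx
      have : x ∈ Set.range σ := by rw [← h1]; exact hqp1 hx
      obtain ⟨i, rfl⟩ := this
      exact ⟨i, hx, rfl⟩
    · rintro ⟨i, hi, rfl⟩; exact hi
  have e2 : q.2 = H.2.map τ := by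
    ext x
    simp only [hH, Finset.mem_map, Finset.mem_filter, Finset.mem_univ, true_and]
    constructor
    · intro hx
      have : x ∈ Set.range τ := by rw [← h2]; exact hqp2 hx
      obtain ⟨i, rfl⟩ := this
      exact ⟨i, hx, rfl⟩
    · rintro ⟨i, hi, rfl⟩; exact hi
  have hsub : IsSubMG F H := by
    intro j hj
    have hj' : τ j ∈ q.2 := by simpa [hH] using hj
    have hE := hq _ hj'
    rcases Sym2.eq_iff.1 (h3 j) with ⟨ha, hb⟩ | ⟨ha, hb⟩ <;> rw [ha, hb] at hE <;>
      simp [hH, hE.1, hE.2]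
  have c1 : q.1.card = H.1.card := by rw [e1, Finset.card_map]
  have c2 : q.2.card = H.2.card := by rw [e2, Finset.card_map]
  rw [c1, c2]
  refine ⟨(hF.mul_card_le hsub).1, fun hne hqp => (hF.mul_card_le hsub).2 ?_ ?_⟩
  · rw [← Finset.card_pos, ← c1, Finset.card_pos]; exact hne
  · rintro ⟨hu1, hu2⟩
    apply hqp
    refine Prod.ext ?_ ?_
    · rw [← Finset.coe_inj, h1, e1, hu1]; simp
    · rw [← Finset.coe_inj, h2, e2, hu2]; simp

lemma IsSubMG.union {n m : ℕ} {E : Fin m → Fin n × Fin n}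
    {p q : Finset (Fin n) × Finset (Fin m)} (hp : IsSubMG E p) (hq : IsSubMG E q) :
    IsSubMG E (p.1 ∪ q.1, p.2 ∪ q.2) := by
  intro j hj
  rcases Finset.mem_union.1 hj with h | h
  · exact ⟨Finset.mem_union_left _ (hp j h).1, Finset.mem_union_left _ (hp j h).2⟩
  · exact ⟨Finset.mem_union_right _ (hq j h).1, Finset.mem_union_right _ (hq j h).2⟩

lemma IsSubMG.inter {n m : ℕ} {E : Fin m → Fin n × Fin n}
    {p q : Finset (Fin n) × Finset (Fin m)} (hp : IsSubMG E p) (hq : IsSubMG E q) :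
    IsSubMG E (p.1 ∩ q.1, p.2 ∩ q.2) := by
  intro j hj
  obtain ⟨h1, h2⟩ := Finset.mem_inter.1 hj
  exact ⟨Finset.mem_inter.2 ⟨(hp j h1).1, (hq j h2).1⟩,
    Finset.mem_inter.2 ⟨(hp j h1).2, (hq j h2).2⟩⟩

/-- Adding a copy of `F` does not decrease the excess `k e - l v`; here in subtraction-free form. -/
lemma SubMGIso.excess_union {k l n m : ℕ} {F : Fin l → Fin k × Fin k}
    {E : Fin m → Fin n × Fin n} {p q : Finset (Fin n) × Finset (Fin m)}
    (hp : SubMGIso F E p) (hF : StrictlyBalancedMG F) (hq : IsSubMG E q) :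
    k * q.2.card + l * (q.1 ∪ p.1).card ≤ k * (q.2 ∪ p.2).card + l * q.1.card ∧
    ((q.1 ∩ p.1).Nonempty → (q.1 ∩ p.1, q.2 ∩ p.2) ≠ p →
      k * q.2.card + l * (q.1 ∪ p.1).card < k * (q.2 ∪ p.2).card + l * q.1.card) := by
  have h := hp.mul_card_le hF (hq.inter hp.isSubMG) Finset.inter_subset_right
    Finset.inter_subset_right
  have c1 := Finset.card_union_add_card_inter q.1 p.1
  have c2 := Finset.card_union_add_card_inter q.2 p.2
  rw [hp.card_eq.1] at c1
  rw [hp.card_eq.2] at c2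
  have c1' := congrArg (fun x => l * x) c1
  have c2' := congrArg (fun x => k * x) c2
  simp only [mul_add] at c1' c2'
  have hkl := mul_comm k l
  refine ⟨?_, fun hne hpr => ?_⟩
  · have := h.1
    simp only at this
    omega
  · have := h.2 hne hpr
    simp only at this
    omega

lemma excess_biUnion {k l n m : ℕ} {F : Fin l → Fin k × Fin k}
    {E : Fin m → Fin n × Fin n} (hF : StrictlyBalancedMG F)
    {ι : Type*} {q : ι → Finset (Fin n) × Finset (Fin m)} (hq : ∀ i, SubMGIso F E (q i))
    {A : Finset (Fin n) × Finset (Fin m)} (hA : IsSubMG E A) (s : Finset ι) :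
    IsSubMG E (A.1 ∪ s.biUnion fun i => (q i).1, A.2 ∪ s.biUnion fun i => (q i).2) ∧
    k * A.2.card + l * (A.1 ∪ s.biUnion fun i => (q i).1).card
      ≤ k * (A.2 ∪ s.biUnion fun i => (q i).2).card + l * A.1.card := by
  induction s using Finset.induction_on with
  | empty => simpa using hA
  | insert a s _ ih =>
    have e1 : A.1 ∪ (insert a s).biUnion (fun i => (q i).1)
        = (A.1 ∪ s.biUnion fun i => (q i).1) ∪ (q a).1 := by
      rw [Finset.biUnion_insert, Finset.union_comm (q a).1, Finset.union_assoc]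
    have e2 : A.2 ∪ (insert a s).biUnion (fun i => (q i).2)
        = (A.2 ∪ s.biUnion fun i => (q i).2) ∪ (q a).2 := by
      rw [Finset.biUnion_insert, Finset.union_comm (q a).2, Finset.union_assoc]
    rw [e1, e2]
    refine ⟨ih.1.union (hq a).isSubMG, ?_⟩
    have h := ((hq a).excess_union hF ih.1).1
    simp only at h
    omega

/-- A union of copies of `F`, two of which are distinct and share an edge, is strictly denser
than `F`. -/
lemma excess_pos_of_not_disjoint {k l n m : ℕ} {F : Fin l → Fin k × Fin k}
    {E : Fin m → Fin n × Fin n} (hF : StrictlyBalancedMG F)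
    {ι : Type*} [Fintype ι] {q : ι → Finset (Fin n) × Finset (Fin m)}
    (hq : ∀ i, SubMGIso F E (q i)) {i j : ι} (hij : q i ≠ q j)
    (hd : ¬Disjoint (q i).2 (q j).2) :
    l * (Finset.univ.biUnion fun i => (q i).1).card
      < k * (Finset.univ.biUnion fun i => (q i).2).card := by
  have h := excess_biUnion hF hq ((hq i).isSubMG.union (hq j).isSubMG) Finset.univ
  have e1 : ((q i).1 ∪ (q j).1) ∪ Finset.univ.biUnion (fun i => (q i).1)
      = Finset.univ.biUnion fun i => (q i).1 := by
    rw [Finset.union_eq_right]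
    exact Finset.union_subset (Finset.subset_biUnion_of_mem (fun i => (q i).1) (Finset.mem_univ i))
      (Finset.subset_biUnion_of_mem (fun i => (q i).1) (Finset.mem_univ j))
  have e2 : ((q i).2 ∪ (q j).2) ∪ Finset.univ.biUnion (fun i => (q i).2)
      = Finset.univ.biUnion fun i => (q i).2 := by
    rw [Finset.union_eq_right]
    exact Finset.union_subset (Finset.subset_biUnion_of_mem (fun i => (q i).2) (Finset.mem_univ i))
      (Finset.subset_biUnion_of_mem (fun i => (q i).2) (Finset.mem_univ j))
  simp only [e1, e2] at h
  have hne : ((q i).1 ∩ (q j).1).Nonempty := by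
    obtain ⟨e, he1, he2⟩ := Finset.not_disjoint_iff.1 hd
    exact ⟨_, Finset.mem_inter.2
      ⟨((hq i).isSubMG e he1).1, ((hq j).isSubMG e he2).1⟩⟩
  have h2 := ((hq j).excess_union hF (hq i).isSubMG).2 hne ?_
  · have hi1 := (hq i).card_eq.1
    have hi2 := (hq i).card_eq.2
    rw [hi1, hi2] at h2
    have := mul_comm k l
    have h3 := h.2
    omega
  · intro heq
    apply hij
    have g1 : (q i).1 ∩ (q j).1 = (q j).1 := congrArg Prod.fst heq
    have g2 : (q i).2 ∩ (q j).2 = (q j).2 := congrArg Prod.snd heq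
    rw [Finset.inter_eq_right] at g1 g2
    refine (Prod.ext (Finset.eq_of_subset_of_card_le g1 ?_)
      (Finset.eq_of_subset_of_card_le g2 ?_)).symm
    · rw [(hq i).card_eq.1, (hq j).card_eq.1]
    · rw [(hq i).card_eq.2, (hq j).card_eq.2]

/-! ### Independence and counting -/

/-- Functions of disjoint sets of coordinates are independent under the uniform measure. -/
lemma card_mul_sum_mul_eq {ι V : Type*} [Fintype ι] [DecidableEq ι] [Fintype V] (A : Finset ι)
    {f g : (ι → V) → ℝ}
    (hf : ∀ E E', (∀ j ∈ A, E j = E' j) → f E = f E')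
    (hg : ∀ E E', (∀ j ∉ A, E j = E' j) → g E = g E') :
    (Fintype.card (ι → V) : ℝ) * ∑ E, f E * g E = (∑ E, f E) * ∑ E, g E := by
  let mix : (ι → V) × (ι → V) → (ι → V) × (ι → V) := fun p =>
    (fun j => if j ∈ A then p.1 j else p.2 j, fun j => if j ∈ A then p.2 j else p.1 j)
  have hmix : Function.Involutive mix := by
    rintro ⟨a, b⟩
    refine Prod.ext ?_ ?_ <;> funext j <;> by_cases hj : j ∈ A <;> simp [mix, hj]
  rw [Finset.sum_mul_sum, ← Finset.sum_product', Finset.univ_product_univ,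
    ← Equiv.sum_comp (hmix.toPerm mix)]
  have : ∀ p : (ι → V) × (ι → V),
      f (hmix.toPerm mix p).1 * g (hmix.toPerm mix p).2 = f p.1 * g p.1 := by
    intro p
    congr 1
    · exact hf _ _ fun j hj => by simp [mix, hj]
    · exact hg _ _ fun j hj => by simp [mix, hj]
  simp_rw [this]
  rw [← Finset.univ_product_univ, Finset.sum_product]
  simp [Finset.mul_sum]

lemma sum_prod_eq_of_pairwise_disjoint {κ ι V : Type*} [Fintype ι] [DecidableEq ι] [Fintype V]
    {L : κ → Finset ι} (hL : Pairwise fun i j => Disjoint (L i) (L j))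
    {f : κ → (ι → V) → ℝ} {c : κ → ℝ}
    (hf : ∀ i E E', (∀ j ∈ L i, E j = E' j) → f i E = f i E')
    (hc : ∀ i, ∑ E, f i E = c i * Fintype.card (ι → V)) (s : Finset κ) :
    ∑ E, ∏ i ∈ s, f i E = (∏ i ∈ s, c i) * Fintype.card (ι → V) := by
  induction s using Finset.induction_on with
  | empty => simp
  | insert a s ha ih =>
    simp_rw [Finset.prod_insert ha]
    have h := card_mul_sum_mul_eq (L a) (f := f a) (g := fun E => ∏ i ∈ s, f i E) (hf a) ?_
    · rw [hc a, ih] at h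
      rcases eq_or_ne (Fintype.card (ι → V) : ℝ) 0 with h0 | h0
      · have : IsEmpty (ι → V) := Fintype.card_eq_zero_iff.1 (by exact_mod_cast h0)
        simp
      · apply mul_left_cancel₀ h0
        rw [h]; ring
    · intro E E' hE
      refine Finset.prod_congr rfl fun i hi => hf i _ _ fun j hj => hE j fun hja => ?_
      have hne : i ≠ a := fun h => ha (h ▸ hi)
      exact Finset.disjoint_left.1 (hL hne) hj hja

lemma SubMGIso.congr {k l n m : ℕ} {F : Fin l → Fin k × Fin k} {E E' : Fin m → Fin n × Fin n}
    {p : Finset (Fin n) × Finset (Fin m)} (hE : ∀ j ∈ p.2, E j = E' j) (h : SubMGIso F E p) :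
    SubMGIso F E' p := by
  obtain ⟨σ, τ, h1, h2, h3⟩ := h
  refine ⟨σ, τ, h1, h2, fun j => ?_⟩
  have : τ j ∈ (p.2 : Set (Fin m)) := by rw [h2]; exact ⟨j, rfl⟩
  rw [← hE _ this, h3]

/-- On fixed vertex and edge sets of the right sizes, `E` carries a copy of `F` iff its transport
to `Fin k`, `Fin l` is isomorphic to `F`. -/
lemma subMGIso_iff {k l n m : ℕ} {F : Fin l → Fin k × Fin k} {E : Fin m → Fin n × Fin n}
    {p : Finset (Fin n) × Finset (Fin m)} (eS : Fin k ≃ p.1) (eL : Fin l ≃ p.2)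
    {E' : Fin l → Fin k × Fin k}
    (hE : ∀ j, E (eL j) = (((eS (E' j).1 : p.1) : Fin n), ((eS (E' j).2 : p.1) : Fin n))) :
    SubMGIso F E p ↔ MGIso F E' := by
  constructor
  · rintro ⟨σ, τ, h1, h2, h3⟩
    have hσ : ∀ i, σ i ∈ p.1 := fun i => by
      have : σ i ∈ (p.1 : Set (Fin n)) := by rw [h1]; exact ⟨i, rfl⟩
      exact this
    have hτ : ∀ i, τ i ∈ p.2 := fun i => by
      have : τ i ∈ (p.2 : Set (Fin m)) := by rw [h2]; exact ⟨i, rfl⟩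
      exact this
    have hs : Function.Injective fun i => eS.symm ⟨σ i, hσ i⟩ := fun a b hab => by
      simpa using hab
    have ht : Function.Injective fun i => eL.symm ⟨τ i, hτ i⟩ := fun a b hab => by
      simpa using hab
    refine ⟨Equiv.ofBijective _ (Finite.injective_iff_bijective.1 hs),
      Equiv.ofBijective _ (Finite.injective_iff_bijective.1 ht), fun j => ?_⟩
    have hj := hE (eL.symm ⟨τ j, hτ j⟩)
    have h4 := h3 j
    simp only [Equiv.apply_symm_apply] at hj
    rw [hj] at h4
    have hinj : Function.Injective fun i => ((eS i : p.1) : Fin n) :=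
      Subtype.val_injective.comp eS.injective
    apply Sym2.map.injective hinj
    simpa using h4
  · rintro ⟨σ, τ, h⟩
    refine ⟨(σ.trans eS).toEmbedding.trans (Function.Embedding.subtype _),
      (τ.trans eL).toEmbedding.trans (Function.Embedding.subtype _), ?_, ?_, fun j => ?_⟩
    · ext x
      constructor
      · intro hx
        exact ⟨σ.symm (eS.symm ⟨x, hx⟩), by simp⟩
      · rintro ⟨i, rfl⟩
        exact (eS (σ i)).2
    · ext x
      constructor
      · intro hx
        exact ⟨τ.symm (eL.symm ⟨x, hx⟩), by simp⟩
      · rintro ⟨i, rfl⟩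
        exact (eL (τ i)).2
    · have h4 := congrArg (Sym2.map fun i => ((eS i : p.1) : Fin n)) (h j)
      simp only [Sym2.map_mk] at h4
      have hj := hE (τ j)
      simp only [Function.Embedding.trans_apply, Equiv.coe_toEmbedding, Equiv.trans_apply,
        Function.Embedding.subtype_apply]
      rw [hj]
      exact h4

lemma card_filter_subMGIso {k l n m : ℕ} (F : Fin l → Fin k × Fin k)
    {p : Finset (Fin n) × Finset (Fin m)} (h1 : p.1.card = k) (h2 : p.2.card = l) :
    (Finset.univ.filter fun E : Fin m → Fin n × Fin n => SubMGIso F E p).card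
      = Set.ncard {E' : Fin l → Fin k × Fin k | MGIso F E'} * (n ^ 2) ^ (m - l) := by
  let eS : Fin k ≃ p.1 := (p.1.equivFinOfCardEq h1).symm
  let eL : Fin l ≃ p.2 := (p.2.equivFinOfCardEq h2).symm
  let glue : (Fin l → Fin k × Fin k) × ({j // j ∉ p.2} → Fin n × Fin n) →
      (Fin m → Fin n × Fin n) := fun x j =>
    if hj : j ∈ p.2 then
      (((eS (x.1 (eL.symm ⟨j, hj⟩)).1 : p.1) : Fin n),
        ((eS (x.1 (eL.symm ⟨j, hj⟩)).2 : p.1) : Fin n))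
    else x.2 ⟨j, hj⟩
  have glue_mem : ∀ x j, glue x (eL j)
      = (((eS (x.1 j).1 : p.1) : Fin n), ((eS (x.1 j).2 : p.1) : Fin n)) := by
    intro x j
    simp [glue]
  have glue_not_mem : ∀ x (j : {j // j ∉ p.2}), glue x j = x.2 j := by
    intro x j
    simp [glue, j.2]
  have hinj : Function.Injective glue := by
    intro x y hxy
    refine Prod.ext ?_ ?_
    · funext j
      have := congrFun hxy (eL j)
      rw [glue_mem, glue_mem, Prod.mk.injEq] at this
      refine Prod.ext ?_ ?_
      · exact eS.injective (Subtype.ext this.1)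
      · exact eS.injective (Subtype.ext this.2)
    · funext j
      have := congrFun hxy j
      rwa [glue_not_mem, glue_not_mem] at this
  have himage : (Finset.univ.filter fun E : Fin m → Fin n × Fin n => SubMGIso F E p)
      = ((Finset.univ.filter fun E' : Fin l → Fin k × Fin k => MGIso F E') ×ˢ
          (Finset.univ : Finset ({j // j ∉ p.2} → Fin n × Fin n))).image glue := by
    ext E
    simp only [Finset.mem_filter, Finset.mem_univ, true_and, Finset.mem_image,
      Finset.mem_product, and_true]
    constructor
    · intro hE
      have hsub := hE.isSubMG
      let E' : Fin l → Fin k × Fin k := fun j =>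
        (eS.symm ⟨(E (eL j)).1, (hsub _ (eL j).2).1⟩, eS.symm ⟨(E (eL j)).2, (hsub _ (eL j).2).2⟩)
      refine ⟨(E', fun j => E j), (subMGIso_iff eS eL fun j => ?_).1 hE, ?_⟩
      · simp [E']
      · funext j
        by_cases hj : j ∈ p.2
        · have := glue_mem (E', fun j => E j) (eL.symm ⟨j, hj⟩)
          simpa [E'] using this
        · exact glue_not_mem (E', fun j => E j) ⟨j, hj⟩
    · rintro ⟨x, hx, rfl⟩
      exact (subMGIso_iff eS eL (glue_mem x)).2 hx
  rw [himage, Finset.card_image_of_injective _ hinj, Finset.card_product,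
    Set.ncard_eq_toFinset_card', Finset.card_univ, Fintype.card_fun, Fintype.card_prod,
    Fintype.card_fin, Fintype.card_subtype_compl, Fintype.card_fin, Fintype.card_coe, h2, sq]
  congr 2
  ext; simp

/-- Tuples of subsets whose union has `e` elements. -/
lemma card_filter_card_biUnion_eq_le {α : Type*} [Fintype α] [DecidableEq α] (r e : ℕ) :
    (Finset.univ.filter fun L : Fin r → Finset α => (Finset.univ.biUnion L).card = e).card
      ≤ Fintype.card α ^ e * (2 ^ e) ^ r := by
  calc _ ≤ ((Finset.univ.powersetCard e).biUnion fun U : Finset α =>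
            Fintype.piFinset fun _ : Fin r => U.powerset).card := by
        refine Finset.card_le_card fun L hL => ?_
        simp only [Finset.mem_filter, Finset.mem_univ, true_and] at hL
        simp only [Finset.mem_biUnion, Finset.mem_powersetCard, Finset.subset_univ, true_and,
          Fintype.mem_piFinset, Finset.mem_powerset]
        exact ⟨_, hL, fun i => Finset.subset_biUnion_of_mem L (Finset.mem_univ i)⟩
    _ ≤ (Finset.univ.powersetCard e : Finset (Finset α)).card * (2 ^ e) ^ r := by
        refine Finset.card_biUnion_le_card_mul _ _ _ fun U hU => ?_
        rw [Fintype.card_piFinset_const, Finset.card_powerset, (Finset.mem_powersetCard.1 hU).2]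
    _ ≤ _ := by
        rw [Finset.card_powersetCard, Finset.card_univ]
        exact Nat.mul_le_mul_right _ (Nat.choose_le_pow _ _)

/-- Pairs of tuples of subsets with unions of prescribed sizes. -/
lemma card_filter_card_biUnion_prod_le {α β : Type*} [Fintype α] [DecidableEq α]
    [Fintype β] [DecidableEq β] (r v e : ℕ) :
    (Finset.univ.filter fun q : Fin r → Finset α × Finset β =>
      (Finset.univ.biUnion fun i => (q i).1).card = v ∧
      (Finset.univ.biUnion fun i => (q i).2).card = e).card
      ≤ (Fintype.card α ^ v * (2 ^ v) ^ r) * (Fintype.card β ^ e * (2 ^ e) ^ r) := by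
  refine le_trans ?_ (Nat.mul_le_mul (card_filter_card_biUnion_eq_le (α := α) r v)
    (card_filter_card_biUnion_eq_le (α := β) r e))
  rw [← Finset.card_product]
  refine Finset.card_le_card_of_injOn
    (Equiv.arrowProdEquivProdArrow (Fin r) (fun _ => Finset α) (fun _ => Finset β)) ?_
    (Equiv.injective _).injOn
  intro q hq
  simpa using hq

/-- Ordered tuples of distinct elements of a finite set. -/
lemma card_filter_injective_mem {α : Type*} [Fintype α] (s : Finset α) (r : ℕ) :
    (Finset.univ.filter fun q : Fin r → α => Function.Injective q ∧ ∀ i, q i ∈ s).card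
      = s.card.descFactorial r := by
  have h := Fintype.card_embedding_eq (α := Fin r) (β := s)
  rw [Fintype.card_coe, Fintype.card_fin] at h
  rw [← h, ← Finset.card_univ]
  symm
  refine Finset.card_bij (fun q _ i => ((q i : s) : α)) ?_ ?_ ?_
  · intro q _
    simp only [Finset.mem_filter, Finset.mem_univ, true_and]
    exact ⟨Subtype.val_injective.comp q.injective, fun i => (q i).2⟩
  · intro q _ q' _ h
    ext i
    exact congrFun h i
  · intro q hq
    simp only [Finset.mem_filter, Finset.mem_univ, true_and] at hq
    exact ⟨⟨fun i => ⟨q i, hq.2 i⟩, fun a b hab => hq.1 (Subtype.ext_iff.1 hab)⟩,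
      Finset.mem_univ _, rfl⟩

/-- Tuples of `l`-sets that are not pairwise disjoint have a small union. -/
lemma card_biUnion_lt_of_not_pairwise_disjoint {α : Type*} [DecidableEq α] {r l : ℕ} {L : Fin r → Finset α}
    (hl : ∀ i, (L i).card = l) (h : ¬Pairwise fun i j => Disjoint (L i) (L j)) :
    (Finset.univ.biUnion L).card < r * l := by
  simp only [Pairwise, not_forall] at h
  obtain ⟨i, j, hij, hd⟩ := h
  obtain ⟨x, hxi, hxj⟩ := Finset.not_disjoint_iff.1 hd
  have hsub : Finset.univ.biUnion L ⊆ (Finset.univ.erase i).biUnion L ∪ (L i).erase x := by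
    intro y hy
    obtain ⟨a, -, ha⟩ := Finset.mem_biUnion.1 hy
    by_cases hai : a = i
    · subst hai
      by_cases hyx : y = x
      · subst hyx
        exact Finset.mem_union_left _ (Finset.mem_biUnion.2 ⟨j, by simp [Ne.symm hij], hxj⟩)
      · exact Finset.mem_union_right _ (Finset.mem_erase.2 ⟨hyx, ha⟩)
    · exact Finset.mem_union_left _ (Finset.mem_biUnion.2 ⟨a, by simp [hai], ha⟩)
  have h1 := (Finset.card_le_card hsub).trans (Finset.card_union_le _ _)
  have h2 : ((Finset.univ.erase i).biUnion L).card ≤ (r - 1) * l := by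
    have := Finset.card_biUnion_le_card_mul (Finset.univ.erase i) L l fun a _ => (hl a).le
    simpa [Finset.card_erase_of_mem] using this
  rw [Finset.card_erase_of_mem hxi, hl i] at h1
  have h3 : 0 < l := by rw [← hl i]; exact Finset.card_pos.2 ⟨x, hxi⟩
  obtain ⟨r', rfl⟩ : ∃ r', r = r' + 1 := ⟨r - 1, by have := i.pos; omega⟩
  simp only [Nat.add_sub_cancel] at h2
  rw [Nat.succ_mul]
  omega

/-! ### Factorial moments of the number of copies -/

lemma countSubMG_eq_card {k l n m : ℕ} (F : Fin l → Fin k × Fin k)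
    (E : Fin m → Fin n × Fin n) :
    countSubMG F E = (Finset.univ.filter fun p => SubMGIso F E p).card := by
  rw [countSubMG, Set.ncard_eq_toFinset_card']
  congr 1
  ext p
  simpa using fun h : SubMGIso F E p => h.isSubMG

lemma card_filter_forall_mem_mem {n m : ℕ} (hn : n ≠ 0) (S : Finset (Fin n))
    (L : Finset (Fin m)) :
    ((Finset.univ.filter fun E : Fin m → Fin n × Fin n => IsSubMG E (S, L)).card : ℝ)
      = (S.card : ℝ) ^ (2 * L.card) / (n : ℝ) ^ (2 * L.card) * (n : ℝ) ^ (2 * m) := by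
  have h : (Finset.univ.filter fun E : Fin m → Fin n × Fin n => IsSubMG E (S, L))
      = Fintype.piFinset fun j => if j ∈ L then S ×ˢ S else Finset.univ := by
    ext E
    rw [Finset.mem_filter, Fintype.mem_piFinset, and_iff_right (Finset.mem_univ _)]
    refine forall_congr' fun j => ?_
    by_cases hj : j ∈ L <;> simp [hj]
  have hL : L.card ≤ m := by simpa using Finset.card_le_univ L
  have hsplit : 2 * m = 2 * L.card + 2 * (m - L.card) := by omega
  have hn' : (n : ℝ) ≠ 0 := by exact_mod_cast hn
  rw [h, Fintype.card_piFinset]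
  simp_rw [apply_ite Finset.card]
  rw [Finset.prod_ite, Finset.prod_const, Finset.prod_const, Finset.card_product,
    Finset.card_univ, Fintype.card_prod, Fintype.card_fin, Finset.filter_not,
    Finset.card_sdiff_of_subset (Finset.filter_subset _ _), Finset.card_univ, Fintype.card_fin,
    Finset.filter_mem_eq_inter, Finset.univ_inter, hsplit, pow_add]
  push_cast
  rw [pow_mul, pow_mul (n : ℝ), pow_mul (n : ℝ)]
  field_simp

/-- The total number of tuples of distinct copies of `F`, two of which share an edge. -/
lemma sum_card_not_pairwise_disjoint_le {k l n m : ℕ} {F : Fin l → Fin k × Fin k}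
    (hF : StrictlyBalancedMG F) (hn : n ≠ 0) (r : ℕ) :
    ∑ E : Fin m → Fin n × Fin n,
      ((Finset.univ.filter fun q : Fin r → Finset (Fin n) × Finset (Fin m) =>
        (Function.Injective q ∧ ∀ i, SubMGIso F E (q i)) ∧
          ¬Pairwise fun i j => Disjoint (q i).2 (q j).2).card : ℝ)
      ≤ (∑ x ∈ (Finset.range (r * k + 1) ×ˢ Finset.range (r * l + 1)).filter
          (fun x => l * x.1 < k * x.2),
          ((2 ^ x.1) ^ r * (2 ^ x.2) ^ r * (x.1 : ℝ) ^ (2 * x.2)) *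
            ((n : ℝ) ^ x.1 * (m : ℝ) ^ x.2 / (n : ℝ) ^ (2 * x.2))) * (n : ℝ) ^ (2 * m) := by
  set T := Finset.univ.sigma fun E : Fin m → Fin n × Fin n =>
    (Finset.univ.filter fun q : Fin r → Finset (Fin n) × Finset (Fin m) =>
        (Function.Injective q ∧ ∀ i, SubMGIso F E (q i)) ∧
          ¬Pairwise fun i j => Disjoint (q i).2 (q j).2) with hT
  set I := (Finset.range (r * k + 1) ×ˢ Finset.range (r * l + 1)).filter
          (fun x : ℕ × ℕ => l * x.1 < k * x.2) with hI
  let Q : ℕ × ℕ → Finset (Fin r → Finset (Fin n) × Finset (Fin m)) := fun x =>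
    Finset.univ.filter fun q =>
      (Finset.univ.biUnion fun i => (q i).1).card = x.1 ∧
      (Finset.univ.biUnion fun i => (q i).2).card = x.2
  let R : (Fin r → Finset (Fin n) × Finset (Fin m)) → Finset (Fin m → Fin n × Fin n) := fun q =>
    Finset.univ.filter fun E => IsSubMG E
      (Finset.univ.biUnion fun i => (q i).1, Finset.univ.biUnion fun i => (q i).2)
  have hsub : T ⊆ I.biUnion fun x => (Q x).biUnion fun q => (R q).image fun E => ⟨E, q⟩ := by
    rintro ⟨E, q⟩ hq
    simp only [hT, Finset.mem_sigma, Finset.mem_univ, Finset.mem_filter, true_and] at hq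
    obtain ⟨⟨hinj, hcopy⟩, hnd⟩ := hq
    simp only [Pairwise, not_forall] at hnd
    obtain ⟨i, j, hij, hd⟩ := hnd
    have hex := excess_pos_of_not_disjoint hF hcopy (hinj.ne hij) hd
    have hsubm : IsSubMG E (Finset.univ.biUnion fun i => (q i).1,
        Finset.univ.biUnion fun i => (q i).2) := by
      intro e he
      obtain ⟨a, -, ha⟩ := Finset.mem_biUnion.1 he
      exact ⟨Finset.mem_biUnion.2 ⟨a, Finset.mem_univ _, ((hcopy a).isSubMG e ha).1⟩,
        Finset.mem_biUnion.2 ⟨a, Finset.mem_univ _, ((hcopy a).isSubMG e ha).2⟩⟩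
    have c1 : (Finset.univ.biUnion fun i => (q i).1).card ≤ r * k := by
      simpa using Finset.card_biUnion_le_card_mul Finset.univ (fun i => (q i).1) k
        fun a _ => (hcopy a).card_eq.1.le
    have c2 : (Finset.univ.biUnion fun i => (q i).2).card ≤ r * l := by
      simpa using Finset.card_biUnion_le_card_mul Finset.univ (fun i => (q i).2) l
        fun a _ => (hcopy a).card_eq.2.le
    refine Finset.mem_biUnion.2 ⟨((Finset.univ.biUnion fun i => (q i).1).card,
      (Finset.univ.biUnion fun i => (q i).2).card), ?_, Finset.mem_biUnion.2 ⟨q, ?_,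
        Finset.mem_image.2 ⟨E, ?_, rfl⟩⟩⟩
    · simp only [hI, Finset.mem_filter, Finset.mem_product, Finset.mem_range]
      exact ⟨⟨by omega, by omega⟩, hex⟩
    · simp [Q]
    · simpa [R] using hsubm
  have hR : ∀ x, ∀ q ∈ Q x, ((R q).card : ℝ)
      = (x.1 : ℝ) ^ (2 * x.2) / (n : ℝ) ^ (2 * x.2) * (n : ℝ) ^ (2 * m) := by
    intro x q hq
    obtain ⟨h1, h2⟩ : _ ∧ _ := by simpa [Q] using hq
    have := card_filter_forall_mem_mem hn (Finset.univ.biUnion fun i => (q i).1)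
      (Finset.univ.biUnion fun i => (q i).2)
    rw [h1, h2] at this
    exact this
  have hQ : ∀ x, ((Q x).card : ℝ)
      ≤ ((n : ℝ) ^ x.1 * (2 ^ x.1) ^ r) * ((m : ℝ) ^ x.2 * (2 ^ x.2) ^ r) := by
    intro x
    have := card_filter_card_biUnion_prod_le (α := Fin n) (β := Fin m) r x.1 x.2
    rw [Fintype.card_fin, Fintype.card_fin] at this
    exact_mod_cast this
  have hcard : (T.card : ℝ) ≤ ∑ x ∈ I, ∑ q ∈ Q x, ((R q).card : ℝ) := by
    have : T.card ≤ ∑ x ∈ I, ∑ q ∈ Q x, (R q).card :=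
      (Finset.card_le_card hsub).trans <| Finset.card_biUnion_le.trans <|
        Finset.sum_le_sum fun x _ => Finset.card_biUnion_le.trans <|
          Finset.sum_le_sum fun q _ => Finset.card_image_le
    exact_mod_cast this
  rw [← Nat.cast_sum, ← Finset.card_sigma, Finset.sum_mul]
  refine hcard.trans (Finset.sum_le_sum fun x _ => ?_)
  rw [Finset.sum_congr rfl (hR x), Finset.sum_const, nsmul_eq_mul]
  refine (mul_le_mul_of_nonneg_right (hQ x) (by positivity)).trans (le_of_eq ?_)
  ring

/-- The expected number of tuples of copies with pairwise disjoint edge sets. -/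
lemma sum_card_pairwise_disjoint_eq {k l n m : ℕ} (F : Fin l → Fin k × Fin k) (hl : 1 ≤ l)
    (hn : n ≠ 0) (r : ℕ) :
    ∑ E : Fin m → Fin n × Fin n,
      ((Finset.univ.filter fun q : Fin r → Finset (Fin n) × Finset (Fin m) =>
        (Function.Injective q ∧ ∀ i, SubMGIso F E (q i)) ∧
          Pairwise fun i j => Disjoint (q i).2 (q j).2).card : ℝ)
      = ((Finset.univ.filter fun q : Fin r → Finset (Fin n) × Finset (Fin m) =>
          (∀ i, (q i).1.card = k ∧ (q i).2.card = l) ∧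
            Pairwise fun i j => Disjoint (q i).2 (q j).2).card : ℝ) *
        ((Set.ncard {E' : Fin l → Fin k × Fin k | MGIso F E'} : ℝ) / (n : ℝ) ^ (2 * l)) ^ r *
        (n : ℝ) ^ (2 * m) := by
  set D := Finset.univ.filter fun q : Fin r → Finset (Fin n) × Finset (Fin m) =>
          (∀ i, (q i).1.card = k ∧ (q i).2.card = l) ∧
            Pairwise fun i j => Disjoint (q i).2 (q j).2 with hD
  have hn' : (n : ℝ) ≠ 0 := by exact_mod_cast hn
  have hcardV : (Fintype.card (Fin m → Fin n × Fin n) : ℝ) = (n : ℝ) ^ (2 * m) := by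
    simp [pow_mul, sq]
  have h1 : ∀ E : Fin m → Fin n × Fin n,
      ((Finset.univ.filter fun q : Fin r → Finset (Fin n) × Finset (Fin m) =>
        (Function.Injective q ∧ ∀ i, SubMGIso F E (q i)) ∧
          Pairwise fun i j => Disjoint (q i).2 (q j).2).card : ℝ)
      = ∑ q ∈ D, ∏ i, if SubMGIso F E (q i) then (1 : ℝ) else 0 := by
    intro E
    have hprod : ∀ q ∈ D, (∏ i, if SubMGIso F E (q i) then (1 : ℝ) else 0)
        = if ∀ i, SubMGIso F E (q i) then 1 else 0 := fun q _ => by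
      rw [Finset.prod_boole]; simp
    rw [Finset.sum_congr rfl hprod, ← Finset.sum_filter, Finset.sum_const, nsmul_eq_mul, mul_one]
    congr 2
    ext q
    simp only [hD, Finset.mem_filter, Finset.mem_univ, true_and]
    constructor
    · rintro ⟨⟨_, hc⟩, hp⟩
      exact ⟨⟨fun i => (hc i).card_eq, hp⟩, hc⟩
    · rintro ⟨⟨hc, hp⟩, hs⟩
      refine ⟨⟨fun i j hij => ?_, hs⟩, hp⟩
      by_contra hne
      have hd : Disjoint (q i).2 (q j).2 := hp hne
      rw [hij, disjoint_self, Finset.bot_eq_empty, ← Finset.card_eq_zero, (hc j).2] at hd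
      omega
  simp_rw [h1]
  rw [Finset.sum_comm]
  have h2 : ∀ q ∈ D, ∑ E : Fin m → Fin n × Fin n,
      ∏ i, (if SubMGIso F E (q i) then (1 : ℝ) else 0)
      = ((Set.ncard {E' : Fin l → Fin k × Fin k | MGIso F E'} : ℝ) / (n : ℝ) ^ (2 * l)) ^ r *
        (n : ℝ) ^ (2 * m) := by
    intro q hq
    simp only [hD, Finset.mem_filter, Finset.mem_univ, true_and] at hq
    have h := sum_prod_eq_of_pairwise_disjoint hq.2
      (f := fun i (E : Fin m → Fin n × Fin n) => if SubMGIso F E (q i) then (1 : ℝ) else 0)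
      (c := fun _ =>
        (Set.ncard {E' : Fin l → Fin k × Fin k | MGIso F E'} : ℝ) / (n : ℝ) ^ (2 * l))
      ?_ ?_ Finset.univ
    · rw [h, Finset.prod_const, Finset.card_univ, Fintype.card_fin, hcardV]
    · intro i E E' hE
      have : SubMGIso F E (q i) ↔ SubMGIso F E' (q i) :=
        ⟨fun h => h.congr hE, fun h => h.congr fun j hj => (hE j hj).symm⟩
      simp [this]
    · intro i
      have hlm : l ≤ m := by
        rw [← (hq.1 i).2]; simpa using Finset.card_le_univ (q i).2
      rw [Finset.sum_boole, card_filter_subMGIso F (hq.1 i).1 (hq.1 i).2, hcardV]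
      have : 2 * m = 2 * l + 2 * (m - l) := by omega
      rw [this, pow_add]
      push_cast
      rw [pow_mul (n : ℝ) 2 (m - l)]
      field_simp
  rw [Finset.sum_congr rfl h2, Finset.sum_const, nsmul_eq_mul, mul_assoc]

/-- Almost all tuples of `k`-sets and `l`-sets have pairwise disjoint second components. -/
lemma abs_card_pairwise_disjoint_sub_le (k l n m r : ℕ) :
    |((Finset.univ.filter fun q : Fin r → Finset (Fin n) × Finset (Fin m) =>
          (∀ i, (q i).1.card = k ∧ (q i).2.card = l) ∧
            Pairwise fun i j => Disjoint (q i).2 (q j).2).card : ℝ)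
        - ((n.choose k : ℝ) * m.choose l) ^ r|
      ≤ (n : ℝ) ^ (r * k) * ∑ e ∈ Finset.range (r * l), (m : ℝ) ^ e * (2 ^ e) ^ r := by
  set C := Finset.univ.filter fun q : Fin r → Finset (Fin n) × Finset (Fin m) =>
    ∀ i, (q i).1.card = k ∧ (q i).2.card = l with hC
  have hCcard : C.card = (n.choose k * m.choose l) ^ r := by
    have : C = Fintype.piFinset fun _ : Fin r =>
        (Finset.univ.powersetCard k : Finset (Finset (Fin n))) ×ˢ
          (Finset.univ.powersetCard l : Finset (Finset (Fin m))) := by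
      ext q
      simp [hC, Finset.mem_powersetCard]
    rw [this, Fintype.card_piFinset_const, Finset.card_product, Finset.card_powersetCard,
      Finset.card_powersetCard]
    simp
  set Z := C.filter fun q => ¬Pairwise fun i j => Disjoint (q i).2 (q j).2 with hZ
  have hsplit := Finset.card_filter_add_card_filter_not
    (s := C) (fun q => Pairwise fun i j => Disjoint (q i).2 (q j).2)
  rw [hC, Finset.filter_filter, ← hC, ← hZ, hCcard] at hsplit
  have hZcard : Z.card ≤ n ^ (r * k) * ∑ e ∈ Finset.range (r * l), m ^ e * (2 ^ e) ^ r := by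
    let A : Finset (Fin r → Finset (Fin n)) := Fintype.piFinset fun _ : Fin r =>
      (Finset.univ.powersetCard k : Finset (Finset (Fin n)))
    let B : Finset (Fin r → Finset (Fin m)) := (Finset.range (r * l)).biUnion fun e =>
      Finset.univ.filter fun L => (Finset.univ.biUnion L).card = e
    have hA : A.card ≤ n ^ (r * k) := by
      rw [Fintype.card_piFinset_const, Finset.card_powersetCard, Finset.card_univ,
        Fintype.card_fin, mul_comm, pow_mul]
      exact Nat.pow_le_pow_left (Nat.choose_le_pow _ _) _
    have hB : B.card ≤ ∑ e ∈ Finset.range (r * l), m ^ e * (2 ^ e) ^ r := by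
      refine Finset.card_biUnion_le.trans (Finset.sum_le_sum fun e _ => ?_)
      simpa using card_filter_card_biUnion_eq_le (α := Fin m) r e
    refine le_trans ?_ (Nat.mul_le_mul hA hB)
    rw [← Finset.card_product]
    refine Finset.card_le_card_of_injOn
      (Equiv.arrowProdEquivProdArrow (Fin r) (fun _ => Finset (Fin n)) (fun _ => Finset (Fin m)))
      ?_ (Equiv.injective _).injOn
    intro q hq
    obtain ⟨hq1, hq2⟩ := Finset.mem_filter.1 (Finset.mem_coe.1 hq)
    have hq1 := (Finset.mem_filter.1 hq1).2
    have := card_biUnion_lt_of_not_pairwise_disjoint (fun i => (hq1 i).2) hq2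
    simp only [Finset.mem_coe, Finset.mem_product, A, B, Fintype.mem_piFinset,
      Finset.mem_powersetCard, Finset.subset_univ, true_and, Finset.mem_biUnion,
      Finset.mem_range, Finset.mem_filter, Finset.mem_univ]
    exact ⟨fun i => (hq1 i).1, _, this, rfl⟩
  have hsplit' := congrArg (Nat.cast : ℕ → ℝ) hsplit
  have hZ' : (Z.card : ℝ)
      ≤ (n : ℝ) ^ (r * k) * ∑ e ∈ Finset.range (r * l), (m : ℝ) ^ e * (2 ^ e) ^ r := by
    exact_mod_cast hZcard
  push_cast at hsplit'
  rw [← hsplit', abs_sub_comm, add_sub_cancel_left, Nat.abs_cast]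
  exact hZ'

/-- Quantitative comparison of the `r`-th factorial moment with the `r`-th power of the mean. -/
lemma abs_factorialMoment_sub_le {k l n m : ℕ} {F : Fin l → Fin k × Fin k} (hl : 1 ≤ l)
    (hF : StrictlyBalancedMG F) (hn : n ≠ 0) (r : ℕ) {a : ℕ}
    (ha : a = Set.ncard {E' : Fin l → Fin k × Fin k | MGIso F E'}) :
    |(∑ E : Fin m → Fin n × Fin n, ((countSubMG F E).descFactorial r : ℝ)) / (n : ℝ) ^ (2 * m)
        - ((n.choose k : ℝ) * m.choose l * (a / (n : ℝ) ^ (2 * l))) ^ r|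
      ≤ (n : ℝ) ^ (r * k) * (∑ e ∈ Finset.range (r * l), (m : ℝ) ^ e * (2 ^ e) ^ r) *
          (a / (n : ℝ) ^ (2 * l)) ^ r +
        ∑ x ∈ (Finset.range (r * k + 1) ×ˢ Finset.range (r * l + 1)).filter
          (fun x => l * x.1 < k * x.2),
          ((2 ^ x.1) ^ r * (2 ^ x.2) ^ r * (x.1 : ℝ) ^ (2 * x.2)) *
            ((n : ℝ) ^ x.1 * (m : ℝ) ^ x.2 / (n : ℝ) ^ (2 * x.2)) := by
  have hn' : (0 : ℝ) < n := by exact_mod_cast Nat.pos_of_ne_zero hn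
  have hN : (0 : ℝ) < (n : ℝ) ^ (2 * m) := by positivity
  have hsum : ∑ E : Fin m → Fin n × Fin n, ((countSubMG F E).descFactorial r : ℝ)
      = ∑ E : Fin m → Fin n × Fin n,
          ((Finset.univ.filter fun q : Fin r → Finset (Fin n) × Finset (Fin m) =>
            (Function.Injective q ∧ ∀ i, SubMGIso F E (q i)) ∧
              Pairwise fun i j => Disjoint (q i).2 (q j).2).card : ℝ) +
        ∑ E : Fin m → Fin n × Fin n,
          ((Finset.univ.filter fun q : Fin r → Finset (Fin n) × Finset (Fin m) =>
            (Function.Injective q ∧ ∀ i, SubMGIso F E (q i)) ∧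
              ¬Pairwise fun i j => Disjoint (q i).2 (q j).2).card : ℝ) := by
    rw [← Finset.sum_add_distrib]
    refine Finset.sum_congr rfl fun E _ => ?_
    rw [countSubMG_eq_card, ← card_filter_injective_mem, ← Nat.cast_add]
    congr 1
    rw [← Finset.filter_filter _ (fun q => Pairwise _),
      ← Finset.filter_filter _ (fun q => ¬Pairwise _),
      Finset.card_filter_add_card_filter_not]
    simp
  have hbad := sum_card_not_pairwise_disjoint_le (m := m) hF hn r
  have hbad0 : 0 ≤ ∑ E : Fin m → Fin n × Fin n,
          ((Finset.univ.filter fun q : Fin r → Finset (Fin n) × Finset (Fin m) =>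
            (Function.Injective q ∧ ∀ i, SubMGIso F E (q i)) ∧
              ¬Pairwise fun i j => Disjoint (q i).2 (q j).2).card : ℝ) :=
    Finset.sum_nonneg fun _ _ => Nat.cast_nonneg _
  have hgood := abs_card_pairwise_disjoint_sub_le k l n m r
  rw [hsum, sum_card_pairwise_disjoint_eq F hl hn r, add_div, mul_div_cancel_right₀ _ hN.ne',
    add_sub_right_comm, ← ha, mul_pow _ ((a : ℝ) / _), ← sub_mul]
  refine (abs_add_le _ _).trans (add_le_add ?_ ?_)
  · have h0 : (0 : ℝ) ≤ (a / (n : ℝ) ^ (2 * l)) ^ r := by positivity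
    rw [abs_mul, abs_of_nonneg h0]
    exact mul_le_mul_of_nonneg_right hgood h0
  · rw [abs_of_nonneg (div_nonneg hbad0 hN.le), div_le_iff₀ hN]
    exact hbad

/-! ### Asymptotics in the critical regime -/

lemma pow_mul_pow_div_pow_eq {n : ℕ} (hn : n ≠ 0) (m d : ℝ) (v e : ℕ) :
    (n : ℝ) ^ v * m ^ e / (n : ℝ) ^ (2 * e)
      = (m / (n : ℝ) ^ ((2 : ℝ) - 1 / d)) ^ e * (n : ℝ) ^ ((v : ℝ) - e / d) := by
  have hn' : (0 : ℝ) < n := by exact_mod_cast Nat.pos_of_ne_zero hn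
  have h : (n : ℝ) ^ v / (n : ℝ) ^ (2 * e)
      = (n : ℝ) ^ ((v : ℝ) - e / d) / ((n : ℝ) ^ ((2 : ℝ) - 1 / d)) ^ e := by
    rw [← Real.rpow_natCast, ← Real.rpow_natCast, ← Real.rpow_natCast, ← Real.rpow_mul hn'.le,
      ← Real.rpow_sub hn', ← Real.rpow_sub hn']
    congr 1
    push_cast
    ring
  calc _ = m ^ e * ((n : ℝ) ^ v / (n : ℝ) ^ (2 * e)) := by ring
    _ = _ := by rw [h, div_pow]; ring

section Critical

variable {k l : ℕ} {d c : ℝ} {m : ℕ → ℕ}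

lemma tendsto_critical_zero (hk : 0 < k) (hl : 0 < l) (hd : d = (l : ℝ) / k)
    (hm : Tendsto (fun n : ℕ => (m n : ℝ) / (n : ℝ) ^ ((2 : ℝ) - 1 / d)) atTop (nhds c))
    {v e : ℕ} (hve : l * v < k * e) :
    Tendsto (fun n : ℕ => (n : ℝ) ^ v * (m n : ℝ) ^ e / (n : ℝ) ^ (2 * e)) atTop (nhds 0) := by
  have hk' : (0 : ℝ) < k := by exact_mod_cast hk
  have hl' : (0 : ℝ) < l := by exact_mod_cast hl
  have hexp : 0 < (e : ℝ) / d - v := by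
    have h : (l : ℝ) * v < k * e := by exact_mod_cast hve
    rw [hd, div_div_eq_mul_div, sub_pos, lt_div_iff₀ hl']
    linarith
  have h := (hm.pow e).mul ((tendsto_rpow_neg_atTop hexp).comp tendsto_natCast_atTop_atTop)
  rw [mul_zero] at h
  refine h.congr' ?_
  filter_upwards [eventually_ne_atTop 0] with n hn
  rw [pow_mul_pow_div_pow_eq hn _ d]
  simp

lemma tendsto_critical (hk : 0 < k) (hl : 0 < l) (hd : d = (l : ℝ) / k)
    (hm : Tendsto (fun n : ℕ => (m n : ℝ) / (n : ℝ) ^ ((2 : ℝ) - 1 / d)) atTop (nhds c))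
    (r : ℕ) :
    Tendsto (fun n : ℕ => (n : ℝ) ^ (r * k) * (m n : ℝ) ^ (r * l) / (n : ℝ) ^ (2 * (r * l)))
      atTop (nhds (c ^ (r * l))) := by
  have hk' : (0 : ℝ) < k := by exact_mod_cast hk
  have hl' : (0 : ℝ) < l := by exact_mod_cast hl
  refine (hm.pow (r * l)).congr' ?_
  filter_upwards [eventually_ne_atTop 0] with n hn
  have hexp : ((r * k : ℕ) : ℝ) - ((r * l : ℕ) : ℝ) / d = 0 := by
    rw [hd]; push_cast; field_simp; ring
  rw [pow_mul_pow_div_pow_eq hn _ d, hexp, Real.rpow_zero, mul_one]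

lemma tendsto_mean (hk : 0 < k) (hl : 0 < l) (hd : d = (l : ℝ) / k)
    (hminf : Tendsto m atTop atTop)
    (hm : Tendsto (fun n : ℕ => (m n : ℝ) / (n : ℝ) ^ ((2 : ℝ) - 1 / d)) atTop (nhds c))
    (a : ℝ) :
    Tendsto (fun n : ℕ => (n.choose k : ℝ) * (m n).choose l * (a / (n : ℝ) ^ (2 * l))) atTop
      (nhds (a * c ^ l / (k.factorial * l.factorial))) := by
  have h1 := isEquivalent_choose k
  have h2 := (isEquivalent_choose l).comp_tendsto hminf
  have h3 := (h1.mul h2).mul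
    (IsEquivalent.refl (u := fun n : ℕ => a / (n : ℝ) ^ (2 * l)) (l := atTop))
  refine h3.symm.tendsto_nhds ?_
  have h4 := (tendsto_critical hk hl hd hm 1).const_mul (a / (k.factorial * l.factorial))
  simp only [one_mul] at h4
  convert h4 using 2
  · simp only [Pi.mul_apply, Function.comp_apply]
    ring
  · ring

lemma tendsto_factorialMoment {F : Fin l → Fin k × Fin k} (hk : 0 < k) (hl : 1 ≤ l)
    (hF : StrictlyBalancedMG F) (hd : d = (l : ℝ) / k) {a : ℕ}
    (ha : a = Set.ncard {E' : Fin l → Fin k × Fin k | MGIso F E'})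
    (hminf : Tendsto m atTop atTop)
    (hm : Tendsto (fun n : ℕ => (m n : ℝ) / (n : ℝ) ^ ((2 : ℝ) - 1 / d)) atTop (nhds c))
    (r : ℕ) :
    Tendsto (fun n : ℕ => (∑ E : Fin (m n) → Fin n × Fin n,
        ((countSubMG F E).descFactorial r : ℝ)) / (n : ℝ) ^ (2 * m n)) atTop
      (nhds ((a * c ^ l / (k.factorial * l.factorial)) ^ r)) := by
  have hmean := (tendsto_mean hk hl hd hminf hm a).pow r
  have hdisj : Tendsto (fun n : ℕ => (n : ℝ) ^ (r * k) *
      (∑ e ∈ Finset.range (r * l), (m n : ℝ) ^ e * (2 ^ e) ^ r) * (a / (n : ℝ) ^ (2 * l)) ^ r)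
      atTop (nhds 0) := by
    have hterm : ∀ e ∈ Finset.range (r * l), Tendsto (fun n : ℕ =>
        ((n : ℝ) ^ (r * k) * (m n : ℝ) ^ (r * l) / (n : ℝ) ^ (2 * (r * l))) *
          ((m n : ℝ) ^ e / (m n : ℝ) ^ (r * l)) * ((2 ^ e) ^ r * (a : ℝ) ^ r)) atTop (nhds 0) := by
      intro e he
      have h1 := (tendsto_pow_div_pow_atTop_zero (𝕜 := ℝ) (Finset.mem_range.1 he)).comp
        (tendsto_natCast_atTop_atTop.comp hminf)
      have h2 := ((tendsto_critical hk hl hd hm r).mul h1).mul_const ((2 ^ e) ^ r * (a : ℝ) ^ r)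
      simpa using h2
    have hsum := tendsto_finsetSum _ hterm
    rw [Finset.sum_const_zero] at hsum
    refine hsum.congr' ?_
    filter_upwards [hminf.eventually_ne_atTop 0] with n hmn
    have hmn' : (m n : ℝ) ≠ 0 := by exact_mod_cast hmn
    rw [Finset.mul_sum, Finset.sum_mul]
    refine Finset.sum_congr rfl fun e _ => ?_
    have : 2 * (r * l) = 2 * l * r := by ring
    rw [div_pow, this, pow_mul _ (2 * l)]
    field_simp
  have hbad : Tendsto (fun n : ℕ =>
      ∑ x ∈ (Finset.range (r * k + 1) ×ˢ Finset.range (r * l + 1)).filter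
          (fun x => l * x.1 < k * x.2),
          ((2 ^ x.1) ^ r * (2 ^ x.2) ^ r * (x.1 : ℝ) ^ (2 * x.2)) *
            ((n : ℝ) ^ x.1 * (m n : ℝ) ^ x.2 / (n : ℝ) ^ (2 * x.2))) atTop (nhds 0) := by
    have hsum := tendsto_finsetSum
      ((Finset.range (r * k + 1) ×ˢ Finset.range (r * l + 1)).filter
          (fun x => l * x.1 < k * x.2)) fun x hx =>
        (tendsto_critical_zero hk hl hd hm (Finset.mem_filter.1 hx).2).const_mul
          ((2 ^ x.1) ^ r * (2 ^ x.2) ^ r * (x.1 : ℝ) ^ (2 * x.2))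
    simpa only [mul_zero, Finset.sum_const_zero] using hsum
  have herr := hdisj.add hbad
  rw [add_zero] at herr
  have hdiff : Tendsto (fun n : ℕ => (∑ E : Fin (m n) → Fin n × Fin n,
        ((countSubMG F E).descFactorial r : ℝ)) / (n : ℝ) ^ (2 * m n) -
        ((n.choose k : ℝ) * (m n).choose l * (a / (n : ℝ) ^ (2 * l))) ^ r) atTop (nhds 0) := by
    refine squeeze_zero_norm' ?_ herr
    filter_upwards [eventually_ne_atTop 0] with n hn
    exact abs_factorialMoment_sub_le hl hF hn r ha
  simpa using hdiff.add hmean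

end Critical

/-- Poisson limit law for the number of copies of a strictly balanced
multigraph F of density d in a uniform random (n, m(n))-multigraph with
m(n) ~ c n^(2 − 1/d); the parameter is λ = a_F c^(m(F)) / (n(F)!·m(F)!). -/
theorem stmt9 {kF lF : ℕ} (F : Fin lF → Fin kF × Fin kF) (hlF : 1 ≤ lF)
    (hbal : StrictlyBalancedMG F)
    (d : ℝ) (hd : d = (lF : ℝ) / kF)
    (aF : ℕ) (haF : aF = Set.ncard {E' : Fin lF → Fin kF × Fin kF | MGIso F E'})
    (c : ℝ) (hc : 0 < c)
    (m : ℕ → ℕ) (hminf : Tendsto m atTop atTop)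
    (hm : Tendsto (fun n : ℕ => (m n : ℝ) / (n : ℝ) ^ ((2 : ℝ) - 1 / d)) atTop (nhds c))
    (lam : ℝ) (hlam : lam = aF * c ^ lF / (kF.factorial * lF.factorial)) :
    ∀ t : ℕ,
      Tendsto (fun n : ℕ =>
          (Set.ncard {E : Fin (m n) → Fin n × Fin n | countSubMG F E = t} : ℝ) /
            (n : ℝ) ^ (2 * m n)) atTop
        (nhds (lam ^ t * Real.exp (-lam) / t.factorial)) := by
  intro t
  have hk : 0 < kF := Fin.pos (F ⟨0, hlF⟩).1
  rw [hlam]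
  refine tendsto_poisson_of_bonferroni
    (fun r => tendsto_factorialMoment hk hlF hbal hd haF hminf hm r) fun J => ?_
  filter_upwards [eventually_ne_atTop 0] with n hn
  have hN : (0 : ℝ) < (n : ℝ) ^ (2 * m n) := by
    have : (0 : ℝ) < n := by exact_mod_cast Nat.pos_of_ne_zero hn
    positivity
  have hcard : (Set.ncard {E : Fin (m n) → Fin n × Fin n | countSubMG F E = t} : ℝ)
      = ∑ E : Fin (m n) → Fin n × Fin n, if countSubMG F E = t then (1 : ℝ) else 0 := by
    rw [Finset.sum_boole, Set.ncard_eq_toFinset_card']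
    congr 2
    ext; simp
  have hswap : ∑ j ∈ Finset.range J, (-1) ^ j *
        ((∑ E : Fin (m n) → Fin n × Fin n, ((countSubMG F E).descFactorial (t + j) : ℝ)) /
          (n : ℝ) ^ (2 * m n)) / (t.factorial * j.factorial)
      = (∑ E : Fin (m n) → Fin n × Fin n, ∑ j ∈ Finset.range J, (-1) ^ j *
          ((countSubMG F E).descFactorial (t + j) : ℝ) / (t.factorial * j.factorial)) /
          (n : ℝ) ^ (2 * m n) := by
    rw [Finset.sum_comm, Finset.sum_div]
    refine Finset.sum_congr rfl fun j _ => ?_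
    rw [← Finset.sum_div, ← Finset.mul_sum]
    ring
  rw [hcard, hswap, ← sub_div, ← Finset.sum_sub_distrib, abs_div, abs_of_pos hN,
    div_right_comm, Finset.sum_div]
  refine div_le_div_of_nonneg_right ?_ hN.le
  exact (Finset.abs_sum_le_sum_abs _ _).trans
    (Finset.sum_le_sum fun E _ => abs_indicator_sub_sum_descFactorial_le _ t J)
end

section
/- Let F be a strictly balanced simple graph with density d, l ≥ 1 edges, and aut(F) automorphisms (graph automorphisms of F). Let c > 0 and let m = m(n) be a sequence of integers with m(n) → ∞, m(n) ≤ choose(n,2) for all n, and m(n)/n^{2 − 1/d} → c. Let G be a uniformly random (n, m(n))-graph. Then the number G[F] of subgraphs of G isomorphic to F converges in distribution to a Poisson law of parameter λ = (2c)^l / aut(F); that is, for every t ∈ ℕ, P(G[F] = t) → λ^t e^{−λ} / t! as n → ∞. -/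
open scoped Classical
open Filter Asymptotics

open Finset in
/-- Bonferroni's inequalities for the indicator of zero, in absolute value form. -/
lemma abs_ite_eq_zero_sub_alternating_sum_choose_le (y J : ℕ) :
    |(if y = 0 then (1 : ℝ) else 0) - ∑ j ∈ range J, (-1 : ℝ) ^ j * (y.choose j : ℝ)| ≤
      (y.choose J : ℝ) := by
  cases J with
  | zero => cases y <;> simp
  | succ J =>
    cases y with
    | zero => rw [sum_range_succ']; simp
    | succ y =>
      have h : ∑ j ∈ range (J + 1), (-1 : ℝ) ^ j * ((y + 1).choose j : ℝ) =
          (-1) ^ J * (y.choose J : ℝ) := by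
        exact_mod_cast congrArg (Int.cast (R := ℝ))
          (Int.alternating_sum_range_choose_eq_choose (n := y) (m := J))
      rw [h, Nat.choose_succ_succ]
      simp [abs_mul]

open Finset in
/-- Bonferroni's inequalities for the indicator of `x = t`, in absolute value form. -/
lemma abs_ite_eq_sub_alternating_sum_choose_le (x t J : ℕ) :
    |(if x = t then (1 : ℝ) else 0) -
        ∑ j ∈ range J, (-1 : ℝ) ^ j * ((t + j).choose t : ℝ) * (x.choose (t + j) : ℝ)| ≤
      ((t + J).choose t : ℝ) * (x.choose (t + J) : ℝ) := by
  have key (j : ℕ) : ((t + j).choose t : ℝ) * (x.choose (t + j) : ℝ) =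
      x.choose t * (x - t).choose j := by
    have := Nat.choose_mul (n := x) (k := t + j) (s := t) (by omega)
    rw [Nat.add_sub_cancel_left] at this
    rw [mul_comm]
    exact_mod_cast this
  rcases lt_or_ge x t with hx | hx
  · simp [hx.ne, Nat.choose_eq_zero_of_lt, hx, Nat.lt_add_right]
  · have h := abs_ite_eq_zero_sub_alternating_sum_choose_le (x - t) J
    have h0 : (if x = t then (1 : ℝ) else 0) =
        x.choose t * (if x - t = 0 then (1 : ℝ) else 0) := by
      by_cases hxt : x = t
      · simp [hxt]
      · simp [hxt, show x - t ≠ 0 by omega]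
    simp_rw [mul_assoc, key]
    have h1 : ∑ j ∈ range J, (-1 : ℝ) ^ j * (x.choose t * ((x - t).choose j : ℝ)) =
        x.choose t * ∑ j ∈ range J, (-1 : ℝ) ^ j * ((x - t).choose j : ℝ) := by
      rw [mul_sum]
      exact sum_congr rfl fun j _ => by ring
    rw [h0, h1, ← mul_sub, abs_mul, Nat.abs_cast]
    gcongr

open Finset in
/-- The method of binomial moments: if the `r`-th binomial moment of a sequence of counting
variables on finite uniform spaces tends to `lam ^ r / r!` for every `r`, then the variables
converge in distribution to the Poisson law of parameter `lam`. -/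
lemma tendsto_poisson_of_tendsto_binomial_moments {Ω : ℕ → Type*} (s : ∀ n, Finset (Ω n))
    (X : ∀ n, Ω n → ℕ) (lam : ℝ)
    (h : ∀ r : ℕ, Tendsto (fun n => (∑ ω ∈ s n, ((X n ω).choose r : ℝ)) / #(s n)) atTop
      (nhds (lam ^ r / r.factorial))) (t : ℕ) :
    Tendsto (fun n => (#{ω ∈ s n | X n ω = t} : ℝ) / #(s n)) atTop
      (nhds (lam ^ t * Real.exp (-lam) / t.factorial)) := by
  set B : ℕ → ℕ → ℝ := fun r n => (∑ ω ∈ s n, ((X n ω).choose r : ℝ)) / #(s n) with hB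
  have hbound (J n : ℕ) : |(#{ω ∈ s n | X n ω = t} : ℝ) / #(s n) -
      ∑ j ∈ range J, (-1 : ℝ) ^ j * ((t + j).choose t : ℝ) * B (t + j) n| ≤
        ((t + J).choose t : ℝ) * B (t + J) n := by
    have h1 : (#{ω ∈ s n | X n ω = t} : ℝ) / #(s n) -
        ∑ j ∈ range J, (-1 : ℝ) ^ j * ((t + j).choose t : ℝ) * B (t + j) n =
        (∑ ω ∈ s n, ((if X n ω = t then (1 : ℝ) else 0) - ∑ j ∈ range J, (-1 : ℝ) ^ j *
          ((t + j).choose t : ℝ) * ((X n ω).choose (t + j) : ℝ))) / #(s n) := by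
      rw [sum_sub_distrib, sub_div, sum_comm, sum_div (range J)]
      simp [hB, ← mul_sum, mul_div_assoc]
    rw [h1, abs_div, Nat.abs_cast, hB, ← mul_div_assoc, mul_sum]
    gcongr
    exact (abs_sum_le_sum_abs _ _).trans
      (sum_le_sum fun ω _ => abs_ite_eq_sub_alternating_sum_choose_le _ _ _)
  have hcoef (j : ℕ) : ((t + j).choose t : ℝ) * (lam ^ (t + j) / (t + j).factorial) =
      lam ^ t / t.factorial * (lam ^ j / j.factorial) := by
    rw [Nat.cast_add_choose]
    have h1 : ((t + j).factorial : ℝ) ≠ 0 := by positivity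
    have h2 : (t.factorial : ℝ) ≠ 0 := by positivity
    have h3 : (j.factorial : ℝ) ≠ 0 := by positivity
    field_simp
    ring
  have hpartial : Tendsto (fun J => ∑ j ∈ range J, (-1 : ℝ) ^ j * ((t + j).choose t : ℝ) *
      (lam ^ (t + j) / (t + j).factorial)) atTop
      (nhds (lam ^ t * Real.exp (-lam) / t.factorial)) := by
    have h1 := (NormedSpace.expSeries_div_hasSum_exp (-lam)).tendsto_sum_nat.const_mul
      (lam ^ t / t.factorial)
    rw [← Real.exp_eq_exp_ℝ] at h1
    convert h1 using 2 with J
    · rw [mul_sum]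
      refine sum_congr rfl fun j _ => ?_
      rw [mul_assoc, hcoef, neg_pow lam]
      ring
    · ring
  have herr : Tendsto (fun J => ((t + J).choose t : ℝ) * (lam ^ (t + J) / (t + J).factorial))
      atTop (nhds 0) := by
    simp_rw [hcoef]
    simpa using (FloorSemiring.tendsto_pow_div_factorial_atTop lam).const_mul
      (lam ^ t / t.factorial)
  rw [Metric.tendsto_nhds]
  intro ε hε
  obtain ⟨J, hJ1, hJ2⟩ := ((Metric.tendsto_nhds.1 hpartial (ε / 3) (by positivity)).and
    (herr.eventually_lt_const (show (0 : ℝ) < ε / 3 by positivity))).exists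
  have hlim : Tendsto (fun n => ∑ j ∈ range J, (-1 : ℝ) ^ j * ((t + j).choose t : ℝ) *
      B (t + j) n) atTop (nhds (∑ j ∈ range J, (-1 : ℝ) ^ j * ((t + j).choose t : ℝ) *
      (lam ^ (t + j) / (t + j).factorial))) :=
    tendsto_finsetSum _ fun j _ => (h (t + j)).const_mul _
  filter_upwards [Metric.tendsto_nhds.1 hlim (ε / 3) (by positivity),
    ((h (t + J)).const_mul ((t + J).choose t : ℝ)).eventually_lt_const hJ2] with n hn1 hn2
  have hn3 := hbound J n
  rw [Real.dist_eq, abs_lt] at *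
  rw [abs_le] at hn3
  constructor <;> linarith [hn3.1, hn3.2, hn1.1, hn1.2, hJ1.1, hJ1.2]

open Finset in
/-- The copies of `F` in the complete graph on `Fin n`. -/
noncomputable def copiesSG {k : ℕ} (F : SimpleGraph (Fin k)) (n : ℕ) :
    Finset (Finset (Fin n) × Finset (Sym2 (Fin n))) :=
  {p | SubgraphIso F p}

lemma mem_copiesSG {k n : ℕ} {F : SimpleGraph (Fin k)}
    {p : Finset (Fin n) × Finset (Sym2 (Fin n))} : p ∈ copiesSG F n ↔ SubgraphIso F p := by
  simp [copiesSG]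

/-- The copy of `F` that is the image of an embedding of its vertex set. -/
noncomputable def imageSG {k n : ℕ} (F : SimpleGraph (Fin k)) (σ : Fin k ↪ Fin n) :
    Finset (Fin n) × Finset (Sym2 (Fin n)) :=
  (Finset.univ.map σ, F.edgeFinset.map σ.sym2Map)

lemma subgraphIso_iff_exists_imageSG {k n : ℕ} {F : SimpleGraph (Fin k)}
    {p : Finset (Fin n) × Finset (Sym2 (Fin n))} :
    SubgraphIso F p ↔ ∃ σ : Fin k ↪ Fin n, imageSG F σ = p := by
  refine exists_congr fun σ => ?_
  rw [eq_comm (a := imageSG F σ), Prod.ext_iff, ← Finset.coe_inj, ← Finset.coe_inj]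
  simp [imageSG]

lemma adj_iff_of_imageSG_eq {k n : ℕ} {F : SimpleGraph (Fin k)} {σ τ : Fin k ↪ Fin n}
    (h : imageSG F σ = imageSG F τ) {a b a' b' : Fin k} (ha : σ a = τ a') (hb : σ b = τ b') :
    F.Adj a b ↔ F.Adj a' b' := by
  have key (ρ : Fin k ↪ Fin n) (x y : Fin k) :
      s(ρ x, ρ y) ∈ (imageSG F ρ).2 ↔ F.Adj x y := by
    have : s(ρ x, ρ y) = ρ.sym2Map s(x, y) := rfl
    rw [this, imageSG, Finset.mem_map']
    simp
  rw [← key σ, ← key τ, ha, hb, h]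

open Finset in
/-- The embeddings with the same image as `σ` are the compositions of `σ` with automorphisms. -/
lemma card_filter_imageSG_eq {k n : ℕ} (F : SimpleGraph (Fin k)) (σ : Fin k ↪ Fin n) :
    #{τ : Fin k ↪ Fin n | imageSG F τ = imageSG F σ} = Nat.card (F ≃g F) := by
  have : Finite (F ≃g F) := Finite.of_injective _ RelIso.toEquiv_injective
  have := Fintype.ofFinite (F ≃g F)
  rw [Nat.card_eq_fintype_card, ← Finset.card_univ]
  symm
  refine card_bij (fun α _ => α.toEquiv.toEmbedding.trans σ) ?_ ?_ ?_
  · intro α _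
    rw [mem_filter_univ]
    ext x
    · simp only [imageSG, Finset.mem_map, mem_univ, true_and]
      exact ⟨fun ⟨a, ha⟩ => ⟨α a, ha⟩, fun ⟨a, ha⟩ => ⟨α.symm a, by simpa using ha⟩⟩
    · induction x with | _ u v
      have (ρ : Fin k ↪ Fin n) : s(u, v) ∈ (imageSG F ρ).2 ↔
          ∃ a b, F.Adj a b ∧ ρ a = u ∧ ρ b = v := by
        simp only [imageSG, Finset.mem_map, SimpleGraph.mem_edgeFinset]
        constructor
        · rintro ⟨e, he, h⟩
          induction e with | _ a b
          change s(ρ a, ρ b) = s(u, v) at h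
          rw [Sym2.eq_iff] at h
          rcases h with h | h
          · exact ⟨a, b, he, h⟩
          · exact ⟨b, a, he.symm, h.2, h.1⟩
        · rintro ⟨a, b, hab, rfl, rfl⟩
          exact ⟨s(a, b), hab, rfl⟩
      rw [this, this]
      constructor
      · rintro ⟨a, b, hab, h⟩
        exact ⟨α a, α b, α.map_adj_iff.2 hab, h⟩
      · rintro ⟨a, b, hab, h⟩
        exact ⟨α.symm a, α.symm b, α.symm.map_adj_iff.2 hab, by simpa using h⟩
  · intro α _ β _ h
    refine RelIso.ext fun x => σ.injective ?_
    exact congrArg (fun f : Fin k ↪ Fin n => f x) h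
  · intro τ hτ
    rw [mem_filter_univ] at hτ
    have hex (x : Fin k) : ∃ y, σ y = τ x := by
      have : τ x ∈ (imageSG F τ).1 := by simp [imageSG]
      rw [hτ] at this
      simpa [imageSG] using this
    choose f hf using hex
    have hinj : Function.Injective f := fun x y hxy => by
      apply τ.injective
      rw [← hf, ← hf, hxy]
    refine ⟨⟨Equiv.ofBijective f (Finite.injective_iff_bijective.1 hinj), ?_⟩, mem_univ _, ?_⟩
    · intro a b
      exact (adj_iff_of_imageSG_eq hτ (hf a).symm (hf b).symm).symm
    · ext x
      simp [hf]

open Finset in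
lemma card_copiesSG_mul {k : ℕ} (F : SimpleGraph (Fin k)) (n : ℕ) :
    #(copiesSG F n) * Nat.card (F ≃g F) = n.descFactorial k := by
  have h1 : Fintype.card (Fin k ↪ Fin n) = n.descFactorial k := by
    simp [Fintype.card_embedding_eq]
  rw [← h1, ← Finset.card_univ, card_eq_sum_card_fiberwise (f := imageSG F) (t := copiesSG F n),
    sum_const_nat]
  · intro p hp
    obtain ⟨σ, rfl⟩ := subgraphIso_iff_exists_imageSG.1 (mem_copiesSG.1 hp)
    exact card_filter_imageSG_eq F σ
  · intro σ _
    exact mem_copiesSG.2 (subgraphIso_iff_exists_imageSG.2 ⟨σ, rfl⟩)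

lemma SubgraphIso.mem_of_mem_edge {k n : ℕ} {F : SimpleGraph (Fin k)}
    {p : Finset (Fin n) × Finset (Sym2 (Fin n))} (hp : SubgraphIso F p) :
    ∀ e ∈ p.2, ∀ v ∈ e, v ∈ p.1 := by
  obtain ⟨σ, rfl⟩ := subgraphIso_iff_exists_imageSG.1 hp
  intro e he v hv
  obtain ⟨e, -, rfl⟩ := Finset.mem_map.1 he
  obtain ⟨a, -, rfl⟩ := Sym2.mem_map.1 hv
  simp [imageSG]

lemma SubgraphIso.not_isDiag {k n : ℕ} {F : SimpleGraph (Fin k)}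
    {p : Finset (Fin n) × Finset (Sym2 (Fin n))} (hp : SubgraphIso F p) :
    ∀ e ∈ p.2, ¬ e.IsDiag := by
  obtain ⟨σ, rfl⟩ := subgraphIso_iff_exists_imageSG.1 hp
  intro e he
  obtain ⟨e, he', rfl⟩ := Finset.mem_map.1 he
  have := SimpleGraph.not_isDiag_of_mem_edgeFinset he'
  rwa [Function.Embedding.sym2Map_apply, Sym2.isDiag_map σ.injective]

lemma SubgraphIso.card_fst {k n : ℕ} {F : SimpleGraph (Fin k)}
    {p : Finset (Fin n) × Finset (Sym2 (Fin n))} (hp : SubgraphIso F p) : p.1.card = k := by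
  obtain ⟨σ, rfl⟩ := subgraphIso_iff_exists_imageSG.1 hp
  simp [imageSG]

lemma SubgraphIso.card_snd {k n : ℕ} {F : SimpleGraph (Fin k)}
    {p : Finset (Fin n) × Finset (Sym2 (Fin n))} (hp : SubgraphIso F p) :
    p.2.card = F.edgeSet.ncard := by
  obtain ⟨σ, rfl⟩ := subgraphIso_iff_exists_imageSG.1 hp
  rw [imageSG, Finset.card_map, ← SimpleGraph.coe_edgeFinset, Set.ncard_coe_finset]

open Finset in
lemma card_filter_powersetCard_superset_mul {α : Type*} [DecidableEq α] (D A : Finset α)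
    (hA : A ⊆ D) (m : ℕ) :
    #{E ∈ powersetCard m D | A ⊆ E} * (#D).choose #A = (#D).choose m * m.choose #A := by
  rcases le_or_gt #A m with h | h
  · have h1 : #{E ∈ powersetCard m D | A ⊆ E} = #(powersetCard (m - #A) (D \ A)) := by
      refine card_nbij' (fun E => E \ A) (fun E => E ∪ A) ?_ ?_ ?_ ?_
      · intro E hE
        simp only [coe_filter, Set.mem_ofPred_eq, mem_powersetCard] at hE
        simp only [mem_coe, mem_powersetCard]
        exact ⟨sdiff_subset_sdiff hE.1.1 le_rfl, by rw [card_sdiff_of_subset hE.2, hE.1.2]⟩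
      · intro E hE
        simp only [mem_coe, mem_powersetCard] at hE
        have hd : Disjoint E A := disjoint_of_subset_left hE.1 sdiff_disjoint
        simp only [coe_filter, Set.mem_ofPred_eq, mem_powersetCard]
        refine ⟨⟨union_subset (hE.1.trans sdiff_subset) hA, ?_⟩, subset_union_right⟩
        rw [card_union_of_disjoint hd, hE.2]
        omega
      · intro E hE
        simp only [coe_filter, Set.mem_ofPred_eq] at hE
        exact sdiff_union_of_subset hE.2
      · intro E hE
        simp only [mem_coe, mem_powersetCard] at hE
        have hd : Disjoint E A := disjoint_of_subset_left hE.1 sdiff_disjoint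
        exact union_sdiff_cancel_right hd
    rw [h1, card_powersetCard, card_sdiff_of_subset hA, Nat.choose_mul h, mul_comm]
  · rw [Nat.choose_eq_zero_of_lt h, mul_zero, filter_eq_empty_iff.2]
    · simp
    · intro E hE hAE
      have := card_le_card hAE
      rw [(mem_powersetCard.1 hE).2] at this
      omega

open Finset in
/-- The graphs on `Fin n` with exactly `m` edges. -/
noncomputable def graphsWithEdges (n m : ℕ) : Finset (SimpleGraph (Fin n)) :=
  {G | G.edgeSet.ncard = m}

open Finset in
lemma card_filter_graphsWithEdges_superset (n m : ℕ) (A : Finset (Sym2 (Fin n))) :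
    #{G ∈ graphsWithEdges n m | (A : Set (Sym2 (Fin n))) ⊆ G.edgeSet} =
      #{E ∈ powersetCard m (⊤ : SimpleGraph (Fin n)).edgeFinset | A ⊆ E} := by
  have hn (G : SimpleGraph (Fin n)) : G.edgeSet.ncard = #G.edgeFinset := by
    rw [← SimpleGraph.coe_edgeFinset, Set.ncard_coe_finset]
  refine card_bij (fun G _ => G.edgeFinset) ?_ ?_ ?_
  · intro G hG
    simp only [graphsWithEdges, mem_filter, mem_univ, true_and, mem_powersetCard] at hG ⊢
    refine ⟨⟨SimpleGraph.edgeFinset_mono le_top, by rw [← hn, hG.1]⟩, ?_⟩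
    intro e he
    exact SimpleGraph.mem_edgeFinset.2 (hG.2 he)
  · intro G _ H _ h
    exact SimpleGraph.edgeFinset_inj.1 h
  · intro E hE
    simp only [mem_filter, mem_powersetCard] at hE
    obtain ⟨G, hG⟩ : ∃ G : SimpleGraph (Fin n), G.edgeSet = E := by
      refine ⟨SimpleGraph.fromEdgeSet E, ?_⟩
      rw [SimpleGraph.edgeSet_fromEdgeSet, sdiff_eq_left, Set.disjoint_left]
      intro e he hd
      exact SimpleGraph.not_isDiag_of_mem_edgeFinset (hE.1.1 he) hd
    refine ⟨G, ?_, ?_⟩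
    · simp only [graphsWithEdges, mem_filter, mem_univ, true_and, hG, Set.ncard_coe_finset]
      exact ⟨hE.1.2, by exact_mod_cast hE.2⟩
    · ext e
      rw [SimpleGraph.mem_edgeFinset, hG, mem_coe]

open Finset in
lemma card_graphsWithEdges (n m : ℕ) : #(graphsWithEdges n m) = (n.choose 2).choose m := by
  have h := card_filter_graphsWithEdges_superset n m ∅
  simp only [coe_empty, Set.empty_subset, filter_true, empty_subset, card_powersetCard,
    SimpleGraph.card_edgeFinset_top_eq_card_choose_two, Fintype.card_fin] at h
  exact h

open Finset in
/-- The probability that a uniformly random graph with `m` edges contains a given edge set. -/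
lemma card_filter_graphsWithEdges_superset_div {n m : ℕ} (hm : m ≤ n.choose 2)
    (A : Finset (Sym2 (Fin n))) (hA : ∀ e ∈ A, ¬ e.IsDiag) :
    (#{G ∈ graphsWithEdges n m | (A : Set (Sym2 (Fin n))) ⊆ G.edgeSet} : ℝ) /
      #(graphsWithEdges n m) = (m.choose #A : ℝ) / (n.choose 2).choose #A := by
  have hD : #(⊤ : SimpleGraph (Fin n)).edgeFinset = n.choose 2 := by
    rw [SimpleGraph.card_edgeFinset_top_eq_card_choose_two, Fintype.card_fin]
  have hAD : A ⊆ (⊤ : SimpleGraph (Fin n)).edgeFinset := fun e he => by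
    simpa using hA e he
  have h := card_filter_powersetCard_superset_mul _ A hAD m
  rw [← card_filter_graphsWithEdges_superset, hD] at h
  have h1 := Nat.choose_pos hm
  have h2 := Nat.choose_pos (hD ▸ card_le_card hAD)
  rw [card_graphsWithEdges, div_eq_div_iff (by positivity) (by positivity),
    mul_comm (m.choose _ : ℝ)]
  exact_mod_cast h

open Finset in
lemma countSubSG_eq_card {k n : ℕ} (F : SimpleGraph (Fin k)) (G : SimpleGraph (Fin n)) :
    countSubSG F G = #{p ∈ copiesSG F n | (p.2 : Set (Sym2 (Fin n))) ⊆ G.edgeSet} := by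
  rw [countSubSG, ← Set.ncard_coe_finset]
  congr 1
  ext p
  simp only [IsSubgraphPair, Set.mem_ofPred_eq, coe_filter, mem_copiesSG]
  exact ⟨fun h => ⟨h.2, h.1.1⟩, fun h => ⟨⟨h.2, h.1.mem_of_mem_edge⟩, h.1⟩⟩

open Finset in
lemma choose_countSubSG_eq_card {k n : ℕ} (F : SimpleGraph (Fin k)) (G : SimpleGraph (Fin n))
    (r : ℕ) : (countSubSG F G).choose r = #{s ∈ powersetCard r (copiesSG F n) |
      ((s.biUnion Prod.snd : Finset (Sym2 (Fin n))) : Set (Sym2 (Fin n))) ⊆ G.edgeSet} := by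
  rw [countSubSG_eq_card, ← card_powersetCard]
  congr 1
  ext s
  simp only [mem_powersetCard, mem_filter, subset_iff, coe_biUnion, Set.iUnion_subset_iff, mem_coe]
  grind

open Finset in
/-- The binomial moments of the number of copies of `F` in a uniformly random graph with `m`
edges, as a sum over families of copies. -/
lemma sum_choose_countSubSG_div {k n m : ℕ} (F : SimpleGraph (Fin k)) (hm : m ≤ n.choose 2)
    (r : ℕ) : (∑ G ∈ graphsWithEdges n m, ((countSubSG F G).choose r : ℝ)) /
      #(graphsWithEdges n m) = ∑ s ∈ powersetCard r (copiesSG F n),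
        (m.choose #(s.biUnion Prod.snd) : ℝ) / (n.choose 2).choose #(s.biUnion Prod.snd) := by
  have h : ∑ G ∈ graphsWithEdges n m, ((countSubSG F G).choose r : ℝ) =
      ∑ s ∈ powersetCard r (copiesSG F n), (#{G ∈ graphsWithEdges n m |
        ((s.biUnion Prod.snd : Finset (Sym2 (Fin n))) : Set (Sym2 (Fin n))) ⊆ G.edgeSet} : ℝ) := by
    simp_rw [choose_countSubSG_eq_card, card_filter]
    push_cast
    exact sum_comm
  rw [h, sum_div]
  refine sum_congr rfl fun s hs => card_filter_graphsWithEdges_superset_div hm _ fun e he => ?_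
  obtain ⟨p, hp, he⟩ := mem_biUnion.1 he
  exact (mem_copiesSG.1 ((mem_powersetCard.1 hs).1 hp)).not_isDiag e he

open Finset in
/-- A nonempty proper subgraph of a copy of a strictly balanced graph has smaller density. -/
lemma StrictlyBalancedSG.mul_card_lt {k n : ℕ} {F : SimpleGraph (Fin k)}
    (hF : StrictlyBalancedSG F) {p q : Finset (Fin n) × Finset (Sym2 (Fin n))}
    (hp : SubgraphIso F p) (h1 : q.1 ⊆ p.1) (h2 : q.2 ⊆ p.2) (hq : ∀ e ∈ q.2, ∀ v ∈ e, v ∈ q.1)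
    (hne : q.1.Nonempty) (hqp : q ≠ p) : k * #q.2 < F.edgeSet.ncard * #q.1 := by
  obtain ⟨σ, rfl⟩ := subgraphIso_iff_exists_imageSG.1 hp
  obtain ⟨V, -, hV⟩ := subset_map_iff.1 h1
  obtain ⟨E, hE, hE'⟩ := subset_map_iff.1 h2
  have hVpos : 0 < #V := by
    rw [hV, map_nonempty] at hne
    exact hne.card_pos
  have hk : 0 < k := by
    have := card_le_univ V
    rw [Fintype.card_fin] at this
    omega
  have h := hF (V, E) ⟨fun e he => SimpleGraph.mem_edgeFinset.1 (hE he), ?_⟩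
    (card_pos.1 hVpos) ?_
  · rw [div_lt_div_iff₀ (by exact_mod_cast hVpos) (by exact_mod_cast hk)] at h
    rw [hV, hE', card_map, card_map, mul_comm k]
    exact_mod_cast h
  · intro e he v hv
    have := hq (σ.sym2Map e) (by rw [hE']; exact mem_map_of_mem _ he) (σ v)
      (Sym2.mem_map.2 ⟨v, hv, rfl⟩)
    rw [hV] at this
    exact (mem_map' σ).1 this
  · rintro ⟨hV1, hE1⟩
    apply hqp
    have hV2 : V = univ := by exact_mod_cast hV1
    have hE2 : E = F.edgeFinset := by
      ext e
      rw [SimpleGraph.mem_edgeFinset, ← hE1, mem_coe]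
    exact Prod.ext (by rw [hV, hV2]; rfl) (by rw [hE', hE2]; rfl)

open Finset in
lemma StrictlyBalancedSG.mul_card_le {k n : ℕ} {F : SimpleGraph (Fin k)}
    (hF : StrictlyBalancedSG F) {p q : Finset (Fin n) × Finset (Sym2 (Fin n))}
    (hp : SubgraphIso F p) (h1 : q.1 ⊆ p.1) (h2 : q.2 ⊆ p.2)
    (hq : ∀ e ∈ q.2, ∀ v ∈ e, v ∈ q.1) : k * #q.2 ≤ F.edgeSet.ncard * #q.1 := by
  by_cases hqp : q = p
  · rw [hqp, hp.card_fst, hp.card_snd, mul_comm]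
  rcases q.1.eq_empty_or_nonempty with h | h
  · have : q.2 = ∅ := by
      refine eq_empty_of_forall_notMem fun e he => ?_
      have := hq e he _ e.out_fst_mem
      simp [h] at this
    simp [this]
  · exact (hF.mul_card_lt hp h1 h2 hq h hqp).le

open Finset in
lemma forall_mem_biUnion_of_mem_edge {k n : ℕ} {F : SimpleGraph (Fin k)}
    {s : Finset (Finset (Fin n) × Finset (Sym2 (Fin n)))} (hs : s ⊆ copiesSG F n) :
    ∀ e ∈ s.biUnion Prod.snd, ∀ v ∈ e, v ∈ s.biUnion Prod.fst := by
  intro e he v hv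
  obtain ⟨p, hp, he⟩ := mem_biUnion.1 he
  exact mem_biUnion.2 ⟨p, hp, (mem_copiesSG.1 (hs hp)).mem_of_mem_edge e he v hv⟩

open Finset in
/-- A union of copies of a strictly balanced graph, two of which overlap, has density larger
than the graph. -/
lemma StrictlyBalancedSG.lt_mul_card_biUnion {k n : ℕ} {F : SimpleGraph (Fin k)}
    (hF : StrictlyBalancedSG F) {p q : Finset (Fin n) × Finset (Sym2 (Fin n))}
    (hp : p ∈ copiesSG F n) (hq : q ∈ copiesSG F n) (hpq : p ≠ q) (h : ¬ Disjoint p.1 q.1)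
    {s : Finset (Finset (Fin n) × Finset (Sym2 (Fin n)))} (hs : s ⊆ copiesSG F n)
    (hps : p ∈ s) (hqs : q ∈ s) :
    F.edgeSet.ncard * #(s.biUnion Prod.fst) < k * #(s.biUnion Prod.snd) := by
  suffices H : ∀ u : Finset (Finset (Fin n) × Finset (Sym2 (Fin n))), u ⊆ copiesSG F n →
      F.edgeSet.ncard * #((u ∪ {p, q}).biUnion Prod.fst) <
        k * #((u ∪ {p, q}).biUnion Prod.snd) by
    have := H s hs
    rwa [union_eq_left.2 (by grind)] at this
  intro u
  induction u using Finset.induction_on with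
  | empty =>
    intro _
    rw [mem_copiesSG] at hp hq
    have h1 := card_union_add_card_inter p.1 q.1
    have h2 := card_union_add_card_inter p.2 q.2
    rw [hp.card_fst, hq.card_fst] at h1
    rw [hp.card_snd, hq.card_snd] at h2
    have h3 := hF.mul_card_lt hp (q := (p.1 ∩ q.1, p.2 ∩ q.2)) inter_subset_left
      inter_subset_left (fun e he v hv => mem_inter.2
        ⟨hp.mem_of_mem_edge e (mem_inter.1 he).1 v hv,
          hq.mem_of_mem_edge e (mem_inter.1 he).2 v hv⟩)
      (not_disjoint_iff_nonempty_inter.1 h) (fun heq => hpq ?_)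
    · simp only [empty_union, biUnion_insert, singleton_biUnion]
      nlinarith
    · have h4 := congrArg Prod.fst heq
      have h5 := congrArg Prod.snd heq
      exact Prod.ext
        (eq_of_subset_of_card_le (inter_eq_left.1 h4) (by rw [hp.card_fst, hq.card_fst]))
        (eq_of_subset_of_card_le (inter_eq_left.1 h5) (by rw [hp.card_snd, hq.card_snd]))
  | insert a u _ ih =>
    intro hu
    rw [insert_subset_iff] at hu
    have ih := ih hu.2
    have ha := mem_copiesSG.1 hu.1
    set w := u ∪ {p, q} with hw
    have hws : w ⊆ copiesSG F n := by
      rw [hw]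
      grind
    have h1 := card_union_add_card_inter a.1 (w.biUnion Prod.fst)
    have h2 := card_union_add_card_inter a.2 (w.biUnion Prod.snd)
    rw [ha.card_fst] at h1
    rw [ha.card_snd] at h2
    have h3 := hF.mul_card_le ha (q := (a.1 ∩ w.biUnion Prod.fst, a.2 ∩ w.biUnion Prod.snd))
      inter_subset_left inter_subset_left (fun e he v hv => mem_inter.2
        ⟨ha.mem_of_mem_edge e (mem_inter.1 he).1 v hv,
          forall_mem_biUnion_of_mem_edge hws e (mem_inter.1 he).2 v hv⟩)
    rw [insert_union, ← hw, biUnion_insert, biUnion_insert]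
    nlinarith

open Finset in
lemma card_biUnion_snd_of_pairwise_disjoint {k n r : ℕ} {F : SimpleGraph (Fin k)}
    {s : Finset (Finset (Fin n) × Finset (Sym2 (Fin n)))} (hs : s ∈ powersetCard r (copiesSG F n))
    (h : ∀ p ∈ s, ∀ q ∈ s, p ≠ q → Disjoint p.1 q.1) :
    #(s.biUnion Prod.snd) = r * F.edgeSet.ncard := by
  rw [mem_powersetCard] at hs
  rw [card_biUnion, sum_const_nat fun p hp => (mem_copiesSG.1 (hs.1 hp)).card_snd, hs.2]
  intro p hp q hq hpq
  rw [Function.onFun, disjoint_left]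
  intro e he he'
  exact disjoint_left.1 (h p hp q hq hpq)
    ((mem_copiesSG.1 (hs.1 hp)).mem_of_mem_edge e he _ e.out_fst_mem)
    ((mem_copiesSG.1 (hs.1 hq)).mem_of_mem_edge e he' _ e.out_fst_mem)

open Finset in
/-- The number of families of copies of `F` that span exactly `v` vertices is `O(n ^ v)`. -/
lemma card_filter_card_biUnion_fst_le {k : ℕ} (F : SimpleGraph (Fin k)) (n r v : ℕ) :
    #{s ∈ powersetCard r (copiesSG F n) | #(s.biUnion Prod.fst) = v} ≤
      2 ^ (2 ^ v * 2 ^ (v + 1).choose 2) * n ^ v := by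
  have hsub : {s ∈ powersetCard r (copiesSG F n) | #(s.biUnion Prod.fst) = v} ⊆
      (powersetCard v (univ : Finset (Fin n))).biUnion
        fun V => (V.powerset ×ˢ V.sym2.powerset).powerset := by
    intro s hs
    rw [mem_filter, mem_powersetCard] at hs
    refine mem_biUnion.2 ⟨s.biUnion Prod.fst, mem_powersetCard.2 ⟨subset_univ _, hs.2⟩,
      mem_powerset.2 fun p hp => mem_product.2 ⟨mem_powerset.2 ?_, mem_powerset.2 ?_⟩⟩
    · exact subset_biUnion_of_mem Prod.fst hp
    · intro e he
      rw [mem_sym2_iff]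
      exact forall_mem_biUnion_of_mem_edge hs.1.1 e (mem_biUnion.2 ⟨p, hp, he⟩)
  refine (card_le_card hsub).trans (card_biUnion_le.trans ?_)
  rw [sum_const_nat (m := 2 ^ (2 ^ v * 2 ^ (v + 1).choose 2)), card_powersetCard, card_univ,
    Fintype.card_fin, mul_comm]
  · gcongr
    exact Nat.choose_le_pow _ _
  · intro V hV
    rw [card_powerset, card_product, card_powerset, card_powerset, card_sym2,
      (mem_powersetCard.1 hV).2]

open Finset in
/-- The `r`-th binomial moment differs from its contribution from disjoint copies by at most the
expected number of overlapping families, grouped by numbers of vertices and edges. -/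
lemma StrictlyBalancedSG.abs_sum_sub_le {k : ℕ} {F : SimpleGraph (Fin k)}
    (hF : StrictlyBalancedSG F) (n r : ℕ) (w : ℕ → ℝ) (hw : ∀ e, 0 ≤ w e) :
    |∑ s ∈ powersetCard r (copiesSG F n), w #(s.biUnion Prod.snd) -
        (#(copiesSG F n)).choose r * w (r * F.edgeSet.ncard)| ≤
      ∑ v ∈ range (r * k + 1), ∑ e ∈ range (r * F.edgeSet.ncard + 1) with
        F.edgeSet.ncard * v < k * e,
          (2 : ℝ) ^ (2 ^ v * 2 ^ (v + 1).choose 2) * ((n : ℝ) ^ v * w e) := by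
  set l := F.edgeSet.ncard with hl
  set Q : ℕ → ℝ := fun v => ∑ e ∈ range (r * l + 1) with l * v < k * e, w e with hQ
  have hQ0 (v : ℕ) : 0 ≤ Q v := sum_nonneg fun e _ => hw e
  have hQle {v e : ℕ} (he : e ≤ r * l) (hve : l * v < k * e) : w e ≤ Q v :=
    single_le_sum (f := w) (fun e _ => hw e)
      (mem_filter.2 ⟨mem_range.2 (by omega), hve⟩)
  have hpoint : ∀ s ∈ powersetCard r (copiesSG F n),
      |w #(s.biUnion Prod.snd) - w (r * l)| ≤ Q #(s.biUnion Prod.fst) := by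
    intro s hs
    by_cases hd : ∀ p ∈ s, ∀ q ∈ s, p ≠ q → Disjoint p.1 q.1
    · rw [card_biUnion_snd_of_pairwise_disjoint hs hd, ← hl, sub_self, abs_zero]
      exact hQ0 _
    · push Not at hd
      obtain ⟨p, hp, q, hq, hpq, hd⟩ := hd
      rw [mem_powersetCard] at hs
      have h1 := hF.lt_mul_card_biUnion (hs.1 hp) (hs.1 hq) hpq hd hs.1 hp hq
      have h2 : #(s.biUnion Prod.snd) ≤ r * l := by
        rw [← hs.2]
        exact card_biUnion_le_card_mul _ _ _ fun p hp => (mem_copiesSG.1 (hs.1 hp)).card_snd.le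
      have h3 := hQle h2 h1
      have h4 := hQle le_rfl (h1.trans_le (Nat.mul_le_mul_left k h2))
      exact abs_sub_le_of_nonneg_of_le (hw _) h3 (hw _) h4
  have hconst : ((#(copiesSG F n)).choose r : ℝ) * w (r * l) =
      ∑ s ∈ powersetCard r (copiesSG F n), w (r * l) := by
    rw [sum_const, card_powersetCard, nsmul_eq_mul]
  rw [hconst, ← sum_sub_distrib]
  refine (abs_sum_le_sum_abs _ _).trans ((sum_le_sum hpoint).trans ?_)
  rw [← sum_fiberwise_of_maps_to (t := range (r * k + 1)) (g := fun s => #(s.biUnion Prod.fst))]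
  · refine sum_le_sum fun v _ => ?_
    rw [sum_congr rfl fun s hs => congrArg Q (mem_filter.1 hs).2, sum_const, nsmul_eq_mul]
    simp_rw [← mul_sum, ← mul_assoc]
    refine mul_le_mul_of_nonneg_right ?_ (hQ0 v)
    exact_mod_cast card_filter_card_biUnion_fst_le F n r v
  · intro s hs
    rw [mem_powersetCard] at hs
    rw [mem_range, Nat.lt_succ_iff, ← hs.2]
    exact card_biUnion_le_card_mul _ _ _ fun p hp => (mem_copiesSG.1 (hs.1 hp)).card_fst.le

lemma tendsto_choose_div_choose_mul_pow {m N : ℕ → ℕ} (hm : Tendsto m atTop atTop)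
    (hN : Tendsto N atTop atTop) {b : ℕ → ℝ} {a : ℝ}
    (h : Tendsto (fun n => (m n : ℝ) / N n * b n) atTop (nhds a)) (e : ℕ) :
    Tendsto (fun n => ((m n).choose e : ℝ) / (N n).choose e * b n ^ e) atTop (nhds (a ^ e)) := by
  have h1 := (((isEquivalent_choose e).comp_tendsto hm).div
    ((isEquivalent_choose e).comp_tendsto hN)).mul
      (IsEquivalent.refl (u := fun n => b n ^ e) (l := atTop))
  refine h1.tendsto_nhds_iff.2 ((h.pow e).congr fun n => ?_)
  have : (e.factorial : ℝ) ≠ 0 := by positivity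
  simp only [Pi.mul_apply, Pi.div_apply, Function.comp_apply]
  rw [div_div_div_cancel_right₀ this, mul_pow, div_pow]

lemma tendsto_choose_two_atTop : Tendsto (fun n : ℕ => n.choose 2) atTop atTop := by
  refine tendsto_atTop_mono (fun n => ?_) (tendsto_sub_atTop_nat 1)
  rcases n with _ | _ | n
  · simp
  · simp
  · rw [Nat.choose_two_right, Nat.le_div_iff_mul_le two_pos, mul_comm]
    exact Nat.mul_le_mul_right _ (by omega)

lemma tendsto_sq_div_choose_two :
    Tendsto (fun n : ℕ => (n : ℝ) ^ 2 / n.choose 2) atTop (nhds 2) := by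
  have h := (IsEquivalent.refl (u := fun n : ℕ => (n : ℝ) ^ 2) (l := atTop)).div
    (isEquivalent_choose 2)
  refine h.tendsto_nhds_iff.2 (tendsto_const_nhds.congr' ?_)
  filter_upwards [eventually_gt_atTop 0] with n hn
  have : (n : ℝ) ≠ 0 := by positivity
  simp only [Pi.div_apply]
  field_simp
  norm_num

/-- If `m n ~ c * n ^ (2 - x)`, the edge probability `m n / n.choose 2` is `~ 2 * c * n ^ (-x)`. -/
lemma tendsto_div_choose_two_mul_rpow {m : ℕ → ℕ} {c x : ℝ}
    (hm : Tendsto (fun n : ℕ => (m n : ℝ) / (n : ℝ) ^ (2 - x)) atTop (nhds c)) :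
    Tendsto (fun n : ℕ => (m n : ℝ) / n.choose 2 * (n : ℝ) ^ x) atTop (nhds (2 * c)) := by
  rw [mul_comm]
  refine (hm.mul tendsto_sq_div_choose_two).congr' ?_
  filter_upwards [eventually_gt_atTop 0] with n hn
  have hn : (0 : ℝ) < n := by exact_mod_cast hn
  have h : (n : ℝ) ^ 2 = (n : ℝ) ^ (2 - x) * (n : ℝ) ^ x := by
    rw [← Real.rpow_add hn, sub_add_cancel]
    exact_mod_cast (Real.rpow_natCast (n : ℝ) 2).symm
  have h' : (n : ℝ) ^ (2 - x) ≠ 0 := by positivity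
  rw [h]
  field_simp

lemma pow_mul_eq_mul_rpow_pow_mul_rpow {n : ℕ} (hn : 0 < n) (v e : ℕ) (x y : ℝ) :
    (n : ℝ) ^ v * y = y * ((n : ℝ) ^ x) ^ e * (n : ℝ) ^ (v - e * x : ℝ) := by
  have hn : (0 : ℝ) < n := by exact_mod_cast hn
  rw [← Real.rpow_mul_natCast hn.le, mul_assoc, ← Real.rpow_add hn,
    show x * e + (v - e * x) = (v : ℝ) by ring, Real.rpow_natCast, mul_comm]

/-- The expected number of subgraphs with `v` vertices and `e` edges in the sparse regime
tends to zero when `v < e * x`. -/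
lemma tendsto_pow_mul_choose_div_choose_zero {m : ℕ → ℕ} (hminf : Tendsto m atTop atTop) {c x : ℝ}
    (hm : Tendsto (fun n : ℕ => (m n : ℝ) / (n : ℝ) ^ (2 - x)) atTop (nhds c)) {v e : ℕ}
    (hve : (v : ℝ) < e * x) :
    Tendsto (fun n : ℕ => (n : ℝ) ^ v * (((m n).choose e : ℝ) / (n.choose 2).choose e)) atTop
      (nhds 0) := by
  have h1 := tendsto_choose_div_choose_mul_pow hminf tendsto_choose_two_atTop
    (tendsto_div_choose_two_mul_rpow hm) e
  have h2 : Tendsto (fun n : ℕ => (n : ℝ) ^ (v - e * x : ℝ)) atTop (nhds 0) := by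
    have := (tendsto_rpow_neg_atTop (sub_pos.2 hve)).comp tendsto_natCast_atTop_atTop
    simpa [Function.comp_def] using this
  rw [← mul_zero ((2 * c) ^ e)]
  refine (h1.mul h2).congr' ?_
  filter_upwards [eventually_gt_atTop 0] with n hn
  exact (pow_mul_eq_mul_rpow_pow_mul_rpow hn v e x _).symm

lemma tendsto_pow_mul_choose_div_choose {m : ℕ → ℕ} (hminf : Tendsto m atTop atTop) {c x : ℝ}
    (hm : Tendsto (fun n : ℕ => (m n : ℝ) / (n : ℝ) ^ (2 - x)) atTop (nhds c)) {v e : ℕ}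
    (hve : (v : ℝ) = e * x) :
    Tendsto (fun n : ℕ => (n : ℝ) ^ v * (((m n).choose e : ℝ) / (n.choose 2).choose e)) atTop
      (nhds ((2 * c) ^ e)) := by
  refine (tendsto_choose_div_choose_mul_pow hminf tendsto_choose_two_atTop
    (tendsto_div_choose_two_mul_rpow hm) e).congr' ?_
  filter_upwards [eventually_gt_atTop 0] with n hn
  rw [pow_mul_eq_mul_rpow_pow_mul_rpow hn v e x, hve, sub_self, Real.rpow_zero, mul_one]

lemma natCard_iso_self_pos {k : ℕ} (F : SimpleGraph (Fin k)) : 0 < Nat.card (F ≃g F) := by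
  have : Finite (F ≃g F) := Finite.of_injective _ RelIso.toEquiv_injective
  have : Nonempty (F ≃g F) := ⟨RelIso.refl _⟩
  exact Nat.card_pos

lemma isEquivalent_card_copiesSG {k : ℕ} (F : SimpleGraph (Fin k)) :
    (fun n => ((copiesSG F n).card : ℝ)) ~[atTop]
      fun n : ℕ => (n : ℝ) ^ k / Nat.card (F ≃g F) := by
  have h := (isEquivalent_descFactorial k).div
    (IsEquivalent.refl (u := fun _ : ℕ => (Nat.card (F ≃g F) : ℝ)) (l := atTop))
  refine h.congr_left (Eventually.of_forall fun n => ?_)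
  have : (Nat.card (F ≃g F) : ℝ) ≠ 0 := by exact_mod_cast (natCard_iso_self_pos F).ne'
  rw [Pi.div_apply, div_eq_iff this]
  beta_reduce
  exact_mod_cast (card_copiesSG_mul F n).symm

lemma isEquivalent_choose_card_copiesSG {k : ℕ} (hk : k ≠ 0) (F : SimpleGraph (Fin k)) (r : ℕ) :
    (fun n => (((copiesSG F n).card).choose r : ℝ)) ~[atTop]
      fun n : ℕ => ((n : ℝ) ^ k / Nat.card (F ≃g F)) ^ r / r.factorial := by
  have haut : (0 : ℝ) < Nat.card (F ≃g F) := by exact_mod_cast natCard_iso_self_pos F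
  have h := isEquivalent_card_copiesSG F
  have htop : Tendsto (fun n => (copiesSG F n).card) atTop atTop := by
    rw [← tendsto_natCast_atTop_iff (R := ℝ)]
    exact h.symm.tendsto_atTop
      (((tendsto_pow_atTop hk).comp tendsto_natCast_atTop_atTop).atTop_div_const haut)
  exact ((isEquivalent_choose r).comp_tendsto htop).trans ((h.pow r).div IsEquivalent.refl)

open Finset in
/-- The binomial moments of the number of copies of a strictly balanced graph in a uniformly
random graph with `m n` edges converge to those of a Poisson law. -/
lemma StrictlyBalancedSG.tendsto_binomial_moment {k : ℕ} {F : SimpleGraph (Fin k)}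
    (hF : StrictlyBalancedSG F) (hk : k ≠ 0) (hl : F.edgeSet.ncard ≠ 0) {c : ℝ} {m : ℕ → ℕ}
    (hminf : Tendsto m atTop atTop) (hmle : ∀ n, m n ≤ n.choose 2)
    (hm : Tendsto (fun n : ℕ => (m n : ℝ) / (n : ℝ) ^ ((2 : ℝ) - k / F.edgeSet.ncard)) atTop
      (nhds c)) (r : ℕ) :
    Tendsto (fun n => (∑ G ∈ graphsWithEdges n (m n), ((countSubSG F G).choose r : ℝ)) /
        #(graphsWithEdges n (m n))) atTop
      (nhds (((2 * c) ^ F.edgeSet.ncard / Nat.card (F ≃g F)) ^ r / r.factorial)) := by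
  set l := F.edgeSet.ncard with hldef
  have hl0 : (0 : ℝ) < l := by exact_mod_cast Nat.pos_of_ne_zero hl
  set w : ℕ → ℕ → ℝ := fun n e => ((m n).choose e : ℝ) / (n.choose 2).choose e with hw
  have hmain : Tendsto (fun n => ((#(copiesSG F n)).choose r : ℝ) * w n (r * l)) atTop
      (nhds (((2 * c) ^ l / Nat.card (F ≃g F)) ^ r / r.factorial)) := by
    have h1 := (isEquivalent_choose_card_copiesSG hk F r).mul
      (IsEquivalent.refl (u := fun n => w n (r * l)) (l := atTop))
    refine h1.tendsto_nhds_iff.2 ?_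
    have h2 := (tendsto_pow_mul_choose_div_choose hminf hm (v := r * k) (e := r * l)
      (by push_cast; field_simp)).div_const ((Nat.card (F ≃g F) : ℝ) ^ r * r.factorial)
    convert h2 using 2
    · simp only [Pi.mul_apply, hw, div_pow, ← pow_mul, mul_comm k r]
      ring
    · rw [div_pow, ← pow_mul, mul_comm l r, div_div]
  have herr : Tendsto (fun n : ℕ => ∑ v ∈ range (r * k + 1), ∑ e ∈ range (r * l + 1) with
      l * v < k * e, (2 : ℝ) ^ (2 ^ v * 2 ^ (v + 1).choose 2) * ((n : ℝ) ^ v * w n e)) atTop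
      (nhds 0) := by
    rw [show (0 : ℝ) = ∑ v ∈ range (r * k + 1), ∑ e ∈ range (r * l + 1) with l * v < k * e,
      (2 : ℝ) ^ (2 ^ v * 2 ^ (v + 1).choose 2) * 0 by simp]
    refine tendsto_finsetSum _ fun v _ => tendsto_finsetSum _ fun e he => Tendsto.const_mul _ ?_
    refine tendsto_pow_mul_choose_div_choose_zero hminf hm ?_
    rw [← mul_div_assoc, lt_div_iff₀ hl0, mul_comm (v : ℝ), mul_comm (e : ℝ)]
    exact_mod_cast (mem_filter.1 he).2
  have hdiff := squeeze_zero_norm (fun n => by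
    rw [Real.norm_eq_abs]
    exact hF.abs_sum_sub_le n r (w n) fun e => by positivity) herr
  have h := hdiff.add hmain
  simp only [← hldef, sub_add_cancel, zero_add] at h
  exact h.congr fun n => (sum_choose_countSubSG_div F (hmle n) r).symm

/-- Poisson limit law for the number of copies of a strictly balanced
simple graph F of density d in a uniform random (n, m(n))-graph with
m(n) ~ c n^(2 − 1/d); the parameter is λ = (2c)^l / aut(F). -/
theorem stmt10 {k : ℕ} (F : SimpleGraph (Fin k)) (l : ℕ) (hl : l = F.edgeSet.ncard)
    (hl1 : 1 ≤ l) (hbal : StrictlyBalancedSG F)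
    (d : ℝ) (hd : d = (l : ℝ) / k)
    (autF : ℕ) (haut : autF = Nat.card (F ≃g F))
    (c : ℝ) (hc : 0 < c)
    (m : ℕ → ℕ) (hminf : Tendsto m atTop atTop) (hmle : ∀ n, m n ≤ n.choose 2)
    (hm : Tendsto (fun n : ℕ => (m n : ℝ) / (n : ℝ) ^ ((2 : ℝ) - 1 / d)) atTop (nhds c))
    (lam : ℝ) (hlam : lam = (2 * c) ^ l / autF) :
    ∀ t : ℕ,
      Tendsto (fun n : ℕ =>
          (Set.ncard {G : SimpleGraph (Fin n) |
              G.edgeSet.ncard = m n ∧ countSubSG F G = t} : ℝ) /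
            ((n.choose 2).choose (m n) : ℝ)) atTop
        (nhds (lam ^ t * Real.exp (-lam) / t.factorial)) := by
  intro t
  subst hl hd haut hlam
  have hk : k ≠ 0 := by
    rintro rfl
    have : F.edgeSet = ∅ := Set.eq_empty_of_isEmpty _
    simp [this] at hl1
  rw [one_div_div] at hm
  have h := tendsto_poisson_of_tendsto_binomial_moments (fun n => graphsWithEdges n (m n))
    (fun n => countSubSG F) _
    (hbal.tendsto_binomial_moment hk (Nat.one_le_iff_ne_zero.1 hl1) hminf hmle hm) t
  refine h.congr fun n => ?_
  rw [card_graphsWithEdges, ← Set.ncard_coe_finset]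
  congr 3
  ext G
  simp [graphsWithEdges]
end
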